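/- Let 1 < q ≤ 2, 2 < r < 2q, ε > 0, and let Ξ ⊂ ℝ⁺ be a finite set. Given real coefficients a_ω for each dyadic interval ω, let D_k(ξ) = Σ_{|ω|=2^k, ω∩Ξ≠∅} a_ω 1_ω(ξ) for k ∈ ℤ. Suppose Υ is a finite collection of pairwise disjoint subintervals of ℝ⁺ and {m_υ}_{υ∈Υ} is a collection of functions of bounded r-variation such that each m_υ is supported on υ. Then ‖ (D_k · Σ_{υ∈Υ} m_υ)_{k∈ℤ} ‖_{M^{q,*}} ≤ C_{q,r,ε} (|Ξ| + |Υ|)^{1/q − 1/r + ε} · sup_{ξ∈Ξ} ‖ (Σ_{|ω|=2^k} a_ω 1_ω(ξ))_{k∈ℤ} ‖_{V^r_k} · sup_{υ∈Υ} ‖m_υ‖_{V^r}. -/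

import Mathlib

open MeasureTheory Set Filter
open scoped ENNReal NNReal Classical BigOperators RealInnerProductSpace

noncomputable section

/-- The binary digit of `x` in position `n+1` to the left of the point
(terminating expansion for dyadic rationals). -/
def digit (n : ℤ) (x : ℝ) : ℤ := ⌊x / 2 ^ n⌋ % 2

/-- Bitwise addition `⊕` on nonnegative reals. -/
def wXor (x y : ℝ) : ℝ := ∑' n : ℤ, (((digit n x + digit n y) % 2 : ℤ) : ℝ) * 2 ^ n

/-- The `n`-th digit of the bitwise product `x ⊗ y`. -/
def wMulDigit (n : ℤ) (x y : ℝ) : ℤ :=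
  ⌊∑' m : ℤ, ((digit (n - m) x * digit m y : ℤ) : ℝ)⌋ % 2

/-- Bitwise multiplication `⊗` on nonnegative reals. -/
def wMul (x y : ℝ) : ℝ := ∑' n : ℤ, ((wMulDigit n x y : ℤ) : ℝ) * 2 ^ n

/-- The Walsh character `e(x) = exp (i π d₋₁(x))`. -/
def walshe (x : ℝ) : ℝ := (-1 : ℝ) ^ (digit (-1) x)

/-- The Walsh–Fourier transform on `ℝ⁺`; it is involutive, so it also serves
as the inverse Walsh–Fourier transform `ˇ`. -/
def walshFT (f : ℝ → ℝ) (ξ : ℝ) : ℝ := ∫ x in Set.Ici (0 : ℝ), walshe (wMul ξ x) * f x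

/-- Lebesgue measure on `ℝ⁺`. -/
def μplus : Measure ℝ := volume.restrict (Set.Ici 0)

/-- `L^p` norm (real exponent `p`) of an `ℝ≥0∞`-valued function. -/
def lpNormE (p : ℝ) (μ : Measure ℝ) (F : ℝ → ℝ≥0∞) : ℝ≥0∞ := (∫⁻ x, F x ^ p ∂μ) ^ (1 / p)

/-- The `r`-variation norm of `m` on the domain `D`. -/
def vnorm {ι E : Type*} [LinearOrder ι] [NormedAddCommGroup E] (r : ℝ) (D : Set ι)
    (m : ι → E) : ℝ≥0∞ :=
  (⨆ ξ ∈ D, (‖m ξ‖₊ : ℝ≥0∞)) +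
    ⨆ (N : ℕ) (u : Fin (N + 1) → ι) (_ : StrictMono u) (_ : ∀ i, u i ∈ D),
      (∑ i : Fin N, (‖m (u i.succ) - m (u i.castSucc)‖₊ : ℝ≥0∞) ^ r) ^ (1 / r)

/-- The Walsh `L^q`-multiplier norm. -/
def Mq (q : ℝ) (m : ℝ → ℝ) : ℝ≥0∞ :=
  ⨆ (g : ℝ → ℝ) (_ : eLpNorm g (ENNReal.ofReal q) μplus = 1),
    eLpNorm (walshFT fun ξ => m ξ * walshFT g ξ) (ENNReal.ofReal q) μplus

/-- The Walsh `L^q`-maximal-multiplier norm of a sequence of multipliers. -/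
def Mqstar (q : ℝ) (m : ℤ → ℝ → ℝ) : ℝ≥0∞ :=
  ⨆ (g : ℝ → ℝ) (_ : eLpNorm g (ENNReal.ofReal q) μplus = 1),
    lpNormE q μplus fun x => ⨆ k : ℤ, (‖walshFT (fun ξ => m k ξ * walshFT g ξ) x‖₊ : ℝ≥0∞)

/-- The `s`-variation `L^q`-multiplier norm of a sequence of multipliers. -/
def Mqs (q s : ℝ) (m : ℤ → ℝ → ℝ) : ℝ≥0∞ :=
  ⨆ (g : ℝ → ℝ) (_ : eLpNorm g (ENNReal.ofReal q) μplus = 1),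
    lpNormE q μplus fun x =>
      vnorm s (Set.univ : Set ℤ) fun k => walshFT (fun ξ => m k ξ * walshFT g ξ) x

/-- Dyadic intervals `[n 2^k, (n+1) 2^k)`. -/
def IsDyadic (I : Set ℝ) : Prop :=
  ∃ n k : ℤ, I = Set.Ico ((n : ℝ) * 2 ^ k) (((n : ℝ) + 1) * 2 ^ k)

/-- Dyadic intervals of length `2^k`. -/
def IsDyadicLen (k : ℤ) (ω : Set ℝ) : Prop :=
  ∃ n : ℤ, ω = Set.Ico ((n : ℝ) * 2 ^ k) (((n : ℝ) + 1) * 2 ^ k)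

/-- The lower half of an interval. -/
def lowerHalf (ω : Set ℝ) : Set ℝ := ω ∩ Set.Iio ((sInf ω + sSup ω) / 2)

/-- The upper half of an interval. -/
def upperHalf (ω : Set ℝ) : Set ℝ := ω ∩ Set.Ici ((sInf ω + sSup ω) / 2)

/-- A bitile `I × ω ⊆ ℝ⁺ × ℝ⁺` : a rectangle of dyadic intervals of area `2`. -/
structure Bitile where
  I : Set ℝ
  ω : Set ℝ
  hI : IsDyadic I
  hω : IsDyadic ω
  hIsub : I ⊆ Set.Ici 0
  hωsub : ω ⊆ Set.Ici 0
  harea : volume I * volume ω = 2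

/-- The `L²`-normalized Walsh wave packet of the tile `I × ω`. -/
def wavePacket (I ω : Set ℝ) (x : ℝ) : ℝ :=
  Real.sqrt (volume I).toReal * walshFT (Set.indicator ω fun _ => (1 : ℝ)) (wXor x (sInf I))

/-- `⟨f, φ_{P_l}⟩`, the pairing of `f` with the wave packet of the lower tile of `P`. -/
def walshCoef (P : Bitile) (f : ℝ → ℝ) : ℝ :=
  ∫ y in Set.Ici (0 : ℝ), f y * wavePacket P.I (lowerHalf P.ω) y

/-- The partial order on bitiles. -/
def Bitile.le (P Q : Bitile) : Prop := P.I ⊆ Q.I ∧ Q.ω ⊆ P.ω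

/-- Convexity of a set of bitiles. -/
def ConvexBitiles (S : Set Bitile) : Prop :=
  ∀ P₁ P₂ P₃ : Bitile, P₁ ∈ S → P₃ ∈ S → Bitile.le P₁ P₂ → Bitile.le P₂ P₃ → P₂ ∈ S

/-- The truncated partial Walsh-sum operator attached to a collection `Ps` of bitiles. -/
def Sk (Ps : Set Bitile) (f : ℝ → ℝ) (k : ℤ) (ξ x : ℝ) : ℝ :=
  ∑ᶠ (P : Bitile) (_ : P ∈ Ps ∧ volume P.I < 2 ^ k),
    walshCoef P f * wavePacket P.I (lowerHalf P.ω) x *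
      Set.indicator (upperHalf P.ω) (fun _ => (1 : ℝ)) ξ

/-- The partial Walsh-sum operator `S[f](ξ,x) = (f̂ 1_{[0,ξ)})ˇ(x)`. -/
def Spartial (f : ℝ → ℝ) (ξ x : ℝ) : ℝ :=
  walshFT (fun η => Set.indicator (Set.Ico 0 ξ) (fun _ => (1 : ℝ)) η * walshFT f η) x

/-- A tree of bitiles with top data `(ξtop, Itop)`. -/
structure WTree where
  carrier : Set Bitile
  ξtop : ℝ
  Itop : Set ℝ

/-- The defining conditions of a tree. -/
def IsTree (T : WTree) : Prop :=
  IsDyadic T.Itop ∧ 0 ≤ T.ξtop ∧ ∀ P ∈ T.carrier, P.I ⊆ T.Itop ∧ T.ξtop ∈ P.ω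

/-- `u`-overlapping trees. -/
def UOverlapping (T : WTree) : Prop := ∀ P ∈ T.carrier, T.ξtop ∈ upperHalf P.ω

/-- `l`-overlapping trees. -/
def LOverlapping (T : WTree) : Prop := ∀ P ∈ T.carrier, T.ξtop ∈ lowerHalf P.ω

/-- `T` is td-maximal among the trees in `Cc` : maximal with respect to inclusion among
trees in `Cc` with the same top data. -/
def TdMaximalAmong (T : WTree) (Cc : Set WTree) : Prop :=
  T ∈ Cc ∧ ∀ T' ∈ Cc, T'.ξtop = T.ξtop → T'.Itop = T.Itop →
    T.carrier ⊆ T'.carrier → T'.carrier ⊆ T.carrier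

/-- Order on the lower tiles of two bitiles. -/
def lowerLE (P Q : Bitile) : Prop := P.I ⊆ Q.I ∧ lowerHalf Q.ω ⊆ lowerHalf P.ω

/-- Strict order on the lower tiles of two bitiles. -/
def lowerLT (P Q : Bitile) : Prop := lowerLE P Q ∧ ¬ lowerLE Q P

/-- `l`-convexity of a set of bitiles. -/
def LConvex (S : Set Bitile) : Prop :=
  ∀ P P' P'' : Bitile, P ∈ S → P'' ∈ S → lowerLT P P' → lowerLT P' P'' → P' ∈ S

/-- A properly-sorted collection of `l`-overlapping trees. -/
def ProperlySorted (Ts : Set WTree) : Prop :=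
  (∀ T ∈ Ts, IsTree T ∧ LOverlapping T ∧ LConvex T.carrier) ∧
  (∀ T ∈ Ts, ∀ T' ∈ Ts, T ≠ T' → T.carrier ∩ T'.carrier = ∅) ∧
  (∀ T ∈ Ts, ∀ P ∈ T.carrier, ∀ T' ∈ Ts, (T'.Itop ∩ P.I).Nonempty → T'.ξtop ∉ upperHalf P.ω)

/-- The multiplier `𝒟_k = Σ_{|ω| = 2^k, ω ∩ Ξ ≠ ∅} a_ω 1_ω`. -/
def Dk (a : Set ℝ → ℝ) (Ξ : Set ℝ) (k : ℤ) (ξ : ℝ) : ℝ :=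
  ∑ᶠ (ω : Set ℝ) (_ : IsDyadicLen k ω ∧ (ω ∩ Ξ).Nonempty),
    a ω * Set.indicator ω (fun _ => (1 : ℝ)) ξ

/-- The sequence `k ↦ Σ_{|ω| = 2^k} a_ω 1_ω(ξ)`. -/
def dyadicSum (a : Set ℝ → ℝ) (ξ : ℝ) (k : ℤ) : ℝ :=
  ∑ᶠ (ω : Set ℝ) (_ : IsDyadicLen k ω), a ω * Set.indicator ω (fun _ => (1 : ℝ)) ξ

/-- A tile `I × ω ⊆ ℝ⁺ × ℝ⁺` : a rectangle of dyadic intervals of area `1`. -/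
structure WTile where
  I : Set ℝ
  ω : Set ℝ
  hI : IsDyadic I
  hω : IsDyadic ω
  hIsub : I ⊆ Set.Ici 0
  hωsub : ω ⊆ Set.Ici 0
  harea : volume I * volume ω = 1

/-- The subset of the phase plane occupied by a tile. -/
def WTile.carrier (p : WTile) : Set (ℝ × ℝ) := p.I ×ˢ p.ω

/-- The phase-plane projection `Π_S` associated to a region `S` which can be written as a
finite disjoint union of tiles (it is independent of the chosen tiling). -/
def phaseProj (S : Set (ℝ × ℝ)) (f : ℝ → ℝ) : ℝ → ℝ :=
  if h : ∃ ps : Set WTile, ps.Finite ∧ ps.PairwiseDisjoint WTile.carrier ∧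
      (⋃ p ∈ ps, p.carrier) = S then
    fun x => ∑ᶠ p ∈ h.choose,
      (∫ y in Set.Ici (0 : ℝ), f y * wavePacket p.I p.ω y) * wavePacket p.I p.ω x
  else 0

/-- The region of the phase plane occupied by a tree. -/
def treeRegion (T : WTree) : Set (ℝ × ℝ) := ⋃ P ∈ T.carrier, P.I ×ˢ P.ω

/-- `size(Ps, f) = sup_{T ⊆ Ps convex tree} |I_T|^{-1/2} ‖Π_T f‖_{L²}`. -/
def size (Ps : Set Bitile) (f : ℝ → ℝ) : ℝ≥0∞ :=
  ⨆ (T : WTree) (_ : IsTree T ∧ ConvexBitiles T.carrier ∧ T.carrier ⊆ Ps),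
    (volume T.Itop ^ (1 / 2 : ℝ))⁻¹ * eLpNorm (phaseProj (treeRegion T) f) 2 μplus


namespace HE

variable {n : ℕ}

/-- finite Walsh character -/
def W (ξ x : Fin n → Bool) : ℝ := ∏ i, if (ξ i = true ∧ x i = true) then -1 else 1

lemma W_comm (ξ x : Fin n → Bool) : W ξ x = W x ξ := by
  unfold W; exact Finset.prod_congr rfl fun i _ => by simp only [and_comm]

lemma W_sq (ξ x : Fin n → Bool) : W ξ x * W ξ x = 1 := by
  unfold W; rw [← Finset.prod_mul_distrib]
  exact Finset.prod_eq_one fun i _ => by split_ifs <;> norm_num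

lemma W_abs (ξ x : Fin n → Bool) : |W ξ x| = 1 := by
  have := W_sq ξ x
  rcases mul_self_eq_one_iff.mp this with h | h <;> simp [h]

/-- flip one bit -/
def flp (i : Fin n) (ξ : Fin n → Bool) : Fin n → Bool := Function.update ξ i (!ξ i)

lemma flp_flp (i : Fin n) (ξ : Fin n → Bool) : flp i (flp i ξ) = ξ := by
  unfold flp; simp

lemma flp_ne (i : Fin n) (ξ : Fin n → Bool) : flp i ξ ≠ ξ := by
  intro h; have := congrFun h i; simp [flp] at this

lemma flp_of_ne {i j : Fin n} (h : j ≠ i) (ξ : Fin n → Bool) : flp i ξ j = ξ j := by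
  simp [flp, h]

lemma W_flp (i : Fin n) (ξ x : Fin n → Bool) :
    W (flp i ξ) x = (if x i = true then -1 else 1) * W ξ x := by
  unfold W
  rw [← Finset.mul_prod_erase Finset.univ _ (Finset.mem_univ i),
    ← Finset.mul_prod_erase Finset.univ (fun i => if (ξ i = true ∧ x i = true) then (-1:ℝ) else 1)
      (Finset.mem_univ i), ← mul_assoc]
  congr 1
  · cases hx : x i <;> cases hξ : ξ i <;> simp [flp, hξ]
  · refine Finset.prod_congr rfl fun j hj => ?_
    rw [flp_of_ne (Finset.ne_of_mem_erase hj)]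

/-- frequencies in the same dyadic interval of length `2^κ` -/
def agF (κ : ℕ) (ξ η : Fin n → Bool) : Prop := ∀ i : Fin n, κ ≤ (i : ℕ) → ξ i = η i
/-- positions in the same dyadic interval -/
def agX (κ : ℕ) (x y : Fin n → Bool) : Prop := ∀ i : Fin n, (i : ℕ) < κ → x i = y i

lemma agF_refl (κ : ℕ) (ξ : Fin n → Bool) : agF κ ξ ξ := fun _ _ => rfl
lemma agF.symm {κ : ℕ} {ξ η : Fin n → Bool} (h : agF κ ξ η) : agF κ η ξ := fun i hi => (h i hi).symm
lemma agF.trans {κ : ℕ} {ξ η ζ : Fin n → Bool} (h : agF κ ξ η) (h' : agF κ η ζ) : agF κ ξ ζ :=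
  fun i hi => (h i hi).trans (h' i hi)
lemma agF.mono {κ l : ℕ} {ξ η : Fin n → Bool} (h : agF κ ξ η) (hl : κ ≤ l) : agF l ξ η :=
  fun i hi => h i (hl.trans hi)
lemma agX_refl (κ : ℕ) (ξ : Fin n → Bool) : agX κ ξ ξ := fun _ _ => rfl
lemma agX.symm {κ : ℕ} {ξ η : Fin n → Bool} (h : agX κ ξ η) : agX κ η ξ := fun i hi => (h i hi).symm
lemma agX.trans {κ : ℕ} {ξ η ζ : Fin n → Bool} (h : agX κ ξ η) (h' : agX κ η ζ) : agX κ ξ ζ :=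
  fun i hi => (h i hi).trans (h' i hi)
lemma agX.mono {κ l : ℕ} {ξ η : Fin n → Bool} (h : agX l ξ η) (hl : κ ≤ l) : agX κ ξ η :=
  fun i hi => h i (hi.trans_le hl)
lemma agX_top {x y : Fin n → Bool} : agX n x y ↔ x = y :=
  ⟨fun h => funext fun i => h i i.2, fun h => h ▸ agX_refl _ _⟩
lemma agF_zero {x y : Fin n → Bool} : agF 0 x y ↔ x = y :=
  ⟨fun h => funext fun i => h i (Nat.zero_le _), fun h => h ▸ agF_refl _ _⟩
lemma agF_comm {κ : ℕ} {ξ η : Fin n → Bool} : agF κ ξ η ↔ agF κ η ξ := ⟨agF.symm, agF.symm⟩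
lemma agX_comm {κ : ℕ} {ξ η : Fin n → Bool} : agX κ ξ η ↔ agX κ η ξ := ⟨agX.symm, agX.symm⟩

lemma agF_flp {κ : ℕ} {i : Fin n} (hi : (i : ℕ) < κ) (ξ : Fin n → Bool) : agF κ ξ (flp i ξ) := by
  intro j hj
  rw [flp_of_ne]; rintro rfl; omega
lemma agX_flp {κ : ℕ} {i : Fin n} (hi : κ ≤ (i : ℕ)) (ξ : Fin n → Bool) : agX κ ξ (flp i ξ) := by
  intro j hj
  rw [flp_of_ne]; rintro rfl; omega

lemma W_ag {κ : ℕ} {ξ η x y : Fin n → Bool} (h : agF κ ξ η) (h' : agX κ x y) :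
    W η x * W η y = W ξ x * W ξ y := by
  unfold W; rw [← Finset.prod_mul_distrib, ← Finset.prod_mul_distrib]
  refine Finset.prod_congr rfl fun i _ => ?_
  rcases lt_or_ge (i : ℕ) κ with hi | hi
  · rw [h' i hi]; split_ifs <;> norm_num
  · rw [h i hi]

lemma card_agF {κ : ℕ} (hκ : κ ≤ n) (ξ : Fin n → Bool) :
    ((Finset.univ.filter fun η => agF κ ξ η).card) = 2 ^ κ := by
  have : (Finset.univ.filter fun η => agF κ ξ η) =
      Fintype.piFinset (fun i : Fin n => if (i : ℕ) < κ then Finset.univ else {ξ i}) := by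
    ext η
    simp only [Finset.mem_filter, Finset.mem_univ, true_and, Fintype.mem_piFinset]
    unfold agF
    refine forall_congr' fun i => ?_
    by_cases h : (i : ℕ) < κ
    · simp [h]
    · simp [h, not_lt.mp h, eq_comm]
  rw [this, Fintype.card_piFinset]
  have : ∀ i : Fin n, (if (i : ℕ) < κ then (Finset.univ : Finset Bool) else {ξ i}).card =
      if (i : ℕ) < κ then 2 else 1 := fun i => by split_ifs <;> simp
  simp only [this]
  rw [Finset.prod_ite]
  simp only [Finset.prod_const, one_pow, mul_one]
  congr 1
  rw [Fin.card_filter_val_lt]; exact min_eq_right hκ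

lemma card_agX {κ : ℕ} (hκ : κ ≤ n) (ξ : Fin n → Bool) :
    ((Finset.univ.filter fun η => agX κ ξ η).card) * 2 ^ κ = 2 ^ n := by
  have : (Finset.univ.filter fun η => agX κ ξ η) =
      Fintype.piFinset (fun i : Fin n => if (i : ℕ) < κ then {ξ i} else Finset.univ) := by
    ext η
    simp only [Finset.mem_filter, Finset.mem_univ, true_and, Fintype.mem_piFinset]
    unfold agX
    refine forall_congr' fun i => ?_
    by_cases h : (i : ℕ) < κ
    · simp [h, eq_comm]
    · simp [h]
  rw [this, Fintype.card_piFinset]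
  have : ∀ i : Fin n, (if (i : ℕ) < κ then {ξ i} else (Finset.univ : Finset Bool)).card =
      if (i : ℕ) < κ then 1 else 2 := fun i => by split_ifs <;> simp
  simp only [this]
  have h2 : (2:ℕ) ^ κ = ∏ i : Fin n, if (i : ℕ) < κ then 2 else 1 := by
    rw [Finset.prod_ite]
    simp only [Finset.prod_const, one_pow, mul_one]
    congr 1
    rw [Fin.card_filter_val_lt]; exact (min_eq_right hκ).symm
  rw [h2, ← Finset.prod_mul_distrib]
  have : ∀ i : Fin n, ((if (i : ℕ) < κ then 1 else 2) * if (i : ℕ) < κ then 2 else 1) = 2 :=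
    fun i => by split_ifs <;> rfl
  simp [this]

/-- Vanishing of an invariant kernel. -/
lemma kernel_zero {κ : ℕ} {m : (Fin n → Bool) → ℝ} (hm : ∀ ξ η, agF κ ξ η → m ξ = m η)
    {x y : Fin n → Bool} (h : ¬ agX κ x y) : ∑ ξ, m ξ * (W ξ x * W ξ y) = 0 := by
  unfold agX at h; push Not at h
  obtain ⟨i, hi, hxy⟩ := h
  have key : ∑ ξ, m ξ * (W ξ x * W ξ y) = ∑ ξ, -(m ξ * (W ξ x * W ξ y)) := by
    refine Finset.sum_nbij' (flp i) (flp i) (by simp) (by simp) (fun ξ _ => flp_flp i ξ)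
      (fun ξ _ => flp_flp i ξ) fun ξ _ => ?_
    rw [W_flp, W_flp, hm ξ _ (agF_flp hi ξ)]
    cases hx : x i <;> cases hy : y i <;> simp_all
  rw [Finset.sum_neg_distrib] at key
  linarith

lemma W_orth (x y : Fin n → Bool) : ∑ ξ, W ξ x * W ξ y = if x = y then 2 ^ n else 0 := by
  split_ifs with h
  · subst h; simp [W_sq]
  · have := kernel_zero (κ := n) (m := fun _ => 1) (fun _ _ _ => rfl) (x := x) (y := y)
      (by rwa [agX_top])
    simpa using this

/-- finite Walsh transform -/
def hat (f : (Fin n → Bool) → ℝ) (ξ : Fin n → Bool) : ℝ := ∑ y, W ξ y * f y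

/-- multiplier operator -/
def T (m f : (Fin n → Bool) → ℝ) (x : Fin n → Bool) : ℝ :=
  (2 ^ n : ℝ)⁻¹ * ∑ ξ, m ξ * W ξ x * hat f ξ

lemma hat_T (m f : (Fin n → Bool) → ℝ) (ξ : Fin n → Bool) : hat (T m f) ξ = m ξ * hat f ξ := by
  have : ∀ y, W ξ y * ((2 ^ n : ℝ)⁻¹ * ∑ η, m η * W η y * hat f η) =
      ∑ η, (2 ^ n : ℝ)⁻¹ * (m η * hat f η) * (W y ξ * W y η) := by
    intro y
    rw [Finset.mul_sum, Finset.mul_sum]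
    refine Finset.sum_congr rfl fun η _ => ?_
    rw [W_comm ξ y, W_comm η y]; ring
  have e : hat (T m f) ξ = ∑ y, W ξ y * ((2 ^ n : ℝ)⁻¹ * ∑ η, m η * W η y * hat f η) := rfl
  rw [e]
  simp_rw [this]
  rw [Finset.sum_comm]
  simp_rw [← Finset.mul_sum, W_orth]
  simp only [mul_ite, mul_zero, Finset.sum_ite_eq, Finset.mem_univ, if_true]
  field_simp

lemma T_comp (m m' f : (Fin n → Bool) → ℝ) : T m (T m' f) = T (fun ξ => m ξ * m' ξ) f := by
  funext x
  unfold T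
  congr 1
  refine Finset.sum_congr rfl fun ξ _ => ?_
  have := hat_T m' f ξ
  unfold T at this
  rw [this]; ring

lemma T_kernel (m f : (Fin n → Bool) → ℝ) (x : Fin n → Bool) :
    T m f x = ∑ y, ((2 ^ n : ℝ)⁻¹ * ∑ ξ, m ξ * (W ξ x * W ξ y)) * f y := by
  unfold T hat
  simp_rw [Finset.mul_sum, Finset.sum_mul]
  rw [Finset.sum_comm]
  refine Finset.sum_congr rfl fun y _ => Finset.sum_congr rfl fun ξ _ => ?_
  ring

lemma T_one (f : (Fin n → Bool) → ℝ) : T (fun _ => 1) f = f := by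
  funext x
  rw [T_kernel]
  simp [W_orth]

lemma parseval (f g : (Fin n → Bool) → ℝ) :
    ∑ x, f x * g x = (2 ^ n : ℝ)⁻¹ * ∑ ξ, hat f ξ * hat g ξ := by
  have : ∀ x, f x = (2 ^ n : ℝ)⁻¹ * ∑ ξ, 1 * W ξ x * hat f ξ := fun x => (congrFun (T_one f) x).symm
  calc ∑ x, f x * g x = ∑ x, ((2 ^ n : ℝ)⁻¹ * ∑ ξ, 1 * W ξ x * hat f ξ) * g x :=
        Finset.sum_congr rfl fun x _ => by rw [← this x]
    _ = (2 ^ n : ℝ)⁻¹ * ∑ ξ, hat f ξ * hat g ξ := by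
      simp_rw [Finset.mul_sum, Finset.sum_mul]
      rw [Finset.sum_comm]
      refine Finset.sum_congr rfl fun ξ _ => ?_
      unfold hat
      rw [Finset.mul_sum, Finset.mul_sum]
      refine Finset.sum_congr rfl fun x _ => ?_
      ring

lemma plancherel (m f : (Fin n → Bool) → ℝ) :
    ∑ x, (T m f x) ^ 2 = (2 ^ n : ℝ)⁻¹ * ∑ ξ, m ξ ^ 2 * hat f ξ ^ 2 := by
  simp_rw [pow_two]
  rw [parseval]
  congr 1
  refine Finset.sum_congr rfl fun ξ _ => ?_
  rw [hat_T]; ring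

lemma plancherel_one (f : (Fin n → Bool) → ℝ) :
    ∑ x, f x ^ 2 = (2 ^ n : ℝ)⁻¹ * ∑ ξ, hat f ξ ^ 2 := by
  have := plancherel (fun _ => 1) f
  rw [T_one] at this
  simpa using this

/-- summed Plancherel bound -/
lemma plancherel_sum_le {ι : Type*} (s : Finset ι) (m : ι → (Fin n → Bool) → ℝ) (B : ℝ)
    (hm : ∀ ξ, ∑ i ∈ s, m i ξ ^ 2 ≤ B) (f : (Fin n → Bool) → ℝ) :
    ∑ i ∈ s, ∑ x, (T (m i) f x) ^ 2 ≤ B * ∑ x, f x ^ 2 := by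
  simp_rw [plancherel, plancherel_one f]
  rw [← Finset.mul_sum, Finset.sum_comm]
  simp_rw [← Finset.sum_mul]
  rw [mul_left_comm, Finset.mul_sum (a := B)]
  have h0 : (0:ℝ) ≤ (2 ^ n : ℝ)⁻¹ := by positivity
  refine mul_le_mul_of_nonneg_left ?_ h0
  refine Finset.sum_le_sum fun ξ _ => ?_
  exact mul_le_mul_of_nonneg_right (hm ξ) (sq_nonneg _)

lemma plancherel_le (m : (Fin n → Bool) → ℝ) (B : ℝ)
    (hm : ∀ ξ, m ξ ^ 2 ≤ B) (f : (Fin n → Bool) → ℝ) :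
    ∑ x, (T m f x) ^ 2 ≤ B * ∑ x, f x ^ 2 := by
  have := plancherel_sum_le ({()} : Finset Unit) (fun _ => m) B (fun ξ => by simpa using hm ξ) f
  simpa using this

lemma T_self_adj (m f g : (Fin n → Bool) → ℝ) : ∑ x, T m f x * g x = ∑ x, f x * T m g x := by
  rw [parseval (T m f) g, parseval f (T m g)]; congr 1
  apply Finset.sum_congr rfl; intro ξ _
  rw [hat_T, hat_T]; ring

lemma hat_add (f g : (Fin n → Bool) → ℝ) (ξ) : hat (fun x => f x + g x) ξ = hat f ξ + hat g ξ := by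
  unfold hat; rw [← Finset.sum_add_distrib]; exact Finset.sum_congr rfl fun _ _ => by ring

lemma T_add (m f g : (Fin n → Bool) → ℝ) (x) : T m (fun x => f x + g x) x = T m f x + T m g x := by
  unfold T; simp_rw [hat_add]
  rw [← mul_add, ← Finset.sum_add_distrib]; congr 1
  exact Finset.sum_congr rfl fun _ _ => by ring

lemma T_madd (m m' f : (Fin n → Bool) → ℝ) (x) :
    T (fun ξ => m ξ + m' ξ) f x = T m f x + T m' f x := by
  unfold T
  rw [← mul_add, ← Finset.sum_add_distrib]; congr 1
  exact Finset.sum_congr rfl fun _ _ => by ring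

lemma T_msub (m m' f : (Fin n → Bool) → ℝ) (x) :
    T (fun ξ => m ξ - m' ξ) f x = T m f x - T m' f x := by
  unfold T
  rw [← mul_sub, ← Finset.sum_sub_distrib]; congr 1
  exact Finset.sum_congr rfl fun _ _ => by ring

lemma T_msmul (c : ℝ) (m f : (Fin n → Bool) → ℝ) (x) :
    T (fun ξ => c * m ξ) f x = c * T m f x := by
  unfold T
  rw [mul_left_comm, Finset.mul_sum (a := c)]; congr 1
  exact Finset.sum_congr rfl fun _ _ => by ring

lemma T_mzero (f : (Fin n → Bool) → ℝ) (x) : T (fun _ => 0) f x = 0 := by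
  unfold T; simp

lemma T_zero (m : (Fin n → Bool) → ℝ) (x) : T m (fun _ => 0) x = 0 := by
  unfold T hat; simp

lemma T_msum {ι : Type*} (s : Finset ι) (m : ι → (Fin n → Bool) → ℝ) (f x) :
    T (fun ξ => ∑ i ∈ s, m i ξ) f x = ∑ i ∈ s, T (m i) f x := by
  induction s using Finset.induction_on with
  | empty => simp [T_mzero]
  | insert a s ha ih => simp_rw [Finset.sum_insert ha]; rw [T_madd, ih]

lemma T_sum {ι : Type*} (s : Finset ι) (m : (Fin n → Bool) → ℝ) (f : ι → (Fin n → Bool) → ℝ) (x) :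
    T m (fun y => ∑ i ∈ s, f i y) x = ∑ i ∈ s, T m (f i) x := by
  induction s using Finset.induction_on with
  | empty => simp [T_zero]
  | insert a s ha ih => simp_rw [Finset.sum_insert ha]; rw [T_add, ih]

/-- Locality. -/
lemma T_local {κ : ℕ} {m : (Fin n → Bool) → ℝ} (hm : ∀ ξ η, agF κ ξ η → m ξ = m η)
    {f g : (Fin n → Bool) → ℝ} {x} (hfg : ∀ y, agX κ x y → f y = g y) : T m f x = T m g x := by
  rw [T_kernel, T_kernel]
  refine Finset.sum_congr rfl fun y _ => ?_
  by_cases h : agX κ x y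
  · rw [hfg y h]
  · rw [kernel_zero hm h]; simp

/-- conditional expectation -/
def E {V : Type*} [NormedAddCommGroup V] [NormedSpace ℝ V] (κ : ℕ) (f : (Fin n → Bool) → V)
    (x : Fin n → Bool) : V :=
  ((2 ^ κ : ℝ) / 2 ^ n) • ∑ y ∈ Finset.univ.filter (fun y => agX κ x y), f y

section E
variable {V : Type*} [NormedAddCommGroup V] [InnerProductSpace ℝ V]

lemma card_agX' {κ : ℕ} (hκ : κ ≤ n) (x : Fin n → Bool) :
    ((2 ^ κ : ℝ) / 2 ^ n) * ((Finset.univ.filter fun η => agX κ x η).card : ℝ) = 1 := by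
  have := card_agX hκ x
  have h2 : ((Finset.univ.filter fun η => agX κ x η).card : ℝ) * 2 ^ κ = 2 ^ n := by exact_mod_cast this
  field_simp
  linarith

lemma filter_congr_agX {κ : ℕ} {x y : Fin n → Bool} (h : agX κ x y) :
    (Finset.univ.filter fun z => agX κ x z) = Finset.univ.filter fun z => agX κ y z := by
  ext z; simp only [Finset.mem_filter, Finset.mem_univ, true_and]
  exact ⟨fun h' => h.symm.trans h', fun h' => h.trans h'⟩

lemma E_inv {κ : ℕ} (f : (Fin n → Bool) → V) {x y} (h : agX κ x y) : E κ f x = E κ f y := by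
  unfold E; rw [filter_congr_agX h]

lemma E_adj {κ : ℕ} (hκ : κ ≤ n) (f u : (Fin n → Bool) → V) (hu : ∀ x y, agX κ x y → u x = u y) :
    ∑ x, inner ℝ (E κ f x) (u x) = ∑ x, inner ℝ (f x) (u x) := by
  unfold E
  simp_rw [inner_smul_left, sum_inner, Finset.sum_filter, Finset.mul_sum]
  rw [Finset.sum_comm]
  refine Finset.sum_congr rfl fun y _ => ?_
  rw [← Finset.mul_sum, ← Finset.sum_filter]
  have : ∀ x ∈ Finset.univ.filter (fun x => agX κ x y), inner ℝ (f y) (u x) = inner ℝ (f y) (u y) := by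
    intro x hx
    rw [hu x y (by simpa using hx)]
  rw [Finset.sum_congr rfl this, Finset.sum_const, nsmul_eq_mul, ← mul_assoc]
  simp_rw [agX_comm (η := y)]
  have := card_agX' hκ y
  simp only [conj_trivial]
  rw [this, one_mul]

lemma E_top (f : (Fin n → Bool) → V) (x) : E n f x = f x := by
  unfold E; simp [agX_top, Finset.filter_eq]

lemma E_norm_le (κ : ℕ) (f : (Fin n → Bool) → V) (x) : ‖E κ f x‖ ≤ E κ (fun y => ‖f y‖) x := by
  unfold E
  rw [norm_smul, Real.norm_of_nonneg (by positivity), smul_eq_mul]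
  gcongr
  exact norm_sum_le _ _

lemma E_tower {k l : ℕ} (hkl : k ≤ l) (hl : l ≤ n) (f : (Fin n → Bool) → ℝ) (x) :
    E k (E l f) x = E k f x := by
  have := E_adj hl f (fun y => if agX k x y then 1 else 0) (fun a b hab => by
    have : agX k x a ↔ agX k x b := ⟨fun h => h.trans (hab.mono hkl), fun h => h.trans (hab.mono hkl).symm⟩
    simp [this])
  unfold E at this ⊢
  congr 1
  rw [Finset.sum_filter, Finset.sum_filter]
  convert this using 2 <;> · simp only [inner]; split_ifs <;> simp

lemma E_mono (κ : ℕ) {f g : (Fin n → Bool) → ℝ} (h : ∀ y, f y ≤ g y) (x) : E κ f x ≤ E κ g x := by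
  unfold E
  simp only [smul_eq_mul]
  gcongr with y _
  exact h y

end E

/-- projection onto a dyadic frequency interval -/
lemma T_ind {κ : ℕ} (hκ : κ ≤ n) (ξ : Fin n → Bool) (f : (Fin n → Bool) → ℝ) (x) :
    T (fun η => if agF κ ξ η then 1 else 0) f x = W ξ x * E κ (fun y => W ξ y * f y) x := by
  rw [T_kernel]
  unfold E
  rw [smul_eq_mul, Finset.mul_sum, Finset.mul_sum, Finset.sum_filter]
  refine Finset.sum_congr rfl fun y _ => ?_
  split_ifs with h
  · have : ∑ η, (if agF κ ξ η then (1:ℝ) else 0) * (W η x * W η y) = 2 ^ κ * (W ξ x * W ξ y) := by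
      simp_rw [ite_mul, one_mul, zero_mul]
      rw [← Finset.sum_filter]
      rw [Finset.sum_congr rfl (g := fun _ => W ξ x * W ξ y)
        (fun η hη => W_ag (by simpa using hη) h)]
      rw [Finset.sum_const, card_agF hκ, nsmul_eq_mul]; norm_num
    rw [this]; field_simp
  · rw [kernel_zero (κ := κ) _ h]; · simp
    intro a b hab
    have : agF κ ξ a ↔ agF κ ξ b := ⟨fun h => h.trans hab, fun h => h.trans hab.symm⟩
    simp [this]

end HE

namespace HE

variable {n : ℕ}

lemma E_adjR {κ : ℕ} (hκ : κ ≤ n) (f u : (Fin n → Bool) → ℝ) (hu : ∀ x y, agX κ x y → u x = u y) :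
    ∑ x, E κ f x * u x = ∑ x, f x * u x := by
  have := E_adj hκ f u hu
  simp only [RCLike.inner_apply, conj_trivial] at this
  simp_rw [mul_comm _ (u _)]
  exact this

/-- running maximum -/
def rmax (h : (Fin n → Bool) → ℝ) : ℕ → (Fin n → Bool) → ℝ
  | 0 => fun x => E 0 h x
  | k + 1 => fun x => max (rmax h k x) (E (k + 1) h x)

lemma rmax_inv (h : (Fin n → Bool) → ℝ) (k : ℕ) : ∀ x y, agX k x y → rmax h k x = rmax h k y := by
  induction k with
  | zero => intro x y hxy; exact E_inv h hxy
  | succ k ih =>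
    intro x y hxy
    simp only [rmax]
    rw [ih x y (hxy.mono (Nat.le_succ k)), E_inv h hxy]

lemma rmax_ge (h : (Fin n → Bool) → ℝ) (x) : ∀ l k, k ≤ l → E k h x ≤ rmax h l x := by
  intro l
  induction l with
  | zero => intro k hk; obtain rfl : k = 0 := by omega
            exact le_rfl
  | succ l ih =>
    intro k hk
    rcases Nat.lt_or_ge l k with h1 | h1
    · obtain rfl : k = l + 1 := by omega
      exact le_max_right _ _
    · exact (ih k h1).trans (le_max_left _ _)

lemma E_nonneg (κ : ℕ) {h : (Fin n → Bool) → ℝ} (h0 : ∀ x, 0 ≤ h x) (x) : 0 ≤ E κ h x := by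
  unfold E
  exact smul_nonneg (by positivity) (Finset.sum_nonneg fun y _ => h0 y)

lemma rmax_path (h : (Fin n → Bool) → ℝ) (h0 : ∀ x, 0 ≤ h x) (x) (k : ℕ) :
    rmax h k x ^ 2 + 2 * ∑ i ∈ Finset.range k, rmax h i x * (E (i + 1) h x - E i h x)
      ≤ 2 * rmax h k x * E k h x := by
  induction k with
  | zero => simp [rmax]; nlinarith [sq_nonneg (E 0 h x)]
  | succ k ih =>
    rw [Finset.sum_range_succ]
    have hx : rmax h (k + 1) x = max (rmax h k x) (E (k + 1) h x) := rfl
    rcases le_total (rmax h k x) (E (k + 1) h x) with h1 | h1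
    · rw [hx, max_eq_right h1]
      nlinarith [sq_nonneg (E (k + 1) h x - rmax h k x)]
    · rw [hx, max_eq_left h1]
      nlinarith

lemma doob (h : (Fin n → Bool) → ℝ) (h0 : ∀ x, 0 ≤ h x) :
    ∃ Mx : (Fin n → Bool) → ℝ, (∀ x, ∀ k ≤ n, E k h x ≤ Mx x) ∧ (∀ x, 0 ≤ Mx x) ∧
      ∑ x, Mx x ^ 2 ≤ 4 * ∑ x, h x ^ 2 := by
  refine ⟨rmax h n, fun x k hk => rmax_ge h x n k hk,
    fun x => (E_nonneg 0 h0 x).trans (rmax_ge h x n 0 (Nat.zero_le _)), ?_⟩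
  have h1 : ∑ x, (rmax h n x ^ 2 + 2 * ∑ i ∈ Finset.range n, rmax h i x * (E (i + 1) h x - E i h x))
      ≤ ∑ x, 2 * rmax h n x * E n h x := Finset.sum_le_sum fun x _ => rmax_path h h0 x n
  rw [Finset.sum_add_distrib, ← Finset.mul_sum, Finset.sum_comm] at h1
  have h2 : ∑ i ∈ Finset.range n, ∑ x, rmax h i x * (E (i + 1) h x - E i h x) = 0 := by
    refine Finset.sum_eq_zero fun i hi => ?_
    have hi' : i < n := Finset.mem_range.mp hi
    have e1 := E_adjR (κ := i + 1) hi' h (rmax h i) (fun x y hxy => rmax_inv h i x y (hxy.mono (Nat.le_succ i)))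
    have e2 := E_adjR (κ := i) hi'.le h (rmax h i) (fun x y hxy => rmax_inv h i x y hxy)
    simp_rw [mul_sub, Finset.sum_sub_distrib, mul_comm (rmax h i _)]
    rw [e1, e2, sub_self]
  rw [h2, mul_zero, add_zero] at h1
  have h3 : ∑ x, 2 * rmax h n x * E n h x ≤ ∑ x, (1 / 2 * rmax h n x ^ 2 + 2 * h x ^ 2) := by
    refine Finset.sum_le_sum fun x _ => ?_
    rw [E_top]; nlinarith [sq_nonneg (rmax h n x - 2 * h x)]
  rw [Finset.sum_add_distrib, ← Finset.mul_sum, ← Finset.mul_sum] at h3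
  linarith

section recorded
variable {V : Type*} [NormedAddCommGroup V] [InnerProductSpace ℝ V]

/-- recorded process -/
def rp (F : (Fin n → Bool) → V) (δ : ℝ) : ℕ → (Fin n → Bool) → V
  | 0 => fun _ => 0
  | k + 1 => fun x => if δ * ‖E k F x‖ ≤ ‖E k F x - rp F δ k x‖ then E k F x else rp F δ k x

/-- one step of the recorded process -/
def rstep (δ : ℝ) (e w : V) : V := if δ * ‖e‖ ≤ ‖e - w‖ then e else w

lemma rp_succ (F : (Fin n → Bool) → V) (δ : ℝ) (k : ℕ) (x) :
    rp F δ (k + 1) x = rstep δ (E k F x) (rp F δ k x) := rfl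

lemma rp_inv (F : (Fin n → Bool) → V) (δ : ℝ) (k : ℕ) :
    ∀ x y, agX k x y → rp F δ (k + 1) x = rp F δ (k + 1) y := by
  induction k with
  | zero => intro x y hxy; rw [rp_succ, rp_succ, E_inv F hxy]; rfl
  | succ k ih =>
    intro x y hxy
    rw [rp_succ, rp_succ F δ (k + 1) y, ih x y (hxy.mono (Nat.le_succ k)), E_inv F hxy]

lemma rp_close (F : (Fin n → Bool) → V) {δ : ℝ} (hδ : 0 ≤ δ) (k : ℕ) (x) :
    ‖E k F x - rp F δ (k + 1) x‖ ≤ δ * ‖E k F x‖ := by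
  rw [rp]; simp only
  split_ifs with h
  · simp; positivity
  · exact (not_le.mp h).le

lemma rp_change (F : (Fin n → Bool) → V) {δ : ℝ} (k : ℕ) (x)
    (h : rp F δ (k + 1) x ≠ rp F δ k x) :
    δ * ‖E k F x‖ ≤ ‖rp F δ (k + 1) x - rp F δ k x‖ := by
  rw [rp] at h ⊢; simp only at h ⊢
  split_ifs at h ⊢ with h'
  · exact h'
  · exact absurd rfl h

lemma rp_split (F : (Fin n → Bool) → V) (δ : ℝ) (k : ℕ) (x) :
    ‖E k F x - rp F δ k x‖ ^ 2 = ‖rp F δ (k + 1) x - rp F δ k x‖ ^ 2 +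
      ‖E k F x - rp F δ (k + 1) x‖ ^ 2 := by
  rw [rp]; simp only
  split_ifs with h <;> simp

lemma rp_energy (F : (Fin n → Bool) → V) (δ : ℝ) (k : ℕ) (hk : k ≤ n) :
    ∑ j ∈ Finset.range (k + 1), ∑ x, ‖rp F δ (j + 1) x - rp F δ j x‖ ^ 2 +
      ∑ x, ‖E k F x - rp F δ (k + 1) x‖ ^ 2 = ∑ x, ‖E k F x‖ ^ 2 := by
  induction k with
  | zero =>
    simp only [zero_add, Finset.range_one, Finset.sum_singleton]
    rw [← Finset.sum_add_distrib]
    refine Finset.sum_congr rfl fun x _ => ?_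
    rw [← rp_split]; simp [rp]
  | succ k ih =>
    have ih := ih (Nat.le_of_succ_le hk)
    rw [Finset.sum_range_succ, add_assoc, ← Finset.sum_add_distrib]
    simp_rw [← rp_split F δ (k + 1)]
    have e1 := E_adj hk F (rp F δ (k + 1)) (fun x y hxy => rp_inv F δ k x y (hxy.mono (Nat.le_succ k)))
    have e2 := E_adj (Nat.le_of_succ_le hk) F (rp F δ (k + 1)) (fun x y hxy => rp_inv F δ k x y hxy)
    have e3 : ∀ l, ∑ x, ‖E l F x - rp F δ (k + 1) x‖ ^ 2 = ∑ x, ‖E l F x‖ ^ 2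
        - 2 * ∑ x, inner ℝ (E l F x) (rp F δ (k + 1) x) + ∑ x, ‖rp F δ (k + 1) x‖ ^ 2 := by
      intro l
      rw [Finset.mul_sum, ← Finset.sum_sub_distrib, ← Finset.sum_add_distrib]
      exact Finset.sum_congr rfl fun x _ => norm_sub_sq_real _ _
    rw [e3] at ih ⊢
    rw [e2] at ih
    rw [e1]
    linarith

lemma E_norm_sq_le (F : (Fin n → Bool) → V) {k : ℕ} (hk : k ≤ n) :
    ∑ x, ‖E k F x‖ ^ 2 ≤ ∑ x, ‖F x‖ ^ 2 := by
  have e1 := E_adj hk F (E k F) (fun x y hxy => E_inv F hxy)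
  have : 0 ≤ ∑ x, ‖F x - E k F x‖ ^ 2 := Finset.sum_nonneg fun _ _ => sq_nonneg _
  have e3 : ∑ x, ‖F x - E k F x‖ ^ 2 = ∑ x, ‖F x‖ ^ 2
      - 2 * ∑ x, inner ℝ (F x) (E k F x) + ∑ x, ‖E k F x‖ ^ 2 := by
    rw [Finset.mul_sum, ← Finset.sum_sub_distrib, ← Finset.sum_add_distrib]
    exact Finset.sum_congr rfl fun x _ => norm_sub_sq_real _ _
  rw [e3, ← e1] at this
  simp_rw [real_inner_self_eq_norm_sq] at this
  linarith

lemma rp_energy_le (F : (Fin n → Bool) → V) (δ : ℝ) {t : ℕ} (hk : t ≤ n) :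
    ∑ j ∈ Finset.range (t + 1), ∑ x, ‖rp F δ (j + 1) x - rp F δ j x‖ ^ 2 ≤ ∑ x, ‖F x‖ ^ 2 := by
  have := rp_energy F δ t hk
  have h2 : 0 ≤ ∑ x, ‖E t F x - rp F δ (t + 1) x‖ ^ 2 := Finset.sum_nonneg fun _ _ => sq_nonneg _
  linarith [E_norm_sq_le F hk]

/-- level processes -/
def lv (F : (Fin n → Bool) → V) (m : ℕ) (k : ℕ) (x : Fin n → Bool) : V :=
  if m = 0 then 0 else rp F (2 * (1 / 2) ^ m) k x

lemma lv_zero (F : (Fin n → Bool) → V) (m : ℕ) (x) : lv F m 0 x = 0 := by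
  unfold lv; split_ifs <;> simp [rp]

lemma lv_inv (F : (Fin n → Bool) → V) (m k : ℕ) :
    ∀ x y, agX k x y → lv F m (k + 1) x = lv F m (k + 1) y := by
  intro x y hxy; unfold lv; rw [rp_inv F _ k x y hxy]

lemma lv_inv' (F : (Fin n → Bool) → V) (m k : ℕ) :
    ∀ x y, agX k x y → lv F m k x = lv F m k y := by
  intro x y hxy
  cases k with
  | zero => rw [lv_zero, lv_zero]
  | succ k => exact lv_inv F m k x y (hxy.mono (Nat.le_succ k))

lemma lv_close (F : (Fin n → Bool) → V) (m k : ℕ) (x) :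
    ‖E k F x - lv F m (k + 1) x‖ ≤ (2 * (1 / 2) ^ m) * ‖E k F x‖ := by
  unfold lv; split_ifs with h
  · subst h; simp; linarith [norm_nonneg (E k F x)]
  · exact rp_close F (by positivity) k x

lemma lv_change (F : (Fin n → Bool) → V) (m k : ℕ) (x)
    (h : lv F m (k + 1) x ≠ lv F m k x) :
    (2 * (1 / 2) ^ m) * ‖E k F x‖ ≤ ‖lv F m (k + 1) x - lv F m k x‖ := by
  unfold lv at h ⊢; split_ifs at h ⊢ with h'
  · exact absurd rfl h
  · exact rp_change F k x h

lemma lv_energy_le (F : (Fin n → Bool) → V) (m : ℕ) {t : ℕ} (hk : t ≤ n) :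
    ∑ j ∈ Finset.range (t + 1), ∑ x, ‖lv F m (j + 1) x - lv F m j x‖ ^ 2 ≤ ∑ x, ‖F x‖ ^ 2 := by
  unfold lv; split_ifs with h
  · simp; positivity
  · exact rp_energy_le F _ hk

lemma bb_level (F : (Fin n → Bool) → V) (Φ : (Fin n → Bool) → V →ₗ[ℝ] ℝ) {t : ℕ} (ht : t ≤ n)
    (horth : ∀ u : (Fin n → Bool) → V, (∀ x y, agX t x y → u x = u y) →
      ∑ x, (Φ x (u x)) ^ 2 = ∑ x, ‖u x‖ ^ 2) (m : ℕ) :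
    ∃ Mx : (Fin n → Bool) → ℝ, (∀ x, ∀ k ≤ t,
      (Φ x (lv F (m + 1) (k + 1) x - lv F m (k + 1) x)) ^ 2 ≤ Mx x) ∧
      ∑ x, Mx x ≤ 18 * ∑ x, ‖F x‖ ^ 2 := by
  set d : ℕ → (Fin n → Bool) → V := fun k x => lv F (m + 1) k x - lv F m k x with hd
  set u : ℕ → (Fin n → Bool) → V := fun k x => if d (k + 1) x = d k x then 0 else d (k + 1) x with hu
  have key : ∀ x k, (Φ x (d k x)) ^ 2 ≤ ∑ j ∈ Finset.range k, (Φ x (u j x)) ^ 2 := by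
    intro x k
    induction k with
    | zero => simp [hd, lv_zero]
    | succ k ih =>
      rw [Finset.sum_range_succ]
      by_cases h : d (k + 1) x = d k x
      · rw [h]; linarith [sq_nonneg (Φ x (u k x))]
      · have : u k x = d (k + 1) x := by simp only [hu, if_neg h]
        rw [this]
        linarith [Finset.sum_nonneg (s := Finset.range k) (f := fun j => (Φ x (u j x)) ^ 2)
          fun j _ => sq_nonneg _]
  have hinv : ∀ j ≤ t, ∀ x y, agX t x y → u j x = u j y := by
    intro j hj x y hxy
    have h1 := hxy.mono hj
    simp only [hu, hd, lv_inv F (m+1) j x y h1, lv_inv F m j x y h1, lv_inv' F (m+1) j x y h1,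
      lv_inv' F m j x y h1]
  have hsz : ∀ j x, ‖u j x‖ ^ 2 ≤ 9 * (‖lv F (m+1) (j + 1) x - lv F (m+1) j x‖ ^ 2 +
      ‖lv F m (j + 1) x - lv F m j x‖ ^ 2) := by
    intro j x
    simp only [hu]
    split_ifs with h
    · simp; positivity
    · have hp : (0:ℝ) < (1 / 2) ^ m := by positivity
      have h1 : ‖d (j + 1) x‖ ≤ 3 * (1 / 2) ^ m * ‖E j F x‖ := by
        have := lv_close F (m + 1) j x
        have := lv_close F m j x
        have e : d (j + 1) x = (E j F x - lv F m (j + 1) x) - (E j F x - lv F (m + 1) (j + 1) x) := by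
          simp [hd]
        rw [e]
        refine (norm_sub_le _ _).trans ?_
        rw [pow_succ] at *
        nlinarith
      have h2 : lv F (m+1) (j + 1) x ≠ lv F (m+1) j x ∨ lv F m (j + 1) x ≠ lv F m j x := by
        by_contra hcon; push Not at hcon
        exact h (by simp only [hd, hcon.1, hcon.2])
      have h0 := norm_nonneg (d (j + 1) x)
      have hE := norm_nonneg (E j F x)
      rcases h2 with h2 | h2
      · have := lv_change F (m + 1) j x h2
        have h3 : ‖d (j + 1) x‖ ≤ 3 * ‖lv F (m+1) (j + 1) x - lv F (m+1) j x‖ := by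
          rw [pow_succ] at this; nlinarith
        have := pow_le_pow_left₀ h0 h3 2
        nlinarith [sq_nonneg ‖lv F m (j + 1) x - lv F m j x‖]
      · have := lv_change F m j x h2
        have h3 : ‖d (j + 1) x‖ ≤ 3 * ‖lv F m (j + 1) x - lv F m j x‖ := by
          nlinarith [mul_nonneg hp.le hE]
        have := pow_le_pow_left₀ h0 h3 2
        nlinarith [sq_nonneg ‖lv F (m+1) (j + 1) x - lv F (m+1) j x‖]
  refine ⟨fun x => ∑ j ∈ Finset.range (t + 1), (Φ x (u j x)) ^ 2, fun x k hk => ?_, ?_⟩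
  · refine (key x (k + 1)).trans ?_
    exact Finset.sum_le_sum_of_subset_of_nonneg (Finset.range_mono (by omega)) fun _ _ _ => sq_nonneg _
  · rw [Finset.sum_comm]
    have : ∀ j ∈ Finset.range (t + 1), ∑ x, (Φ x (u j x)) ^ 2 ≤
        9 * (∑ x, ‖lv F (m+1) (j + 1) x - lv F (m+1) j x‖ ^ 2 +
          ∑ x, ‖lv F m (j + 1) x - lv F m j x‖ ^ 2) := by
      intro j hj
      rw [horth (u j) (hinv j (by have := Finset.mem_range.mp hj; omega)), ← Finset.sum_add_distrib,
        Finset.mul_sum]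
      exact Finset.sum_le_sum fun x _ => hsz j x
    refine (Finset.sum_le_sum this).trans ?_
    rw [← Finset.mul_sum, Finset.sum_add_distrib]
    linarith [lv_energy_le F (m + 1) ht, lv_energy_le F m ht]

lemma bb_abs (F : (Fin n → Bool) → V) (Φ : (Fin n → Bool) → V →ₗ[ℝ] ℝ) {t : ℕ} (ht : t ≤ n)
    (horth : ∀ u : (Fin n → Bool) → V, (∀ x y, agX t x y → u x = u y) →
      ∑ x, (Φ x (u x)) ^ 2 = ∑ x, ‖u x‖ ^ 2) (R : ℕ)
    (hΦ : ∀ x v, (Φ x v) ^ 2 ≤ 4 ^ R * ‖v‖ ^ 2) :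
    ∃ Mx : (Fin n → Bool) → ℝ, (∀ x, ∀ k ≤ t, (Φ x (E k F x)) ^ 2 ≤ Mx x) ∧
      ∑ x, Mx x ≤ 18 * (R + 1) ^ 2 * ∑ x, ‖F x‖ ^ 2 := by
  choose M hM1 hM2 using fun m => bb_level F Φ ht horth m
  obtain ⟨D, hD1, hD0, hD2⟩ := doob (fun x => ‖F x‖) (fun x => norm_nonneg _)
  refine ⟨fun x => (R + 1) * (4 * D x ^ 2 + ∑ m ∈ Finset.range R, M m x), fun x k hk => ?_, ?_⟩
  · set z := Φ x (E k F x - lv F R (k + 1) x) with hz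
    set y : ℕ → ℝ := fun m => Φ x (lv F (m + 1) (k + 1) x - lv F m (k + 1) x) with hy
    have hsum : Φ x (E k F x) = z + ∑ m ∈ Finset.range R, y m := by
      simp only [hz, hy, map_sub, Finset.sum_range_sub (fun m => Φ x (lv F m (k + 1) x))]
      have : lv F 0 (k + 1) x = 0 := by simp [lv]
      rw [this]; simp
    have hz2 : z ^ 2 ≤ 4 * D x ^ 2 := by
      have h1 := lv_close F R k x
      have h2 : ‖E k F x‖ ≤ D x := (E_norm_le k F x).trans (hD1 x k (hk.trans ht))
      have h3 := hΦ x (E k F x - lv F R (k + 1) x)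
      have h4 : ‖E k F x - lv F R (k + 1) x‖ ≤ 2 * (1 / 2) ^ R * D x :=
        h1.trans (by gcongr)
      have h5 := pow_le_pow_left₀ (norm_nonneg _) h4 2
      have h6 : (4:ℝ) ^ R * (2 * (1 / 2) ^ R * D x) ^ 2 = 4 * D x ^ 2 := by
        have : (4:ℝ) ^ R * ((1 / 2) ^ R) ^ 2 = 1 := by
          rw [← pow_mul, mul_comm R 2, pow_mul, ← mul_pow]; norm_num
        linear_combination 4 * D x ^ 2 * this
      calc z ^ 2 ≤ _ := h3
        _ ≤ 4 ^ R * (2 * (1 / 2) ^ R * D x) ^ 2 := by gcongr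
        _ = _ := h6
    have hcs : (z + ∑ m ∈ Finset.range R, y m) ^ 2 ≤
        (R + 1) * (z ^ 2 + ∑ m ∈ Finset.range R, y m ^ 2) := by
      have := sq_sum_le_card_mul_sum_sq (s := Finset.range (R + 1))
        (f := fun m => if m = R then z else y m)
      rw [Finset.sum_range_succ, Finset.sum_range_succ] at this
      have e1 : ∀ m ∈ Finset.range R, (if m = R then z else y m) = y m := fun m hm => by
        rw [if_neg (by have := Finset.mem_range.mp hm; omega)]
      have e2 : ∀ m ∈ Finset.range R, (if m = R then z else y m) ^ 2 = y m ^ 2 := fun m hm => by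
        rw [e1 m hm]
      rw [Finset.sum_congr rfl e1, Finset.sum_congr rfl e2] at this
      simp at this
      linarith
    rw [hsum]
    refine hcs.trans ?_
    have h7 : ∑ m ∈ Finset.range R, y m ^ 2 ≤ ∑ m ∈ Finset.range R, M m x :=
      Finset.sum_le_sum fun m _ => hM1 m x k hk
    exact mul_le_mul_of_nonneg_left (add_le_add hz2 h7) (by positivity)
  · rw [← Finset.mul_sum, Finset.sum_add_distrib, ← Finset.mul_sum, Finset.sum_comm]
    have h1 : ∑ m ∈ Finset.range R, ∑ x, M m x ≤ ∑ m ∈ Finset.range R, 18 * ∑ x, ‖F x‖ ^ 2 :=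
      Finset.sum_le_sum fun m _ => hM2 m
    simp only [Finset.sum_const, Finset.card_range, nsmul_eq_mul] at h1
    have h0 : 0 ≤ ∑ x, ‖F x‖ ^ 2 := Finset.sum_nonneg fun _ _ => sq_nonneg _
    have hR : (0:ℝ) ≤ R := Nat.cast_nonneg R
    calc _ ≤ ((R:ℝ) + 1) * (4 * (4 * ∑ x, ‖F x‖ ^ 2) + R * (18 * ∑ x, ‖F x‖ ^ 2)) := by gcongr
      _ ≤ _ := by nlinarith [mul_nonneg hR h0]

end recorded

lemma W_flp_right (i : Fin n) (ξ x : Fin n → Bool) :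
    W ξ (flp i x) = (if ξ i = true then -1 else 1) * W ξ x := by
  rw [W_comm, W_flp, W_comm x]

lemma orth (Ξ : Finset (Fin n → Bool)) {t : ℕ} (hΞ : ∀ ξ ∈ Ξ, ∀ η ∈ Ξ, agF t ξ η → ξ = η)
    (u : (Fin n → Bool) → (Fin n → Bool) → ℝ) (hu : ∀ ξ ∈ Ξ, ∀ x y, agX t x y → u ξ x = u ξ y) :
    ∑ x, (∑ ξ ∈ Ξ, W ξ x * u ξ x) ^ 2 = ∑ x, ∑ ξ ∈ Ξ, u ξ x ^ 2 := by
  have h1 : ∀ x, (∑ ξ ∈ Ξ, W ξ x * u ξ x) ^ 2 =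
      ∑ ξ ∈ Ξ, ∑ η ∈ Ξ, (W ξ x * u ξ x) * (W η x * u η x) := by
    intro x; rw [pow_two, Finset.sum_mul_sum]
  simp_rw [h1]
  rw [Finset.sum_comm, Finset.sum_comm (s := Finset.univ)]
  refine Finset.sum_congr rfl fun ξ hξ => ?_
  rw [Finset.sum_comm, Finset.sum_eq_single ξ]
  · refine Finset.sum_congr rfl fun x _ => ?_
    linear_combination (u ξ x) ^ 2 * W_sq ξ x
  · intro η hη hne
    have : ¬ agF t ξ η := fun h => hne (hΞ ξ hξ η hη h).symm
    unfold agF at this; push Not at this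
    obtain ⟨i, hi, hne'⟩ := this
    have key : ∑ x, (W ξ x * u ξ x) * (W η x * u η x) = ∑ x, -((W ξ x * u ξ x) * (W η x * u η x)) := by
      refine Finset.sum_nbij' (flp i) (flp i) (by simp) (by simp) (fun ξ _ => flp_flp i ξ)
        (fun ξ _ => flp_flp i ξ) fun x _ => ?_
      rw [W_flp_right, W_flp_right, hu ξ hξ x _ (agX_flp hi x), hu η hη x _ (agX_flp hi x)]
      cases hx : ξ i <;> cases hy : η i <;> simp_all
    rw [Finset.sum_neg_distrib] at key
    linarith
  · intro h; exact absurd hξ h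

/-- indicator of the union of dyadic intervals meeting `Ξ`. -/
def chi (Ξ : Finset (Fin n → Bool)) (k : ℕ) (η : Fin n → Bool) : ℝ :=
  if ∃ ξ ∈ Ξ, agF k ξ η then 1 else 0

lemma exists_reps (Ξ : Finset (Fin n → Bool)) (t : ℕ) : ∃ Ξ0 ⊆ Ξ,
    (∀ ξ ∈ Ξ0, ∀ η ∈ Ξ0, agF t ξ η → ξ = η) ∧ ∀ ξ ∈ Ξ, ∃ ξ0 ∈ Ξ0, agF t ξ0 ξ := by
  set f : (Fin n → Bool) → (Fin n → Bool) := fun ξ i => if t ≤ (i:ℕ) then ξ i else false with hf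
  have hag : ∀ ξ η, f ξ = f η ↔ agF t ξ η := by
    intro ξ η
    constructor
    · intro h i hi
      have := congrFun h i
      simpa [hf, hi] using this
    · intro h; funext i
      simp only [hf]; split_ifs with hi
      · exact h i hi
      · rfl
  obtain ⟨s, hs, hs2, hs3⟩ := Finset.exists_subset_injOn_image_eq_of_surjOn Ξ (Ξ.image f) (f := f) (by simp [SurjOn])
  refine ⟨s, hs, fun ξ hξ η hη h => hs2 hξ hη ((hag _ _).2 h), fun ξ hξ => ?_⟩
  have : f ξ ∈ s.image f := by rw [hs3]; exact Finset.mem_image_of_mem f hξ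
  obtain ⟨ξ0, h1, h2⟩ := Finset.mem_image.mp this
  exact ⟨ξ0, h1, (hag _ _).1 h2⟩

end HE

namespace HE

variable {n : ℕ}

lemma chi_sq (Ξ : Finset (Fin n → Bool)) (k : ℕ) (η) : chi Ξ k η ^ 2 = chi Ξ k η := by
  unfold chi; split_ifs <;> norm_num

lemma chi_nonneg (Ξ : Finset (Fin n → Bool)) (k : ℕ) (η) : 0 ≤ chi Ξ k η := by
  unfold chi; split_ifs <;> norm_num

lemma chi_le_one (Ξ : Finset (Fin n → Bool)) (k : ℕ) (η) : chi Ξ k η ≤ 1 := by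
  unfold chi; split_ifs <;> norm_num

lemma chi_mono (Ξ : Finset (Fin n → Bool)) {k l : ℕ} (hkl : k ≤ l) (η) : chi Ξ k η ≤ chi Ξ l η := by
  unfold chi
  by_cases h : ∃ ξ ∈ Ξ, agF k ξ η
  · obtain ⟨ξ, h1, h2⟩ := h
    rw [if_pos ⟨ξ, h1, h2⟩, if_pos ⟨ξ, h1, h2.mono hkl⟩]
  · rw [if_neg h]; split_ifs <;> norm_num

lemma chi_inv (Ξ : Finset (Fin n → Bool)) {k : ℕ} {η ζ} (h : agF k η ζ) : chi Ξ k η = chi Ξ k ζ := by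
  unfold chi
  have : (∃ ξ ∈ Ξ, agF k ξ η) ↔ (∃ ξ ∈ Ξ, agF k ξ ζ) :=
    ⟨fun ⟨ξ, h1, h2⟩ => ⟨ξ, h1, h2.trans h⟩, fun ⟨ξ, h1, h2⟩ => ⟨ξ, h1, h2.trans h.symm⟩⟩
  simp only [this]

lemma chi_cases (Ξ : Finset (Fin n → Bool)) (k : ℕ) (η) :
    (chi Ξ k η = 1 ∧ ∃ ξ ∈ Ξ, agF k ξ η) ∨ chi Ξ k η = 0 := by
  unfold chi
  by_cases h : ∃ ξ ∈ Ξ, agF k ξ η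
  · left; exact ⟨if_pos h, h⟩
  · right; exact if_neg h

/-- Block Bourgain estimate. -/
lemma bb (Ξ : Finset (Fin n → Bool)) {t : ℕ} (ht : t ≤ n) (R : ℕ) (hR : Ξ.card ≤ 4 ^ R)
    (g : (Fin n → Bool) → ℝ) :
    ∃ Mx : (Fin n → Bool) → ℝ, (∀ x, ∀ k ≤ t, (∀ ξ ∈ Ξ, ∀ η ∈ Ξ, agF t ξ η → agF k ξ η) →
      (T (chi Ξ k) g x) ^ 2 ≤ Mx x) ∧ ∑ x, Mx x ≤ 18 * (R + 1) ^ 2 * ∑ x, g x ^ 2 := by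
  obtain ⟨Ξ0, hsub, hsep, hrep⟩ := exists_reps Ξ t
  let F : (Fin n → Bool) → EuclideanSpace ℝ Ξ0 := fun y =>
    WithLp.toLp 2 fun ξ => E t (fun y => W ξ.1 y * g y) y
  let Φ : (Fin n → Bool) → EuclideanSpace ℝ Ξ0 →ₗ[ℝ] ℝ := fun x =>
    { toFun := fun v => ∑ ξ : Ξ0, W ξ.1 x * v ξ
      map_add' := fun v w => by simp [mul_add, Finset.sum_add_distrib]
      map_smul' := fun c v => by simp only [PiLp.smul_apply, smul_eq_mul, RingHom.id_apply, Finset.mul_sum]; exact Finset.sum_congr rfl fun _ _ => by ring }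
  have hΦ : ∀ x v, Φ x v = ∑ ξ : Ξ0, W ξ.1 x * v ξ := fun x v => rfl
  have hchi : ∀ k ≤ t, (∀ ξ ∈ Ξ, ∀ η ∈ Ξ, agF t ξ η → agF k ξ η) →
      chi Ξ k = fun η => ∑ ξ ∈ Ξ0, if agF k ξ η then 1 else 0 := by
    intro k hk hK; funext η
    rcases chi_cases Ξ k η with ⟨h1, ξ, hξ, h2⟩ | h1
    · rw [h1]
      obtain ⟨ξ0, h3, h4⟩ := hrep ξ hξ
      have h5 : agF k ξ0 η := (hK ξ0 (hsub h3) ξ hξ h4).trans h2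
      rw [Finset.sum_eq_single ξ0, if_pos h5]
      · intro ξ1 h6 hne
        rw [if_neg]
        intro h7
        exact hne (hsep ξ1 h6 ξ0 h3 ((h7.trans h5.symm).mono hk))
      · intro h; exact absurd h3 h
    · rw [h1]; symm
      refine Finset.sum_eq_zero fun ξ hξ => ?_
      rw [if_neg]; intro h2
      unfold chi at h1
      rw [if_pos ⟨ξ, hsub hξ, h2⟩] at h1; exact one_ne_zero h1
  have hT : ∀ k ≤ t, (∀ ξ ∈ Ξ, ∀ η ∈ Ξ, agF t ξ η → agF k ξ η) → ∀ x,
      T (chi Ξ k) g x = ∑ ξ ∈ Ξ0, W ξ x * E k (fun y => W ξ y * g y) x := by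
    intro k hk hK x
    rw [hchi k hk hK, T_msum]
    exact Finset.sum_congr rfl fun ξ _ => T_ind (hk.trans ht) ξ g x
  have hEF : ∀ k ≤ t, ∀ x (ξ : Ξ0), (E k F x) ξ = E k (fun y => W ξ.1 y * g y) x := by
    intro k hk x ξ
    rw [← E_tower hk ht]
    simp only [E, PiLp.smul_apply, WithLp.ofLp_sum, Finset.sum_apply, F]
  have hΦE : ∀ k ≤ t, (∀ ξ ∈ Ξ, ∀ η ∈ Ξ, agF t ξ η → agF k ξ η) → ∀ x,
      T (chi Ξ k) g x = Φ x (E k F x) := by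
    intro k hk hK x
    rw [hT k hk hK, hΦ, ← Finset.sum_coe_sort]
    exact Finset.sum_congr rfl fun ξ _ => by rw [hEF k hk]
  have horth : ∀ u : (Fin n → Bool) → EuclideanSpace ℝ Ξ0, (∀ x y, agX t x y → u x = u y) →
      ∑ x, (Φ x (u x)) ^ 2 = ∑ x, ‖u x‖ ^ 2 := by
    intro u hu
    have := orth Ξ0 hsep (fun ξ x => if h : ξ ∈ Ξ0 then u x ⟨ξ, h⟩ else 0) (fun ξ hξ x y hxy => by
      simp only [hu x y hxy])
    simp_rw [hΦ, EuclideanSpace.norm_sq_eq, Real.norm_eq_abs, sq_abs]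
    simp_rw [← Finset.sum_coe_sort Ξ0] at this
    simpa using this
  obtain ⟨Mx, h1, h2⟩ := bb_abs F Φ ht horth R (by
    intro x v
    rw [hΦ, EuclideanSpace.norm_sq_eq]
    simp_rw [Real.norm_eq_abs, sq_abs]
    refine (Finset.sum_mul_sq_le_sq_mul_sq _ _ _).trans ?_
    have e : ∑ ξ : Ξ0, W ξ.1 x ^ 2 ≤ 4 ^ R := by
      simp_rw [pow_two, W_sq]
      simp
      exact_mod_cast (Finset.card_le_card hsub).trans hR
    exact mul_le_mul_of_nonneg_right e (Finset.sum_nonneg fun _ _ => sq_nonneg _))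
  refine ⟨Mx, fun x k hk hK => by rw [hΦE k hk hK]; exact h1 x k hk, h2.trans ?_⟩
  have hFn : ∑ x, ‖F x‖ ^ 2 ≤ ∑ x, g x ^ 2 := by
    have e1 : ∑ x, ‖F x‖ ^ 2 = ∑ x, T (chi Ξ t) g x ^ 2 := by
      rw [← horth F (fun x y hxy => by
        simp only [F]; congr 1; funext ξ; exact E_inv _ hxy)]
      refine Finset.sum_congr rfl fun x _ => ?_
      rw [hT t le_rfl (fun _ _ _ _ h => h), hΦ]
      congr 1
      exact Finset.sum_coe_sort Ξ0 (fun ξ => W ξ x * E t (fun y => W ξ y * g y) x)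
    rw [e1]
    have := plancherel_le (chi Ξ t) 1 (fun ξ => by rw [chi_sq]; exact chi_le_one _ _ _) g
    linarith
  exact mul_le_mul_of_nonneg_left hFn (by positivity)

/-- Rademacher–Menshov, numerical version. -/
lemma rm_num (R : ℕ) : ∀ (h : ℕ → ℝ) (l : ℕ), l ≤ 2 ^ R → (h l - h 0) ^ 2 ≤
    (R + 1) * ∑ ρ ∈ Finset.range (R + 1), ∑ s ∈ Finset.range (2 ^ (R - ρ)),
      (h ((s + 1) * 2 ^ ρ) - h (s * 2 ^ ρ)) ^ 2 := by
  induction R with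
  | zero =>
    intro h l hl
    have : l = 0 ∨ l = 1 := by simp at hl; omega
    rcases this with rfl | rfl
    · simp; positivity
    · simp
  | succ R ih =>
    intro h l hl
    have ih' := ih (fun s => h (2 * s)) (l / 2) (by rw [pow_succ] at hl; omega)
    rw [Finset.sum_range_succ']
    simp only [mul_zero] at ih'
    set B := ∑ ρ ∈ Finset.range (R + 1), ∑ s ∈ Finset.range (2 ^ (R - ρ)),
      (h (2 * ((s + 1) * 2 ^ ρ)) - h (2 * (s * 2 ^ ρ))) ^ 2 with hB
    have eB : ∑ ρ ∈ Finset.range (R + 1), ∑ s ∈ Finset.range (2 ^ (R + 1 - (ρ + 1))),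
      (h ((s + 1) * 2 ^ (ρ + 1)) - h (s * 2 ^ (ρ + 1))) ^ 2 = B := by
      rw [hB]
      refine Finset.sum_congr rfl fun ρ _ => ?_
      rw [Nat.add_sub_add_right]
      refine Finset.sum_congr rfl fun s _ => ?_
      congr 3 <;> ring_nf
    rw [eB]
    simp only [pow_zero, mul_one, Nat.sub_zero]
    set A := ∑ s ∈ Finset.range (2 ^ (R + 1)), (h (s + 1) - h s) ^ 2 with hA
    have hA0 : 0 ≤ A := Finset.sum_nonneg fun _ _ => sq_nonneg _
    have hB0 : 0 ≤ B := Finset.sum_nonneg fun _ _ => Finset.sum_nonneg fun _ _ => sq_nonneg _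
    have ha : (h l - h (2 * (l / 2))) ^ 2 ≤ A := by
      rcases Nat.even_or_odd' l with ⟨c, rfl | rfl⟩
      · rw [Nat.mul_div_cancel_left c (by norm_num)]; simpa using hA0
      · have e : (2 * c + 1) / 2 = c := by omega
        rw [e]
        have hm : 2 * c ∈ Finset.range (2 ^ (R + 1)) := Finset.mem_range.mpr (by omega)
        exact Finset.single_le_sum (f := fun s => (h (s + 1) - h s) ^ 2) (fun _ _ => sq_nonneg _) hm
    have hR : (0:ℝ) ≤ R := Nat.cast_nonneg R
    push_cast
    set a := h l - h (2 * (l / 2)) with haa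
    set b := h (2 * (l / 2)) - h 0 with hbb
    have e : h l - h 0 = a + b := by rw [haa, hbb]; ring
    rw [e]
    -- (a+b)^2 ≤ (R+2)(a^2 + b^2/(R+1))
    have h3 : ((R:ℝ) + 1) * (a + b) ^ 2 ≤ (R + 1) * ((R + 2) * (B + A)) := by
      have h4 : ((R:ℝ) + 1) * (R + 2) * a ^ 2 ≤ (R + 1) * (R + 2) * A := by gcongr
      have h5 : ((R:ℝ) + 2) * b ^ 2 ≤ (R + 2) * ((R + 1) * B) := by gcongr
      linarith [sq_nonneg ((R + 1) * a - b)]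
    have := le_of_mul_le_mul_left h3 (by positivity)
    linarith

lemma rm (R : ℕ) (m : ℕ → (Fin n → Bool) → ℝ) (V : ℝ) (hV : 1 ≤ V)
    (h0 : ∀ η, m 0 η ^ 2 ≤ 1)
    (hm : ∀ η, ∀ ρ, ∀ S, ∑ s ∈ Finset.range S,
      (m ((s + 1) * 2 ^ ρ) η - m (s * 2 ^ ρ) η) ^ 2 ≤ V) (f : (Fin n → Bool) → ℝ) :
    ∃ Mx : (Fin n → Bool) → ℝ, (∀ x, ∀ l ≤ 2 ^ R, (T (m l) f x) ^ 2 ≤ Mx x) ∧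
      ∑ x, Mx x ≤ 4 * (R + 1) ^ 2 * V * ∑ x, f x ^ 2 := by
  refine ⟨fun x => 2 * (T (m 0) f x) ^ 2 + 2 * ((R + 1) * ∑ ρ ∈ Finset.range (R + 1),
    ∑ s ∈ Finset.range (2 ^ (R - ρ)), (T (m ((s + 1) * 2 ^ ρ)) f x - T (m (s * 2 ^ ρ)) f x) ^ 2),
    fun x l hl => ?_, ?_⟩
  · have := rm_num R (fun l => T (m l) f x) l hl
    nlinarith [sq_nonneg (T (m l) f x - 2 * T (m 0) f x)]
  · rw [Finset.sum_add_distrib, ← Finset.mul_sum, ← Finset.mul_sum, ← Finset.mul_sum]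
    have h1 := plancherel_le (m 0) 1 h0 f
    have h2 : ∑ x, ∑ ρ ∈ Finset.range (R + 1), ∑ s ∈ Finset.range (2 ^ (R - ρ)),
        (T (m ((s + 1) * 2 ^ ρ)) f x - T (m (s * 2 ^ ρ)) f x) ^ 2 ≤ (R + 1) * (V * ∑ x, f x ^ 2) := by
      rw [Finset.sum_comm]
      have : ∀ ρ ∈ Finset.range (R + 1), ∑ x, ∑ s ∈ Finset.range (2 ^ (R - ρ)),
        (T (m ((s + 1) * 2 ^ ρ)) f x - T (m (s * 2 ^ ρ)) f x) ^ 2 ≤ V * ∑ x, f x ^ 2 := by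
        intro ρ _
        rw [Finset.sum_comm]
        simp_rw [← T_msub]
        exact plancherel_sum_le (Finset.range (2 ^ (R - ρ)))
          (fun s ξ => m ((s + 1) * 2 ^ ρ) ξ - m (s * 2 ^ ρ) ξ) V (fun ξ => hm ξ ρ _) f
      refine (Finset.sum_le_sum this).trans ?_
      simp
    have hf : 0 ≤ ∑ x, f x ^ 2 := Finset.sum_nonneg fun _ _ => sq_nonneg _
    have hR : (0:ℝ) ≤ R := Nat.cast_nonneg R
    have h3 : ((R:ℝ) + 1) * ∑ x, ∑ ρ ∈ Finset.range (R + 1), ∑ s ∈ Finset.range (2 ^ (R - ρ)),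
        (T (m ((s + 1) * 2 ^ ρ)) f x - T (m (s * 2 ^ ρ)) f x) ^ 2 ≤
        (R + 1) * ((R + 1) * (V * ∑ x, f x ^ 2)) := by gcongr
    have h4 : ∑ x, f x ^ 2 ≤ (R + 1) ^ 2 * V * ∑ x, f x ^ 2 := by
      refine le_mul_of_one_le_left hf ?_
      nlinarith
    nlinarith

/-- multiplicity -/
def cnt (Ξ : Finset (Fin n → Bool)) (k : ℕ) (ξ : Fin n → Bool) : ℕ :=
  (Ξ.filter fun η => agF k ξ η).card

lemma cnt_mono (Ξ : Finset (Fin n → Bool)) {k l : ℕ} (h : k ≤ l) (ξ) : cnt Ξ k ξ ≤ cnt Ξ l ξ := by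
  refine Finset.card_le_card fun η hη => ?_
  simp only [Finset.mem_filter] at hη ⊢
  exact ⟨hη.1, hη.2.mono h⟩

lemma cnt_pos (Ξ : Finset (Fin n → Bool)) (k : ℕ) {ξ} (h : ξ ∈ Ξ) : 0 < cnt Ξ k ξ :=
  Finset.card_pos.mpr ⟨ξ, by simp [h, agF_refl]⟩

lemma cnt_le (Ξ : Finset (Fin n → Bool)) (k : ℕ) (ξ) : cnt Ξ k ξ ≤ Ξ.card :=
  Finset.card_filter_le _ _

lemma cnt_zero (Ξ : Finset (Fin n → Bool)) {ξ} (h : ξ ∈ Ξ) : cnt Ξ 0 ξ = 1 := by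
  unfold cnt
  rw [Finset.card_eq_one]
  refine ⟨ξ, ?_⟩
  ext η
  simp only [Finset.mem_filter, agF_zero, Finset.mem_singleton]
  constructor
  · rintro ⟨_, h⟩; exact h.symm
  · rintro rfl; exact ⟨h, rfl⟩

lemma cnt_congr (Ξ : Finset (Fin n → Bool)) {k : ℕ} {ξ η} (h : agF k ξ η) :
    cnt Ξ k ξ = cnt Ξ k η := by
  unfold cnt; congr 1; ext ζ
  simp only [Finset.mem_filter]
  exact ⟨fun h' => ⟨h'.1, h.symm.trans h'.2⟩, fun h' => ⟨h'.1, h.trans h'.2⟩⟩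

lemma cnt_eq_imp (Ξ : Finset (Fin n → Bool)) {k l : ℕ} (h : k ≤ l) {ξ η} (hη : η ∈ Ξ)
    (he : cnt Ξ k ξ = cnt Ξ l ξ) (hl : agF l ξ η) : agF k ξ η := by
  have hs : (Ξ.filter fun η => agF k ξ η) ⊆ (Ξ.filter fun η => agF l ξ η) := by
    intro ζ hζ
    simp only [Finset.mem_filter] at hζ ⊢
    exact ⟨hζ.1, hζ.2.mono h⟩
  have := Finset.eq_of_subset_of_card_le hs he.ge
  have h2 : η ∈ (Ξ.filter fun η => agF l ξ η) := by simp [hη, hl]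
  rw [← this] at h2
  exact (Finset.mem_filter.mp h2).2

/-- The representation of `δ_k χ_k`. -/
lemma chi_repr (Ξ : Finset (Fin n → Bool)) (k : ℕ) (δ : (Fin n → Bool) → ℝ)
    (hδ : ∀ ξ η, agF k ξ η → δ ξ = δ η) (η) :
    δ η * chi Ξ k η = ∑ ξ ∈ Ξ, ((cnt Ξ k ξ : ℝ)⁻¹ * δ ξ) * if agF k ξ η then 1 else 0 := by
  have h1 : ∀ ξ ∈ Ξ, ((cnt Ξ k ξ : ℝ)⁻¹ * δ ξ) * (if agF k ξ η then 1 else 0) =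
      if agF k η ξ then ((cnt Ξ k η : ℝ)⁻¹ * δ η) else 0 := by
    intro ξ _
    by_cases h : agF k ξ η
    · rw [if_pos h, if_pos h.symm, cnt_congr Ξ h, hδ ξ η h, mul_one]
    · rw [if_neg h, if_neg (fun h' => h h'.symm), mul_zero]
  rw [Finset.sum_congr rfl h1, ← Finset.sum_filter, Finset.sum_const, nsmul_eq_mul]
  rcases chi_cases Ξ k η with ⟨h2, ξ, h3, h4⟩ | h2
  · rw [h2]
    have : 0 < cnt Ξ k η := by rw [← cnt_congr Ξ h4]; exact cnt_pos Ξ k h3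
    have h5 : ((Ξ.filter fun ξ => agF k η ξ).card : ℝ) = cnt Ξ k η := rfl
    rw [h5]; field_simp
  · rw [h2]
    have : (Ξ.filter fun ξ => agF k η ξ) = ∅ := by
      refine Finset.filter_eq_empty_iff.mpr fun ξ hξ h => ?_
      unfold chi at h2; rw [if_pos ⟨ξ, hξ, h.symm⟩] at h2; exact one_ne_zero h2
    rw [this]; simp

/-- Maximal estimate for the small tail. -/
lemma tail_max (Ξ : Finset (Fin n → Bool)) (N : ℕ) (hN : Ξ.card ≤ N) (δ : ℕ → (Fin n → Bool) → ℝ)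
    (hδ : ∀ k, ∀ ξ η, agF k ξ η → δ k ξ = δ k η) (d : ℝ)
    (hd : ∀ k ≤ n, ∀ ξ ∈ Ξ, δ k ξ ^ 2 ≤ d) (hd0 : 0 ≤ d) (f : (Fin n → Bool) → ℝ) :
    ∃ Mx : (Fin n → Bool) → ℝ, (∀ x, ∀ k ≤ n, (T (fun η => δ k η * chi Ξ k η) f x) ^ 2 ≤ Mx x) ∧
      ∑ x, Mx x ≤ 8 * (Nat.log 2 N + 1 : ℕ) * (d * N) * ∑ x, f x ^ 2 := by
  set top : ℕ → (Fin n → Bool) → ℕ := fun i ξ =>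
    Nat.findGreatest (fun k => Nat.log 2 (cnt Ξ k ξ) = i) n with htop
  have htopn : ∀ i ξ, top i ξ ≤ n := fun i ξ => Nat.findGreatest_le n
  have hcnt : ∀ i, ∀ ξ ∈ Ξ, cnt Ξ (top i ξ) ξ < 2 ^ (i + 1) := by
    intro i ξ hξ
    by_cases h0 : top i ξ = 0
    · rw [h0, cnt_zero Ξ hξ]; exact Nat.one_lt_two_pow (by omega)
    · have := Nat.findGreatest_of_ne_zero (P := fun k => Nat.log 2 (cnt Ξ k ξ) = i) (n := n) rfl h0
      have h2 : Nat.log 2 (cnt Ξ (top i ξ) ξ) = i := this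
      have := Nat.lt_pow_succ_log_self (b := 2) (by norm_num) (cnt Ξ (top i ξ) ξ)
      rwa [h2] at this
  choose D hD1 hD0 hD2 using fun (i : ℕ) (ξ : Fin n → Bool) =>
    doob (fun x => |E (top i ξ) (fun y => W ξ y * f y) x|) (fun x => abs_nonneg _)
  set I := Finset.range (Nat.log 2 N + 1) with hI
  have hstep : ∀ x, ∀ k ≤ n, ∀ ξ ∈ Ξ, (cnt Ξ k ξ : ℝ)⁻¹ * (E k (fun y => W ξ y * f y) x) ^ 2 ≤
      ∑ i ∈ I, ((2:ℝ) ^ i)⁻¹ * D i ξ x ^ 2 := by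
    intro x k hk ξ hξ
    set i := Nat.log 2 (cnt Ξ k ξ) with hi
    have hc := cnt_pos Ξ k hξ
    have hiI : i ∈ I := by
      rw [hI, Finset.mem_range]
      exact Nat.lt_succ_of_le (Nat.log_mono_right ((cnt_le Ξ k ξ).trans hN))
    have hkt : k ≤ top i ξ := Nat.le_findGreatest hk rfl
    refine le_trans ?_ (Finset.single_le_sum (f := fun i => ((2:ℝ) ^ i)⁻¹ * D i ξ x ^ 2)
      (fun _ _ => by positivity) hiI)
    have h1 : ((2:ℝ) ^ i) ≤ cnt Ξ k ξ := by exact_mod_cast Nat.pow_log_le_self 2 hc.ne'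
    have h2 : |E k (fun y => W ξ y * f y) x| ≤ D i ξ x := by
      rw [← E_tower hkt (htopn i ξ)]
      exact (E_norm_le k (E (top i ξ) (fun y => W ξ y * f y)) x).trans (hD1 i ξ x k hk)
    have h3 : (E k (fun y => W ξ y * f y) x) ^ 2 ≤ D i ξ x ^ 2 := by
      rw [← sq_abs]; exact pow_le_pow_left₀ (abs_nonneg _) h2 2
    have h4 : (cnt Ξ k ξ : ℝ)⁻¹ ≤ ((2:ℝ) ^ i)⁻¹ := inv_anti₀ (by positivity) h1
    exact mul_le_mul h4 h3 (sq_nonneg _) (by positivity)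
  refine ⟨fun x => (d * N) * ∑ ξ ∈ Ξ, ∑ i ∈ I, ((2:ℝ) ^ i)⁻¹ * D i ξ x ^ 2, fun x k hk => ?_, ?_⟩
  · have e1 : T (fun η => δ k η * chi Ξ k η) f x = ∑ ξ ∈ Ξ,
        ((cnt Ξ k ξ : ℝ)⁻¹ * δ k ξ) * (W ξ x * E k (fun y => W ξ y * f y) x) := by
      have : (fun η => δ k η * chi Ξ k η) = fun η => ∑ ξ ∈ Ξ,
          ((cnt Ξ k ξ : ℝ)⁻¹ * δ k ξ) * if agF k ξ η then 1 else 0 :=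
        funext fun η => chi_repr Ξ k (δ k) (hδ k) η
      rw [this, T_msum]
      refine Finset.sum_congr rfl fun ξ _ => ?_
      rw [T_msmul, T_ind hk]
    rw [e1]
    have e2 : ∀ ξ ∈ Ξ, ((cnt Ξ k ξ : ℝ)⁻¹ * δ k ξ) * (W ξ x * E k (fun y => W ξ y * f y) x) =
        (Real.sqrt ((cnt Ξ k ξ : ℝ)⁻¹) * δ k ξ * W ξ x) *
        (Real.sqrt ((cnt Ξ k ξ : ℝ)⁻¹) * E k (fun y => W ξ y * f y) x) := by
      intro ξ _
      have : Real.sqrt ((cnt Ξ k ξ : ℝ)⁻¹) * Real.sqrt ((cnt Ξ k ξ : ℝ)⁻¹) = (cnt Ξ k ξ : ℝ)⁻¹ :=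
        Real.mul_self_sqrt (by positivity)
      linear_combination (-(δ k ξ * W ξ x * E k (fun y => W ξ y * f y) x)) * this
    rw [Finset.sum_congr rfl e2]
    refine (Finset.sum_mul_sq_le_sq_mul_sq _ _ _).trans ?_
    have e3 : ∀ ξ, Real.sqrt ((cnt Ξ k ξ : ℝ)⁻¹) ^ 2 = (cnt Ξ k ξ : ℝ)⁻¹ := fun ξ =>
      Real.sq_sqrt (by positivity)
    refine mul_le_mul ?_ ?_ (Finset.sum_nonneg fun _ _ => sq_nonneg _) (by positivity)
    · have : ∀ ξ ∈ Ξ, (Real.sqrt ((cnt Ξ k ξ : ℝ)⁻¹) * δ k ξ * W ξ x) ^ 2 ≤ d := by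
        intro ξ hξ
        rw [mul_pow, mul_pow, e3, pow_two (W ξ x), W_sq, mul_one]
        have h1 : (cnt Ξ k ξ : ℝ)⁻¹ ≤ 1 := inv_le_one_of_one_le₀ (by exact_mod_cast cnt_pos Ξ k hξ)
        calc _ ≤ 1 * d := mul_le_mul h1 (hd k hk ξ hξ) (sq_nonneg _) zero_le_one
          _ = d := one_mul d
      refine (Finset.sum_le_sum this).trans ?_
      rw [Finset.sum_const, nsmul_eq_mul, mul_comm]
      exact mul_le_mul_of_nonneg_left (by exact_mod_cast hN) hd0
    · refine Finset.sum_le_sum fun ξ hξ => ?_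
      rw [mul_pow, e3]
      exact hstep x k hk ξ hξ
  · rw [← Finset.mul_sum]
    have h1 : ∑ x, ∑ ξ ∈ Ξ, ∑ i ∈ I, ((2:ℝ) ^ i)⁻¹ * D i ξ x ^ 2 ≤
        8 * (Nat.log 2 N + 1 : ℕ) * ∑ x, f x ^ 2 := by
      have e1 : ∑ x, ∑ ξ ∈ Ξ, ∑ i ∈ I, ((2:ℝ) ^ i)⁻¹ * D i ξ x ^ 2 =
          ∑ i ∈ I, ∑ ξ ∈ Ξ, ((2:ℝ) ^ i)⁻¹ * ∑ x, D i ξ x ^ 2 := by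
        simp_rw [Finset.mul_sum]
        rw [Finset.sum_comm]
        simp_rw [Finset.sum_comm (t := I)]
      rw [e1]
      have : ∀ i ∈ I, ∑ ξ ∈ Ξ, ((2:ℝ) ^ i)⁻¹ * ∑ x, D i ξ x ^ 2 ≤ 8 * ∑ x, f x ^ 2 := by
        intro i _
        have h2 : ∀ ξ ∈ Ξ, ((2:ℝ) ^ i)⁻¹ * ∑ x, D i ξ x ^ 2 ≤
            4 * (((2:ℝ) ^ i)⁻¹ * ∑ x, T (fun η => if agF (top i ξ) ξ η then 1 else 0) f x ^ 2) := by
          intro ξ _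
          have := hD2 i ξ
          simp_rw [sq_abs] at this
          simp_rw [T_ind (htopn i ξ), mul_pow, pow_two (W ξ _), W_sq, one_mul]
          rw [mul_left_comm]
          exact mul_le_mul_of_nonneg_left this (by positivity)
        refine (Finset.sum_le_sum h2).trans ?_
        rw [← Finset.mul_sum, ← Finset.mul_sum]
        have h3 := plancherel_sum_le Ξ (fun ξ η => if agF (top i ξ) ξ η then (1:ℝ) else 0) (2 ^ (i + 1))
          (fun η => by
            simp only [ite_pow, one_pow, ne_eq, OfNat.ofNat_ne_zero, not_false_eq_true, zero_pow]
            rw [← Finset.sum_filter, Finset.sum_const, nsmul_eq_mul, mul_one]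
            set Q := Ξ.filter fun ξ => agF (top i ξ) ξ η with hQ
            rcases Q.eq_empty_or_nonempty with h | h
            · rw [h]; simp
            · obtain ⟨ξs, hs1, hs2⟩ := Finset.exists_max_image Q (top i) h
              have hs3 := Finset.mem_filter.mp hs1
              have : Q.card ≤ cnt Ξ (top i ξs) ξs := by
                refine Finset.card_le_card fun ξ hξ => ?_
                have h4 := Finset.mem_filter.mp hξ
                exact Finset.mem_filter.mpr ⟨h4.1, hs3.2.trans (h4.2.mono (hs2 ξ hξ)).symm⟩
              exact_mod_cast this.trans (hcnt i ξs hs3.1).le) f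
        calc _ ≤ 4 * (((2:ℝ) ^ i)⁻¹ * (2 ^ (i + 1) * ∑ x, f x ^ 2)) := by gcongr
          _ = _ := by rw [pow_succ]; field_simp; ring
      refine (Finset.sum_le_sum this).trans ?_
      rw [Finset.sum_const, hI, Finset.card_range, nsmul_eq_mul]
      linarith
    calc _ ≤ (d * N) * (8 * (Nat.log 2 N + 1 : ℕ) * ∑ x, f x ^ 2) := by gcongr
      _ = _ := by ring

end HE

namespace HE

variable {n : ℕ}

lemma core (Ξ : Finset (Fin n → Bool)) (N : ℕ) (hN : Ξ.card ≤ N)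
    (b Θ : ℕ → (Fin n → Bool) → ℝ) (i : ℕ → (Fin n → Bool) → ℕ) (V : ℝ) (hV : 0 ≤ V)
    (hbi : ∀ k, ∀ ξ η, agF k ξ η → b k ξ = b k η)
    (hΘi : ∀ k, ∀ ξ η, agF k ξ η → Θ k ξ = Θ k η)
    (hb1 : ∀ k ≤ n, ∀ ξ ∈ Ξ, b k ξ ^ 2 ≤ 1)
    (hi : ∀ k l, k ≤ l → l ≤ n → ∀ ξ ∈ Ξ, i l ξ ≤ i k ξ)
    (hiN : ∀ k ≤ n, ∀ ξ ∈ Ξ, i k ξ ≤ N)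
    (hieq : ∀ k l, k ≤ l → l ≤ n → ∀ ξ ∈ Ξ, i k ξ = i l ξ → b k ξ = b l ξ)
    (hΘ0 : ∀ k ≤ n, ∀ ξ ∈ Ξ, 0 ≤ Θ k ξ) (hΘV : ∀ k ≤ n, ∀ ξ ∈ Ξ, Θ k ξ ≤ V)
    (hbΘ : ∀ k l, k ≤ l → l ≤ n → ∀ ξ ∈ Ξ, (b k ξ - b l ξ) ^ 2 ≤ Θ k ξ - Θ l ξ)
    (R R' : ℕ) (hR : N ≤ 4 ^ R) (hR' : 2 * N ^ 2 + 1 ≤ 2 ^ R') (f : (Fin n → Bool) → ℝ) :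
    ∃ Mx : (Fin n → Bool) → ℝ, (∀ x, ∀ k ≤ n, (T (fun η => b k η * chi Ξ k η) f x) ^ 2 ≤ Mx x) ∧
      ∑ x, Mx x ≤ (8 * (R' + 1) ^ 2 * (V + 1) + 144 * (R + 1) ^ 2) * ∑ x, f x ^ 2 := by
  set p : ℕ → ℕ := fun k => 1 + (∑ ξ ∈ Ξ, cnt Ξ k ξ + ∑ ξ ∈ Ξ, (N - i k ξ)) with hp
  have hpm1 : ∀ k l, k ≤ l → l ≤ n → ∑ ξ ∈ Ξ, cnt Ξ k ξ ≤ ∑ ξ ∈ Ξ, cnt Ξ l ξ := fun k l hkl hl =>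
    Finset.sum_le_sum fun ξ _ => cnt_mono Ξ hkl ξ
  have hpm2 : ∀ k l, k ≤ l → l ≤ n → ∑ ξ ∈ Ξ, (N - i k ξ) ≤ ∑ ξ ∈ Ξ, (N - i l ξ) := fun k l hkl hl =>
    Finset.sum_le_sum fun ξ hξ => Nat.sub_le_sub_left (hi k l hkl hl ξ hξ) N
  have hpmono : ∀ k l, k ≤ l → l ≤ n → p k ≤ p l := fun k l hkl hl => by
    have := hpm1 k l hkl hl; have := hpm2 k l hkl hl; simp only [hp]; omega
  have hpeq : ∀ k l, k ≤ l → l ≤ n → p k = p l → ∀ ξ ∈ Ξ, cnt Ξ k ξ = cnt Ξ l ξ ∧ i k ξ = i l ξ := by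
    intro k l hkl hl h ξ hξ
    have h1 := hpm1 k l hkl hl; have h2 := hpm2 k l hkl hl
    have h3 : ∑ ξ ∈ Ξ, cnt Ξ k ξ = ∑ ξ ∈ Ξ, cnt Ξ l ξ := by simp only [hp] at h; omega
    have h4 : ∑ ξ ∈ Ξ, (N - i k ξ) = ∑ ξ ∈ Ξ, (N - i l ξ) := by simp only [hp] at h; omega
    have h5 := (Finset.sum_eq_sum_iff_of_le fun ξ _ => cnt_mono Ξ hkl ξ).mp h3 ξ hξ
    have h6 := (Finset.sum_eq_sum_iff_of_le fun ξ hξ =>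
      Nat.sub_le_sub_left (hi k l hkl hl ξ hξ) N).mp h4 ξ hξ
    have := hiN k (hkl.trans hl) ξ hξ; have := hiN l hl ξ hξ
    exact ⟨h5, by omega⟩
  have hple : ∀ k ≤ n, p k ≤ 2 * N ^ 2 + 1 := by
    intro k hk
    have h1 : ∑ ξ ∈ Ξ, cnt Ξ k ξ ≤ Ξ.card * N := by
      rw [← smul_eq_mul, ← Finset.sum_const]
      exact Finset.sum_le_sum fun ξ _ => (cnt_le Ξ k ξ).trans hN
    have h2 : ∑ ξ ∈ Ξ, (N - i k ξ) ≤ Ξ.card * N := by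
      rw [← smul_eq_mul, ← Finset.sum_const]
      exact Finset.sum_le_sum fun ξ _ => Nat.sub_le _ _
    have h3 : Ξ.card * N ≤ N * N := Nat.mul_le_mul_right N hN
    simp only [hp]; rw [pow_two]; omega
  set t : ℕ → ℕ := fun s => Nat.findGreatest (fun k => p k ≤ s) n with ht
  have htn : ∀ s, t s ≤ n := fun s => Nat.findGreatest_le n
  have htm : Monotone t := fun s s' h => Nat.findGreatest_mono_left (fun k hk => le_trans hk h) n
  have hkt : ∀ k ≤ n, k ≤ t (p k) := fun k hk => Nat.le_findGreatest (P := fun k' => p k' ≤ p k) hk le_rfl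
  have hpt : ∀ k ≤ n, p (t (p k)) = p k := fun k hk =>
    le_antisymm (Nat.findGreatest_spec (P := fun k' => p k' ≤ p k) hk le_rfl)
      (hpmono _ _ (hkt k hk) (htn _))
  have htk : ∀ k ≤ n, ∀ s, p k = s + 1 → t s ≤ k := by
    intro k hk s hs
    by_contra hcon; push Not at hcon
    have h0 : t s ≠ 0 := by omega
    have := Nat.findGreatest_of_ne_zero (P := fun k => p k ≤ s) (n := n) rfl h0
    have h1 : p (t s) ≤ s := this
    have := hpmono k (t s) hcon.le (htn s)
    omega
  -- potential
  set P : ℕ → (Fin n → Bool) → ℝ := fun k η => if ∃ ξ ∈ Ξ, agF k ξ η then Θ k η else V + 1 with hP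
  have hDP : ∀ k l, k ≤ l → l ≤ n → ∀ η, (b l η * chi Ξ l η - b k η * chi Ξ k η) ^ 2 ≤ P k η - P l η := by
    intro k l hkl hl η
    by_cases h1 : ∃ ξ ∈ Ξ, agF k ξ η
    · obtain ⟨ξ, hξ, h2⟩ := h1
      have h3 : ∃ ξ ∈ Ξ, agF k ξ η := ⟨ξ, hξ, h2⟩
      have h4 : ∃ ξ ∈ Ξ, agF l ξ η := ⟨ξ, hξ, h2.mono hkl⟩
      simp only [hP, chi, if_pos h3, if_pos h4, mul_one]
      rw [← hbi k ξ η h2, ← hbi l ξ η (h2.mono hkl), ← hΘi k ξ η h2, ← hΘi l ξ η (h2.mono hkl)]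
      have := hbΘ k l hkl hl ξ hξ
      nlinarith
    · by_cases h4 : ∃ ξ ∈ Ξ, agF l ξ η
      · simp only [hP, chi, if_neg h1, if_pos h4, mul_one]
        obtain ⟨ξ, hξ, h2⟩ := h4
        rw [← hbi l ξ η h2, ← hΘi l ξ η h2]
        have := hb1 l hl ξ hξ
        have := hΘV l hl ξ hξ
        nlinarith
      · simp only [hP, chi, if_neg h1, if_neg h4]; simp
  have hP0 : ∀ k ≤ n, ∀ η, 0 ≤ P k η := by
    intro k hk η
    simp only [hP]; split_ifs with h
    · obtain ⟨ξ, hξ, h2⟩ := h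
      rw [← hΘi k ξ η h2]; exact hΘ0 k hk ξ hξ
    · linarith
  have hPV : ∀ k ≤ n, ∀ η, P k η ≤ V + 1 := by
    intro k hk η
    simp only [hP]; split_ifs with h
    · obtain ⟨ξ, hξ, h2⟩ := h
      rw [← hΘi k ξ η h2]; linarith [hΘV k hk ξ hξ]
    · linarith
  have hDb : ∀ k ≤ n, ∀ η, (b k η * chi Ξ k η) ^ 2 ≤ chi Ξ k η := by
    intro k hk η
    rcases chi_cases Ξ k η with ⟨h1, ξ, hξ, h2⟩ | h1
    · rw [h1, mul_one, ← hbi k ξ η h2]; exact hb1 k hk ξ hξ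
    · rw [h1]; simp
  obtain ⟨Mr, hMr1, hMr2⟩ := rm R' (fun l η => b (t l) η * chi Ξ (t l) η) (V + 1) (by linarith)
    (fun η => (hDb _ (htn 0) η).trans (chi_le_one _ _ _)) (fun η ρ S => by
      have h1 : ∀ s ∈ Finset.range S, (b (t ((s + 1) * 2 ^ ρ)) η * chi Ξ (t ((s + 1) * 2 ^ ρ)) η -
          b (t (s * 2 ^ ρ)) η * chi Ξ (t (s * 2 ^ ρ)) η) ^ 2 ≤
          P (t (s * 2 ^ ρ)) η - P (t ((s + 1) * 2 ^ ρ)) η := fun s _ =>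
        hDP _ _ (htm (Nat.mul_le_mul_right _ (Nat.le_succ s))) (htn _) η
      refine (Finset.sum_le_sum h1).trans ?_
      rw [Finset.sum_range_sub' (fun s => P (t (s * 2 ^ ρ)) η)]
      linarith [hPV _ (htn (0 * 2 ^ ρ)) η, hP0 _ (htn (S * 2 ^ ρ)) η]) f
  -- blocks
  set gm : ℕ → (Fin n → Bool) → ℝ := fun s η =>
    b (t (s + 1)) η * (chi Ξ (t (s + 1)) η - chi Ξ (t s) η) with hgm
  choose Mb hMb1 hMb2 using fun s => bb Ξ (htn (s + 1)) R (hN.trans hR) (T (gm s) f)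
  have hMb0 : ∀ s x, 0 ≤ Mb s x := fun s x =>
    (sq_nonneg _).trans (hMb1 s x (t (s + 1)) le_rfl (fun _ _ _ _ h => h))
  set S := 2 * N ^ 2 + 1 with hS
  refine ⟨fun x => 2 * Mr x + 2 * ∑ s ∈ Finset.range S, 4 * Mb s x, fun x k hk => ?_, ?_⟩
  · obtain ⟨s, hs⟩ : ∃ s, p k = s + 1 := ⟨p k - 1, by simp only [hp]; omega⟩
    have hsS : s < S := by have := hple k hk; omega
    have hk1 := hkt k hk; rw [hs] at hk1
    have hp1 := hpt k hk; rw [hs, ← hs] at hp1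
    have heq := hpeq k (t (s + 1)) hk1 (htn _) (by rw [← hs]; exact hp1.symm)
    have hts := htk k hk s hs
    set τ := t (s + 1) with hτ
    have hmult : (fun η => b k η * chi Ξ k η) = fun η => b τ η * chi Ξ τ η +
        (chi Ξ k η * gm s η - chi Ξ τ η * gm s η) := by
      funext η
      have m1 := chi_mono Ξ hk1 η
      have m2 := chi_mono Ξ hts η
      have m3 := chi_nonneg Ξ (t s) η
      have m4 := chi_le_one Ξ τ η
      simp only [hgm]
      rw [← hτ]
      rcases chi_cases Ξ k η with ⟨h1, ξ, hξ, h2⟩ | h1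
      · have h3 : chi Ξ τ η = 1 := by linarith
        rw [h1, h3, hbi k ξ η h2 |>.symm, hbi τ ξ η (h2.mono hk1) |>.symm,
          hieq k τ hk1 (htn _) ξ hξ (heq ξ hξ).2]
        ring
      · have h3 : chi Ξ (t s) η = 0 := by linarith
        rw [h1, h3]
        linear_combination b τ η * chi_sq Ξ τ η
    have hTeq : T (fun η => b k η * chi Ξ k η) f x = T (fun η => b τ η * chi Ξ τ η) f x +
        (T (chi Ξ k) (T (gm s) f) x - T (chi Ξ τ) (T (gm s) f) x) := by
      rw [hmult, T_madd, T_msub, T_comp, T_comp]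
    have b1 := hMr1 x (s + 1) (by omega)
    have b2 := hMb1 s x k hk1 (fun ξ hξ η hη h => cnt_eq_imp Ξ hk1 hη (heq ξ hξ).1 h)
    have b3 := hMb1 s x τ le_rfl (fun _ _ _ _ h => h)
    have b4 : 4 * Mb s x ≤ ∑ s ∈ Finset.range S, 4 * Mb s x :=
      Finset.single_le_sum (f := fun s => 4 * Mb s x) (fun s _ => by have := hMb0 s x; linarith)
        (Finset.mem_range.mpr hsS)
    rw [hTeq]
    rw [← hτ] at b1
    set A := T (fun η => b τ η * chi Ξ τ η) f x
    set B := T (chi Ξ k) (T (gm s) f) x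
    set C := T (chi Ξ τ) (T (gm s) f) x
    nlinarith [sq_nonneg (A - (B - C)), sq_nonneg (B + C)]
  · have h1 : ∑ s ∈ Finset.range S, ∑ x, T (gm s) f x ^ 2 ≤ 1 * ∑ x, f x ^ 2 := by
      refine plancherel_sum_le (Finset.range S) gm 1 (fun η => ?_) f
      have h2 : ∀ s ∈ Finset.range S, gm s η ^ 2 ≤ chi Ξ (t (s + 1)) η - chi Ξ (t s) η := by
        intro s _
        have m2 := chi_mono Ξ (htm (Nat.le_succ s)) η
        simp only [hgm]
        have h3 := hDb (t (s + 1)) (htn _) η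
        rcases chi_cases Ξ (t (s + 1)) η with ⟨h4, -⟩ | h4 <;>
        rcases chi_cases Ξ (t s) η with ⟨h5, -⟩ | h5 <;> rw [Nat.succ_eq_add_one] at m2 <;>
          rw [h4, h5] at m2 <;> rw [h4] at h3 <;> rw [h4, h5] <;> nlinarith
      refine (Finset.sum_le_sum h2).trans ?_
      rw [Finset.sum_range_sub (fun s => chi Ξ (t s) η)]
      linarith [chi_le_one Ξ (t S) η, chi_nonneg Ξ (t 0) η]
    rw [Finset.sum_add_distrib, ← Finset.mul_sum, ← Finset.mul_sum, Finset.sum_comm]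
    simp_rw [← Finset.mul_sum]
    have h2 : ∑ s ∈ Finset.range S, ∑ x, Mb s x ≤ 18 * (R + 1) ^ 2 * ∑ x, f x ^ 2 := by
      refine (Finset.sum_le_sum fun s _ => hMb2 s).trans ?_
      rw [← Finset.mul_sum]
      refine mul_le_mul_of_nonneg_left ?_ (by positivity)
      linarith
    nlinarith

end HE

namespace HE

variable {n : ℕ}

lemma sq_le_of_rpow {r : ℝ} (hr : 2 < r) {N : ℝ} (hN : 1 ≤ N) {x y : ℝ} (hx : |x| ^ r ≤ y) :
    x ^ 2 ≤ N ^ (-(2 / r)) * (1 + N * y) := by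
  have hr0 : 0 < r := by linarith
  have hy : 0 ≤ y := (Real.rpow_nonneg (abs_nonneg x) r).trans hx
  have h1 : x ^ 2 = (|x| ^ r) ^ (2 / r) := by
    rw [← Real.rpow_mul (abs_nonneg x), mul_div_cancel₀ _ hr0.ne', ← sq_abs]; norm_cast
  have h2 : (|x| ^ r) ^ (2 / r) ≤ y ^ (2 / r) :=
    Real.rpow_le_rpow (Real.rpow_nonneg (abs_nonneg x) r) hx (by positivity)
  have h3 : y ^ (2 / r) = N ^ (-(2 / r)) * (N * y) ^ (2 / r) := by
    rw [Real.mul_rpow (by linarith) hy, ← mul_assoc, ← Real.rpow_add (by linarith)]; simp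
  have h4 : (N * y) ^ (2 / r) ≤ 1 + N * y := by
    have hNy : 0 ≤ N * y := by positivity
    calc (N * y) ^ (2 / r) ≤ (1 + N * y) ^ (2 / r) :=
          Real.rpow_le_rpow hNy (by linarith) (by positivity)
      _ ≤ (1 + N * y) ^ (1 : ℝ) := Real.rpow_le_rpow_of_exponent_le (by linarith)
          (by rw [div_le_one hr0]; linarith)
      _ = _ := Real.rpow_one _
  rw [h1]
  refine h2.trans ?_
  rw [h3]
  exact mul_le_mul_of_nonneg_left h4 (by positivity)

lemma sq_le_of_rpow' {r : ℝ} (hr : 2 < r) {N : ℝ} (hN : 1 ≤ N) {x : ℝ} (hx : |x| ^ r ≤ N⁻¹) :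
    x ^ 2 ≤ N ^ (-(2 / r)) := by
  have hr0 : 0 < r := by linarith
  have h1 : x ^ 2 = (|x| ^ r) ^ (2 / r) := by
    rw [← Real.rpow_mul (abs_nonneg x), mul_div_cancel₀ _ hr0.ne', ← sq_abs]; norm_cast
  have h2 : (|x| ^ r) ^ (2 / r) ≤ (N⁻¹) ^ (2 / r) :=
    Real.rpow_le_rpow (Real.rpow_nonneg (abs_nonneg x) r) hx (by positivity)
  rw [h1, Real.rpow_neg (by linarith), ← Real.inv_rpow (by linarith)]
  exact h2

/-- last scale with the same value of i -/
def kst (i : ℕ → ℕ) (n k : ℕ) : ℕ := max k (Nat.findGreatest (fun k' => k ≤ k' ∧ i k' = i k) n)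

lemma kst_ge (i : ℕ → ℕ) (n k : ℕ) : k ≤ kst i n k := le_max_left _ _

lemma kst_le (i : ℕ → ℕ) {n k : ℕ} (hk : k ≤ n) : kst i n k ≤ n :=
  max_le hk (Nat.findGreatest_le n)

lemma kst_i (i : ℕ → ℕ) {n k : ℕ} (hk : k ≤ n) : i (kst i n k) = i k := by
  have h := Nat.findGreatest_spec (P := fun k' => k ≤ k' ∧ i k' = i k) hk ⟨le_rfl, rfl⟩
  unfold kst; rw [max_eq_right h.1]; exact h.2

lemma kst_max (i : ℕ → ℕ) {n k l : ℕ} (hk : k ≤ l) (hl : l ≤ n) (h : i l = i k) : l ≤ kst i n k :=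
  (Nat.le_findGreatest (P := fun k' => k ≤ k' ∧ i k' = i k) hl ⟨hk, h⟩).trans (le_max_right _ _)

lemma kst_congr (i j : ℕ → ℕ) (n k : ℕ) (h : ∀ l, k ≤ l → i l = j l) : kst i n k = kst j n k := by
  unfold kst
  have : (fun k' => k ≤ k' ∧ i k' = i k) = (fun k' => k ≤ k' ∧ j k' = j k) := by
    funext k'; rw [h k le_rfl]; apply propext
    constructor <;> rintro ⟨h1, h2⟩
    · exact ⟨h1, (h k' h1) ▸ h2⟩
    · exact ⟨h1, (h k' h1).trans h2⟩
  congr 1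
  simp only [this]

lemma kst_eq (i : ℕ → ℕ) {n k l : ℕ} (hk : k ≤ l) (hl : l ≤ n) (h : i l = i k) :
    kst i n k = kst i n l := by
  apply le_antisymm
  · exact kst_max i (kst_max i hk hl h) (kst_le i (hk.trans hl)) (by rw [kst_i i (hk.trans hl), h])
  · exact kst_max i (hk.trans (kst_ge i n l)) (kst_le i hl) (by rw [kst_i i hl, h])

lemma kst_lt (i : ℕ → ℕ) {n k l : ℕ} (hi : ∀ k l, k ≤ l → l ≤ n → i l ≤ i k) (hk : k ≤ l)
    (hl : l ≤ n) (h : i l ≠ i k) : kst i n k ≤ l := by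
  by_contra hc
  push Not at hc
  have h1 := hi l _ hc.le (kst_le i (hk.trans hl))
  rw [kst_i i (hk.trans hl)] at h1
  exact h (le_antisymm (hi k l hk hl) h1)

theorem L2max (r : ℝ) (hr : 2 < r) (Ξ : Finset (Fin n → Bool)) (N : ℕ) (hN1 : 1 ≤ N)
    (hN : Ξ.card ≤ N) (a φ : ℕ → (Fin n → Bool) → ℝ)
    (hai : ∀ k, ∀ ξ η, agF k ξ η → a k ξ = a k η)
    (hφi : ∀ k, ∀ ξ η, agF k ξ η → φ k ξ = φ k η)
    (ha1 : ∀ k ≤ n, ∀ ξ ∈ Ξ, |a k ξ| ≤ 1)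
    (hφ0 : ∀ k ≤ n, ∀ ξ ∈ Ξ, 0 ≤ φ k ξ) (hφ1 : ∀ k ≤ n, ∀ ξ ∈ Ξ, φ k ξ ≤ 1)
    (haφ : ∀ k l, k ≤ l → l ≤ n → ∀ ξ ∈ Ξ, |a k ξ - a l ξ| ^ r ≤ φ k ξ - φ l ξ)
    (f : (Fin n → Bool) → ℝ) :
    ∃ Mx : (Fin n → Bool) → ℝ, (∀ x, ∀ k ≤ n, (T (fun η => a k η * chi Ξ k η) f x) ^ 2 ≤ Mx x) ∧
      ∑ x, Mx x ≤ 2400 * ((Nat.log 2 N + 1 : ℕ) : ℝ) ^ 2 * (N : ℝ) ^ (1 - 2 / r) * ∑ x, f x ^ 2 := by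
  have hNr : (1 : ℝ) ≤ N := by exact_mod_cast hN1
  have hr0 : 0 < r := by linarith
  set d : ℝ := (N : ℝ) ^ (-(2 / r)) with hd
  have hd0 : 0 ≤ d := by positivity
  set P : ℝ := (N : ℝ) ^ (1 - 2 / r) with hP
  have hdN : d * N = P := by
    rw [hd, hP, sub_eq_neg_add, Real.rpow_add (by linarith), Real.rpow_one]
  have hP1 : 1 ≤ P := Real.one_le_rpow hNr (by
    have : 2 / r ≤ 1 := by rw [div_le_one hr0]; linarith
    linarith)
  set i : ℕ → (Fin n → Bool) → ℕ := fun k ξ => ⌊(N : ℝ) * φ k ξ⌋₊ with hi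
  set K : ℕ → (Fin n → Bool) → ℕ := fun k ξ => kst (fun l => i l ξ) n k with hK
  have hφanti : ∀ k l, k ≤ l → l ≤ n → ∀ ξ ∈ Ξ, φ l ξ ≤ φ k ξ := fun k l hkl hl ξ hξ => by
    have := haφ k l hkl hl ξ hξ
    have := Real.rpow_nonneg (abs_nonneg (a k ξ - a l ξ)) r
    linarith
  have hianti : ∀ ξ ∈ Ξ, ∀ k l, k ≤ l → l ≤ n → i l ξ ≤ i k ξ := fun ξ hξ k l hkl hl =>
    Nat.floor_le_floor (mul_le_mul_of_nonneg_left (hφanti k l hkl hl ξ hξ) (by linarith))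
  have hKi : ∀ k, ∀ ξ η, agF k ξ η → K k ξ = K k η := fun k ξ η h =>
    kst_congr _ _ n k fun l hl => by simp only [hi]; rw [hφi l ξ η (h.mono hl)]
  have hKge : ∀ k ξ, k ≤ K k ξ := fun k ξ => kst_ge _ _ _
  have hKn : ∀ k ≤ n, ∀ ξ, K k ξ ≤ n := fun k hk ξ => kst_le _ hk
  have hiK : ∀ k ≤ n, ∀ ξ, i (K k ξ) ξ = i k ξ := fun k hk ξ => kst_i (fun l => i l ξ) hk
  have hKeq : ∀ k l, k ≤ l → l ≤ n → ∀ ξ, i k ξ = i l ξ → K k ξ = K l ξ := fun k l hkl hl ξ h =>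
    kst_eq (fun l => i l ξ) hkl hl h.symm
  have hKlt : ∀ k l, k ≤ l → l ≤ n → ∀ ξ ∈ Ξ, i k ξ ≠ i l ξ → K k ξ ≤ K l ξ :=
    fun k l hkl hl ξ hξ h => (kst_lt (fun l => i l ξ) (hianti ξ hξ) hkl hl h.symm).trans (hKge l ξ)
  set b : ℕ → (Fin n → Bool) → ℝ := fun k ξ => a (K k ξ) ξ with hb
  set Θ : ℕ → (Fin n → Bool) → ℝ := fun k ξ => d * (i k ξ + N * φ (K k ξ) ξ) with hΘ
  have hbi : ∀ k, ∀ ξ η, agF k ξ η → b k ξ = b k η := fun k ξ η h => by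
    simp only [hb]; rw [hKi k ξ η h]; exact hai _ _ _ (h.mono (hKge k η))
  have hΘi : ∀ k, ∀ ξ η, agF k ξ η → Θ k ξ = Θ k η := fun k ξ η h => by
    simp only [hΘ, hi]; rw [hKi k ξ η h, hφi _ _ _ (h.mono (hKge k η)), hφi _ _ _ h]
  have hile : ∀ k ≤ n, ∀ ξ ∈ Ξ, (i k ξ : ℝ) ≤ N := fun k hk ξ hξ =>
    (Nat.floor_le (mul_nonneg (by linarith) (hφ0 k hk ξ hξ))).trans
      (by have := mul_le_mul_of_nonneg_left (hφ1 k hk ξ hξ) (by linarith : (0:ℝ) ≤ N); linarith)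
  set ℓ : ℕ := Nat.log 2 N + 1 with hℓ
  have hNl : N < 2 ^ ℓ := Nat.lt_pow_succ_log_self (by norm_num) N
  obtain ⟨Mb, hMb, hMbs⟩ := core Ξ N hN b Θ i (2 * P) (by linarith) hbi hΘi
    (fun k hk ξ hξ => by
      have := ha1 _ (hKn k hk ξ) ξ hξ
      simp only [hb]; rw [← sq_abs]; exact pow_le_one₀ (abs_nonneg _) this)
    (fun k l hkl hl ξ hξ => hianti ξ hξ k l hkl hl)
    (fun k hk ξ hξ => by exact_mod_cast hile k hk ξ hξ)
    (fun k l hkl hl ξ hξ h => by simp only [hb]; rw [hKeq k l hkl hl ξ h])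
    (fun k hk ξ hξ => by
      have := hφ0 _ (hKn k hk ξ) ξ hξ
      simp only [hΘ]; positivity)
    (fun k hk ξ hξ => by
      have h1 := hφ1 _ (hKn k hk ξ) ξ hξ
      have h2 := hile k hk ξ hξ
      have h3 := mul_le_mul_of_nonneg_left h1 (by linarith : (0:ℝ) ≤ N)
      rw [← hdN]
      calc d * (i k ξ + N * φ (K k ξ) ξ) ≤ d * (N + N) :=
            mul_le_mul_of_nonneg_left (by linarith) hd0
        _ = _ := by ring)
    (fun k l hkl hl ξ hξ => by
      by_cases h : i k ξ = i l ξ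
      · simp only [hb, hΘ]; rw [hKeq k l hkl hl ξ h, h]; simp
      · have h1 := haφ _ _ (hKlt k l hkl hl ξ hξ h) (hKn l hl ξ) ξ hξ
        have h2 := sq_le_of_rpow hr hNr h1
        have h3 : (i l ξ : ℝ) + 1 ≤ i k ξ := by
          have := hianti ξ hξ k l hkl hl
          exact_mod_cast lt_of_le_of_ne this (Ne.symm h)
        simp only [hb, hΘ]
        refine h2.trans ?_
        rw [← mul_sub]
        exact mul_le_mul_of_nonneg_left (by linarith) hd0)
    ℓ (2 * ℓ + 2)
    (hNl.le.trans (Nat.pow_le_pow_left (by norm_num) ℓ))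
    (by
      have : 2 ^ (2 * ℓ + 2) = 4 * (2 ^ ℓ) ^ 2 := by rw [pow_add, pow_mul']; ring
      rw [this]; nlinarith) f
  obtain ⟨Mt, hMt, hMts⟩ := tail_max Ξ N hN (fun k ξ => a k ξ - b k ξ)
    (fun k ξ η h => by rw [hai k ξ η h, hbi k ξ η h]) d
    (fun k hk ξ hξ => by
      have h1 := haφ _ _ (hKge k ξ) (hKn k hk ξ) ξ hξ
      refine sq_le_of_rpow' hr hNr (h1.trans ?_)
      have h2 := hiK k hk ξ
      have h3 : (N : ℝ) * φ k ξ < i k ξ + 1 := Nat.lt_floor_add_one _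
      have h4 : (i (K k ξ) ξ : ℝ) ≤ N * φ (K k ξ) ξ :=
        Nat.floor_le (mul_nonneg (by linarith) (hφ0 _ (hKn k hk ξ) ξ hξ))
      rw [h2] at h4
      rw [← one_div, le_div_iff₀ (by linarith)]
      linarith)
    hd0 f
  refine ⟨fun x => 2 * Mt x + 2 * Mb x, fun x k hk => ?_, ?_⟩
  · have h1 := hMt x k hk
    have h2 := hMb x k hk
    have h3 : T (fun η => a k η * chi Ξ k η) f x =
        T (fun η => (a k η - b k η) * chi Ξ k η) f x + T (fun η => b k η * chi Ξ k η) f x := by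
      rw [← T_madd]; congr 1; funext η; ring
    rw [h3]
    nlinarith [sq_nonneg (T (fun η => (a k η - b k η) * chi Ξ k η) f x - T (fun η => b k η * chi Ξ k η) f x)]
  · rw [Finset.sum_add_distrib, ← Finset.mul_sum, ← Finset.mul_sum]
    have hS : 0 ≤ ∑ x, f x ^ 2 := Finset.sum_nonneg fun _ _ => sq_nonneg _
    have hl1 : (1 : ℝ) ≤ ℓ := by rw [hℓ]; push_cast; linarith [Nat.cast_nonneg (α := ℝ) (Nat.log 2 N)]
    rw [hdN] at hMts
    have hc : 2 * (8 * (ℓ : ℝ) * P) + 2 * (8 * (((2 * ℓ + 2 : ℕ) : ℝ) + 1) ^ 2 * (2 * P + 1) + 144 * ((ℓ : ℝ) + 1) ^ 2)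
        ≤ 2400 * (ℓ : ℝ) ^ 2 * P := by
      push_cast
      have e1 : (2 * (ℓ : ℝ) + 2 + 1) ^ 2 ≤ 25 * ℓ ^ 2 := by nlinarith
      have e2 : ((ℓ : ℝ) + 1) ^ 2 ≤ 4 * ℓ ^ 2 := by nlinarith
      have e3 : (2 * (ℓ : ℝ) + 2 + 1) ^ 2 * (2 * P + 1) ≤ 25 * ℓ ^ 2 * (3 * P) :=
        mul_le_mul e1 (by linarith) (by linarith) (by positivity)
      have e4 : ((ℓ : ℝ) + 1) ^ 2 ≤ 4 * ℓ ^ 2 * P := e2.trans (le_mul_of_one_le_right (by positivity) hP1)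
      have e5 : (ℓ : ℝ) * P ≤ ℓ ^ 2 * P := mul_le_mul_of_nonneg_right (by nlinarith) (by linarith)
      nlinarith
    have := mul_le_mul_of_nonneg_right hc hS
    nlinarith

end HE

namespace HE

variable {n : ℕ}

/-- maximal operator -/
def S (m : ℕ → (Fin n → Bool) → ℝ) (f : (Fin n → Bool) → ℝ) (x : Fin n → Bool) : ℝ :=
  (Finset.range (n + 1)).sup' ⟨0, by simp⟩ fun k => |T (m k) f x|

lemma le_S (m : ℕ → (Fin n → Bool) → ℝ) (f : (Fin n → Bool) → ℝ) (x) {k : ℕ} (hk : k ≤ n) :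
    |T (m k) f x| ≤ S m f x :=
  Finset.le_sup' (fun k => |T (m k) f x|) (Finset.mem_range.mpr (by omega))

lemma S_le (m : ℕ → (Fin n → Bool) → ℝ) (f : (Fin n → Bool) → ℝ) (x) {c : ℝ}
    (h : ∀ k ≤ n, |T (m k) f x| ≤ c) : S m f x ≤ c :=
  Finset.sup'_le _ _ fun k hk => h k (by have := Finset.mem_range.mp hk; omega)

lemma S_nonneg (m : ℕ → (Fin n → Bool) → ℝ) (f : (Fin n → Bool) → ℝ) (x) : 0 ≤ S m f x :=
  (abs_nonneg _).trans (le_S m f x (Nat.zero_le n))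

lemma S_add_le (m : ℕ → (Fin n → Bool) → ℝ) (f g : (Fin n → Bool) → ℝ) (x) :
    S m (fun y => f y + g y) x ≤ S m f x + S m g x :=
  S_le _ _ _ fun k hk => by
    rw [T_add]
    exact (abs_add_le _ _).trans (add_le_add (le_S m f x hk) (le_S m g x hk))

lemma abs_T_ind {κ : ℕ} (hκ : κ ≤ n) (ξ : Fin n → Bool) (f : (Fin n → Bool) → ℝ) (x) :
    |T (fun η => if agF κ ξ η then 1 else 0) f x| ≤ E κ (fun y => |f y|) x := by
  rw [T_ind hκ, abs_mul, W_abs, one_mul]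
  have := E_norm_le κ (fun y => W ξ y * f y) x
  simp only [Real.norm_eq_abs, abs_mul, W_abs, one_mul] at this
  exact this

lemma chi_sum_reps (Ξ : Finset (Fin n → Bool)) (k : ℕ) : ∃ Ξ0 ⊆ Ξ, ∀ η,
    chi Ξ k η = ∑ ξ ∈ Ξ0, if agF k ξ η then 1 else 0 := by
  obtain ⟨Ξ0, hs, h1, h2⟩ := exists_reps Ξ k
  refine ⟨Ξ0, hs, fun η => ?_⟩
  unfold chi
  split_ifs with h
  · obtain ⟨ξ, hξ, h3⟩ := h
    obtain ⟨ξ0, hξ0, h4⟩ := h2 ξ hξ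
    rw [Finset.sum_eq_single_of_mem ξ0 hξ0, if_pos (h4.trans h3)]
    intro ζ hζ hne
    rw [if_neg]
    intro h5
    exact hne (h1 ζ hζ ξ0 hξ0 (h5.trans (h4.trans h3).symm))
  · symm
    refine Finset.sum_eq_zero fun ξ hξ => if_neg fun h3 => h ⟨ξ, hs hξ, h3⟩

lemma abs_T_chi {κ : ℕ} (hκ : κ ≤ n) (Ξ : Finset (Fin n → Bool)) {N : ℕ} (hN : Ξ.card ≤ N)
    (f : (Fin n → Bool) → ℝ) (x) :
    |T (chi Ξ κ) f x| ≤ N * E κ (fun y => |f y|) x := by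
  obtain ⟨Ξ0, hs, h⟩ := chi_sum_reps Ξ κ
  have : T (chi Ξ κ) f x = ∑ ξ ∈ Ξ0, T (fun η => if agF κ ξ η then 1 else 0) f x := by
    rw [← T_msum]; congr 1; funext η; exact h η
  rw [this]
  have hE : 0 ≤ E κ (fun y => |f y|) x := E_nonneg κ (fun y => abs_nonneg _) x
  calc |∑ ξ ∈ Ξ0, T (fun η => if agF κ ξ η then 1 else 0) f x|
      ≤ ∑ ξ ∈ Ξ0, |T (fun η => if agF κ ξ η then 1 else 0) f x| := Finset.abs_sum_le_sum_abs _ _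
    _ ≤ ∑ ξ ∈ Ξ0, E κ (fun y => |f y|) x := Finset.sum_le_sum fun ξ _ => abs_T_ind hκ ξ f x
    _ = Ξ0.card * E κ (fun y => |f y|) x := by simp
    _ ≤ _ := mul_le_mul_of_nonneg_right
        (by exact_mod_cast (Finset.card_le_card hs).trans hN) hE

lemma E_succ_le (κ : ℕ) {h : (Fin n → Bool) → ℝ} (h0 : ∀ x, 0 ≤ h x) (x) :
    E (κ + 1) h x ≤ 2 * E κ h x := by
  unfold E
  simp only [smul_eq_mul]
  rw [← mul_assoc]
  have : (2 ^ (κ + 1) : ℝ) / 2 ^ n = 2 * (2 ^ κ / 2 ^ n) := by rw [pow_succ]; ring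
  rw [this]
  refine mul_le_mul_of_nonneg_left (Finset.sum_le_sum_of_subset_of_nonneg ?_ fun y _ _ => h0 y)
    (by positivity)
  intro y hy
  simp only [Finset.mem_filter, Finset.mem_univ, true_and] at hy ⊢
  exact hy.mono (Nat.le_succ κ)

/-- κ is the first scale at x with average exceeding lam -/
def isSt (h : (Fin n → Bool) → ℝ) (lam : ℝ) (κ : ℕ) (x : Fin n → Bool) : Prop :=
  lam < E κ h x ∧ ∀ l < κ, E l h x ≤ lam

lemma isSt_inv (h : (Fin n → Bool) → ℝ) (lam : ℝ) {κ : ℕ} {x y : Fin n → Bool} (hxy : agX κ x y)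
    (hx : isSt h lam κ x) : isSt h lam κ y := by
  refine ⟨(E_inv h hxy) ▸ hx.1, fun l hl => (E_inv h (hxy.mono hl.le)) ▸ hx.2 l hl⟩

lemma isSt_unique (h : (Fin n → Bool) → ℝ) (lam : ℝ) {κ l : ℕ} {x : Fin n → Bool}
    (hx : isSt h lam κ x) (hy : isSt h lam l x) : κ = l := by
  rcases lt_trichotomy κ l with h1 | h1 | h1
  · exact absurd (hy.2 κ h1) (not_le.mpr hx.1)
  · exact h1
  · exact absurd (hx.2 l h1) (not_le.mpr hy.1)

lemma isSt_exists (h : (Fin n → Bool) → ℝ) (lam : ℝ) {x : Fin n → Bool} {k : ℕ} (hk : k ≤ n)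
    (hx : lam < E k h x) : ∃ κ ≤ n, isSt h lam κ x := by
  have hex : ∃ k, lam < E k h x := ⟨k, hx⟩
  refine ⟨Nat.find hex, (Nat.find_min' hex hx).trans hk, Nat.find_spec hex, fun l hl => ?_⟩
  exact not_lt.mp (Nat.find_min hex hl)

lemma E_zero (h : (Fin n → Bool) → ℝ) (x) : E 0 h x = (2 ^ n : ℝ)⁻¹ * ∑ y, h y := by
  unfold E
  have : (Finset.univ.filter fun y => agX 0 x y) = Finset.univ := by
    ext y; simp [agX]
  rw [this]; simp

theorem weak (m : ℕ → (Fin n → Bool) → ℝ) (Ξ : Finset (Fin n → Bool)) (N : ℕ) (hN1 : 1 ≤ N)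
    (hN : Ξ.card ≤ N)
    (hm : ∀ k ≤ n, ∀ κ ≤ n, ∀ ξ η, agF κ ξ η → m k ξ * (1 - chi Ξ κ ξ) = m k η * (1 - chi Ξ κ η))
    (B : ℝ) (hB : ∀ f, ∑ x, S m f x ^ 2 ≤ B ^ 2 * ∑ x, f x ^ 2) (f : (Fin n → Bool) → ℝ)
    (lam s : ℝ) (hlam : 0 < lam) (hs : 0 < s) :
    ((Finset.univ.filter fun x => s < S m f x).card : ℝ) ≤
      (∑ x, |f x|) / lam + 2 * N * B ^ 2 * lam * (∑ x, |f x|) / s ^ 2 := by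
  set h : (Fin n → Bool) → ℝ := fun y => |f y| with hh
  have h0 : ∀ y, 0 ≤ h y := fun y => abs_nonneg _
  have hL : 0 ≤ ∑ x, h x := Finset.sum_nonneg fun x _ => h0 x
  have hNr : (1 : ℝ) ≤ N := by exact_mod_cast hN1
  by_cases hav : lam < (2 ^ n : ℝ)⁻¹ * ∑ y, h y
  · have h1 : ((Finset.univ.filter fun x => s < S m f x).card : ℝ) ≤ 2 ^ n := by
      have := Finset.card_le_univ (Finset.univ.filter fun x => s < S m f x)
      simp only [Fintype.card_fun, Fintype.card_bool, Fintype.card_fin] at this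
      exact_mod_cast this
    have h2 : (2 ^ n : ℝ) ≤ (∑ x, h x) / lam := by
      rw [le_div_iff₀ hlam]
      have := mul_lt_mul_of_pos_left hav (by positivity : (0:ℝ) < 2 ^ n)
      rw [mul_inv_cancel_left₀ (by positivity)] at this
      exact this.le
    have h3 : 0 ≤ 2 * N * B ^ 2 * lam * (∑ x, h x) / s ^ 2 := by positivity
    linarith
  push Not at hav
  set P : ℕ → (Fin n → Bool) → Prop := fun κ x => isSt h lam κ x with hP
  set F : ℕ → (Fin n → Bool) → ℝ := fun κ x => if P κ x then f x else 0 with hF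
  set Bad : (Fin n → Bool) → Prop := fun x => ∃ κ ≤ n, P κ x with hBad
  set F0 : (Fin n → Bool) → ℝ := fun x => if Bad x then 0 else f x with hF0
  have hfdec : ∀ x, f x = F0 x + ∑ κ ∈ Finset.range (n + 1), F κ x := by
    intro x
    by_cases hx : Bad x
    · obtain ⟨κ, hκ, hx'⟩ := hx
      rw [Finset.sum_eq_single_of_mem κ (Finset.mem_range.mpr (by omega))]
      · simp only [hF0, hF]; rw [if_pos ⟨κ, hκ, hx'⟩, if_pos hx']; ring
      · intro l _ hl; simp only [hF]; exact if_neg fun h' => hl (isSt_unique h lam h' hx')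
    · rw [Finset.sum_eq_zero]
      · simp only [hF0]; rw [if_neg hx]; ring
      · intro l hl; simp only [hF]
        exact if_neg fun h' => hx ⟨l, by have := Finset.mem_range.mp hl; omega, h'⟩
  have hL1 : ∑ x, h x = ∑ x, |F0 x| + ∑ κ ∈ Finset.range (n + 1), ∑ x, |F κ x| := by
    rw [Finset.sum_comm, ← Finset.sum_add_distrib]
    refine Finset.sum_congr rfl fun x _ => ?_
    simp only [hh]
    by_cases hx : Bad x
    · obtain ⟨κ, hκ, hx'⟩ := hx
      rw [Finset.sum_eq_single_of_mem κ (Finset.mem_range.mpr (by omega))]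
      · simp only [hF0, hF]; rw [if_pos ⟨κ, hκ, hx'⟩, if_pos hx']; simp
      · intro l _ hl; simp only [hF]; rw [if_neg fun h' => hl (isSt_unique h lam h' hx')]; simp
    · rw [Finset.sum_eq_zero]
      · simp only [hF0]; rw [if_neg hx]; ring
      · intro l hl; simp only [hF]
        rw [if_neg fun h' => hx ⟨l, by have := Finset.mem_range.mp hl; omega, h'⟩]; simp
  -- local vanishing
  have hvan : ∀ κ, ∀ mm : (Fin n → Bool) → ℝ, (∀ ξ η, agF κ ξ η → mm ξ = mm η) → ∀ x, ¬ P κ x →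
      T mm (F κ) x = 0 := by
    intro κ mm hmm x hx
    rw [T_local hmm (g := fun _ => 0), T_zero]
    intro y hy
    simp only [hF]
    exact if_neg fun h' => hx (isSt_inv h lam hy.symm h')
  have hloc : ∀ κ, ∀ mm : (Fin n → Bool) → ℝ, (∀ ξ η, agF κ ξ η → mm ξ = mm η) → ∀ x, P κ x →
      T mm (F κ) x = T mm f x := by
    intro κ mm hmm x hx
    refine T_local hmm ?_
    intro y hy
    simp only [hF]
    exact if_pos (isSt_inv h lam hy hx)
  have hEle : ∀ κ ≤ n, ∀ x, P κ x → E κ h x ≤ 2 * lam := by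
    intro κ hκ x hx
    rcases Nat.eq_zero_or_pos κ with h1 | h1
    · subst h1; rw [E_zero]; linarith
    · obtain ⟨l, rfl⟩ : ∃ l, κ = l + 1 := ⟨κ - 1, by omega⟩
      have := E_succ_le l h0 x
      have := hx.2 l (by omega)
      linarith
  set G1 : ℕ → (Fin n → Bool) → ℝ := fun κ => T (chi Ξ κ) (F κ) with hG1
  have hG1b : ∀ κ ≤ n, ∀ x, |G1 κ x| ≤ 2 * N * lam := by
    intro κ hκ x
    by_cases hx : P κ x
    · simp only [hG1]; rw [hloc κ _ (fun ξ η h => chi_inv Ξ h) x hx]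
      refine (abs_T_chi hκ Ξ hN f x).trans ?_
      have := mul_le_mul_of_nonneg_left (hEle κ hκ x hx) (by linarith : (0:ℝ) ≤ N)
      linarith
    · simp only [hG1]; rw [hvan κ _ (fun ξ η h => chi_inv Ξ h) x hx]; simp; positivity
  have hG1s : ∀ κ ≤ n, ∑ x, G1 κ x ^ 2 ≤ 2 * N * lam * ∑ x, |F κ x| := by
    intro κ hκ
    have e1 : ∑ x, G1 κ x ^ 2 = ∑ x, F κ x * G1 κ x := by
      have := T_self_adj (chi Ξ κ) (F κ) (G1 κ)
      simp only [hG1] at this ⊢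
      rw [T_comp] at this
      have e2 : (fun ξ => chi Ξ κ ξ * chi Ξ κ ξ) = chi Ξ κ := by
        funext ξ; rw [← pow_two, chi_sq]
      rw [e2] at this
      rw [← this]
      exact Finset.sum_congr rfl fun x _ => pow_two _
    rw [e1, Finset.mul_sum]
    refine Finset.sum_le_sum fun x _ => ?_
    calc F κ x * G1 κ x ≤ |F κ x * G1 κ x| := le_abs_self _
      _ = |F κ x| * |G1 κ x| := abs_mul _ _
      _ ≤ |F κ x| * (2 * N * lam) := mul_le_mul_of_nonneg_left (hG1b κ hκ x) (abs_nonneg _)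
      _ = _ := mul_comm _ _
  set g : (Fin n → Bool) → ℝ := fun x => F0 x + ∑ κ ∈ Finset.range (n + 1), G1 κ x with hg
  set b : (Fin n → Bool) → ℝ := fun x => ∑ κ ∈ Finset.range (n + 1), T (fun ξ => 1 - chi Ξ κ ξ) (F κ) x
    with hb
  have hfgb : f = fun x => g x + b x := by
    funext x
    rw [hfdec x]; simp only [hg, hb]
    rw [add_assoc, ← Finset.sum_add_distrib]; congr 1
    refine Finset.sum_congr rfl fun κ _ => ?_
    rw [T_msub, T_one]; simp only [hG1]; ring
  -- L2 of g
  have hgs : ∑ x, g x ^ 2 ≤ 2 * N * lam * ∑ x, h x := by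
    have hpt : ∀ x, g x ^ 2 = F0 x ^ 2 + ∑ κ ∈ Finset.range (n + 1), G1 κ x ^ 2 := by
      intro x
      by_cases hx : Bad x
      · obtain ⟨κ, hκ, hx'⟩ := hx
        have hz : ∀ l, l ≠ κ → G1 l x = 0 := fun l hl =>
          hvan l _ (fun ξ η h => chi_inv Ξ h) x fun h' => hl (isSt_unique h lam h' hx')
        have hz0 : F0 x = 0 := if_pos ⟨κ, hκ, hx'⟩
        simp only [hg]
        rw [Finset.sum_eq_single_of_mem κ (Finset.mem_range.mpr (by omega)) (fun l _ hl => hz l hl),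
          Finset.sum_eq_single_of_mem κ (Finset.mem_range.mpr (by omega))
            (fun l _ hl => by rw [hz l hl]; ring), hz0]
        ring
      · have hz : ∀ l ∈ Finset.range (n + 1), G1 l x = 0 := fun l hl =>
          hvan l _ (fun ξ η h => chi_inv Ξ h) x fun h' =>
            hx ⟨l, by have := Finset.mem_range.mp hl; omega, h'⟩
        simp only [hg]
        rw [Finset.sum_eq_zero hz, Finset.sum_eq_zero fun l hl => by rw [hz l hl]; ring]
        ring
    simp_rw [hpt]
    rw [Finset.sum_add_distrib, Finset.sum_comm, hL1, mul_add, Finset.mul_sum (Finset.range (n+1))]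
    refine add_le_add ?_ (Finset.sum_le_sum fun κ hκ =>
      hG1s κ (by have := Finset.mem_range.mp hκ; omega))
    rw [Finset.mul_sum]
    refine Finset.sum_le_sum fun x _ => ?_
    have hF0b : |F0 x| ≤ lam := by
      simp only [hF0]
      split_ifs with hx
      · simp; exact hlam.le
      · by_contra hc
        push Not at hc
        exact hx (isSt_exists h lam le_rfl (by rw [E_top]; exact hc))
    rw [← sq_abs]
    rw [pow_two]
    refine mul_le_mul_of_nonneg_right (hF0b.trans ?_) (abs_nonneg _)
    nlinarith
  -- bad set
  have hbadc : lam * ((Finset.univ.filter fun x => Bad x).card : ℝ) ≤ ∑ x, h x := by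
    have e1 : ∀ κ ≤ n, lam * ((Finset.univ.filter fun x => P κ x).card : ℝ) ≤ ∑ x, |F κ x| := by
      intro κ hκ
      have e2 := E_adjR hκ h (fun x => if P κ x then 1 else 0) (fun x y hxy => by
        have : P κ x ↔ P κ y := ⟨isSt_inv h lam hxy, isSt_inv h lam hxy.symm⟩
        simp only [this])
      have e3 : ∑ x, |F κ x| = ∑ x, h x * (if P κ x then 1 else 0) :=
        Finset.sum_congr rfl fun x _ => by simp only [hF, hh]; split_ifs <;> simp
      rw [e3, ← e2, Finset.card_filter]
      push_cast
      rw [Finset.mul_sum]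
      refine Finset.sum_le_sum fun x _ => ?_
      split_ifs with hx
      · have := hx.1; linarith
      · simp
    have e4 : ((Finset.univ.filter fun x => Bad x).card : ℝ) ≤
        ∑ κ ∈ Finset.range (n + 1), ((Finset.univ.filter fun x => P κ x).card : ℝ) := by
      have : (Finset.univ.filter fun x => Bad x) ⊆
          (Finset.range (n + 1)).biUnion fun κ => Finset.univ.filter fun x => P κ x := by
        intro x hx
        simp only [Finset.mem_filter, Finset.mem_univ, true_and] at hx
        obtain ⟨κ, hκ, hx'⟩ := hx
        simp only [Finset.mem_biUnion, Finset.mem_range, Finset.mem_filter, Finset.mem_univ, true_and]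
        exact ⟨κ, by omega, hx'⟩
      exact_mod_cast (Finset.card_le_card this).trans Finset.card_biUnion_le
    calc lam * ((Finset.univ.filter fun x => Bad x).card : ℝ)
        ≤ lam * ∑ κ ∈ Finset.range (n + 1), ((Finset.univ.filter fun x => P κ x).card : ℝ) :=
          mul_le_mul_of_nonneg_left e4 hlam.le
      _ = ∑ κ ∈ Finset.range (n + 1), lam * ((Finset.univ.filter fun x => P κ x).card : ℝ) :=
          Finset.mul_sum _ _ _
      _ ≤ ∑ κ ∈ Finset.range (n + 1), ∑ x, |F κ x| := Finset.sum_le_sum fun κ hκ =>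
          e1 κ (by have := Finset.mem_range.mp hκ; omega)
      _ ≤ _ := by rw [hL1]; have : 0 ≤ ∑ x, |F0 x| := Finset.sum_nonneg fun _ _ => abs_nonneg _
                  linarith
  have hSeq : ∀ x, ¬ Bad x → S m f x ≤ S m g x := by
    intro x hx
    refine S_le _ _ _ fun k hk => ?_
    have e1 : T (m k) f x = T (m k) g x + T (m k) b x := by
      conv_lhs => rw [hfgb]
      rw [T_add]
    have e2 : T (m k) b x = 0 := by
      simp only [hb]
      rw [T_sum]
      refine Finset.sum_eq_zero fun κ hκ => ?_
      have hκn : κ ≤ n := by have := Finset.mem_range.mp hκ; omega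
      have := congrFun (T_comp (m k) (fun ξ => 1 - chi Ξ κ ξ) (F κ)) x
      rw [this]
      exact hvan κ _ (fun ξ η h => hm k hk κ hκn ξ η h) x fun h' => hx ⟨κ, hκn, h'⟩
    rw [e1, e2, add_zero]
    exact le_S m g x hk
  -- Chebyshev
  have hch : s ^ 2 * ((Finset.univ.filter fun x => s < S m g x).card : ℝ) ≤ ∑ x, S m g x ^ 2 := by
    rw [Finset.card_filter]; push_cast; rw [Finset.mul_sum]
    refine Finset.sum_le_sum fun x _ => ?_
    split_ifs with hx
    · rw [mul_one]; exact pow_le_pow_left₀ hs.le hx.le 2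
    · simp; positivity
  have hsub : (Finset.univ.filter fun x => s < S m f x) ⊆
      (Finset.univ.filter fun x => Bad x) ∪ (Finset.univ.filter fun x => s < S m g x) := by
    intro x hx
    simp only [Finset.mem_union, Finset.mem_filter, Finset.mem_univ, true_and] at hx ⊢
    by_cases hb : Bad x
    · exact Or.inl hb
    · exact Or.inr (hx.trans_le (hSeq x hb))
  have hc : ((Finset.univ.filter fun x => s < S m f x).card : ℝ) ≤
      ((Finset.univ.filter fun x => Bad x).card : ℝ) + ((Finset.univ.filter fun x => s < S m g x).card : ℝ) := by
    exact_mod_cast (Finset.card_le_card hsub).trans (Finset.card_union_le _ _)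
  refine hc.trans (add_le_add ?_ ?_)
  · rw [le_div_iff₀ hlam]; linarith
  · rw [le_div_iff₀ (by positivity)]
    have := hB g
    have := mul_le_mul_of_nonneg_left hgs (sq_nonneg B)
    linarith

end HE

namespace HE

lemma lint1 {p u : ℝ} (hp : -1 < p) (hu : 0 < u) :
    ∫⁻ t in Ioi (0:ℝ), (if t < u then ENNReal.ofReal (t ^ p) else 0) =
      ENNReal.ofReal (u ^ (p + 1) / (p + 1)) := by
  have h1 : (fun t : ℝ => if t < u then ENNReal.ofReal (t ^ p) else 0) =
      (Iio u).indicator fun t => ENNReal.ofReal (t ^ p) := by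
    funext t; simp [indicator]
  rw [h1, setLIntegral_indicator measurableSet_Iio]
  have h2 : Iio u ∩ Ioi (0:ℝ) = Ioo 0 u := by rw [inter_comm]; exact Ioi_inter_Iio
  rw [h2, setLIntegral_congr (Ioo_ae_eq_Ioc), ← ofReal_integral_eq_lintegral_ofReal,
    ← intervalIntegral.integral_of_le hu.le, integral_rpow (Or.inl hp)]
  · rw [Real.zero_rpow (by linarith)]; simp
  · exact (intervalIntegrable_iff_integrableOn_Ioc_of_le hu.le).mp
      (intervalIntegral.intervalIntegrable_rpow' hp)
  · refine (ae_restrict_iff' measurableSet_Ioc).mpr (Eventually.of_forall fun t ht => ?_)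
    exact Real.rpow_nonneg ht.1.le _

lemma lint2 {p u : ℝ} (hp : p < -1) (hu : 0 < u) :
    ∫⁻ t in Ioi (0:ℝ), (if u ≤ t then ENNReal.ofReal (t ^ p) else 0) =
      ENNReal.ofReal (u ^ (p + 1) / (-(p + 1))) := by
  have h1 : (fun t : ℝ => if u ≤ t then ENNReal.ofReal (t ^ p) else 0) =
      (Ici u).indicator fun t => ENNReal.ofReal (t ^ p) := by
    funext t; simp [indicator]
  rw [h1, setLIntegral_indicator measurableSet_Ici]
  have h2 : Ici u ∩ Ioi (0:ℝ) = Ici u := inter_eq_left.mpr fun t ht => hu.trans_le ht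
  rw [h2, setLIntegral_congr (Ioi_ae_eq_Ici).symm, ← ofReal_integral_eq_lintegral_ofReal,
    integral_Ioi_rpow_of_lt hp hu]
  · congr 1; rw [div_neg, neg_div]
  · exact integrableOn_Ioi_rpow_of_lt hp hu
  · refine (ae_restrict_iff' measurableSet_Ioi).mpr (Eventually.of_forall fun t ht => ?_)
    exact Real.rpow_nonneg (hu.le.trans (le_of_lt ht)) _

lemma layer {q u : ℝ} (hq : 0 < q) (hu : 0 ≤ u) :
    ENNReal.ofReal (u ^ q) = ENNReal.ofReal q *
      ∫⁻ t in Ioi (0:ℝ), (if t < u then ENNReal.ofReal (t ^ (q - 1)) else 0) := by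
  rcases hu.eq_or_lt with h | h
  · rw [← h, Real.zero_rpow hq.ne']
    have : ∫⁻ t in Ioi (0:ℝ), (if t < (0:ℝ) then ENNReal.ofReal (t ^ (q - 1)) else 0) = 0 := by
      rw [setLIntegral_congr_fun (g := fun _ => 0) measurableSet_Ioi]
      · simp
      · intro t ht
        exact if_neg (not_lt.mpr (le_of_lt ht))
    rw [this]; simp
  · rw [lint1 (by linarith) h, ← ENNReal.ofReal_mul hq.le]
    congr 1
    rw [sub_add_cancel]; field_simp

theorem marc {X : Type*} [Fintype X] (Sop : (X → ℝ) → X → ℝ) (hS0 : ∀ f x, 0 ≤ Sop f x)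
    (hSadd : ∀ f g x, Sop (fun y => f y + g y) x ≤ Sop f x + Sop g x) (A D : ℝ) (hA : 0 ≤ A)
    (hD : 0 ≤ D)
    (h1 : ∀ f s, 0 < s → ((Finset.univ.filter fun x => s < Sop f x).card : ℝ) ≤ A / s * ∑ x, |f x|)
    (h2 : ∀ f s, 0 < s → ((Finset.univ.filter fun x => s < Sop f x).card : ℝ) ≤
      D / s ^ 2 * ∑ x, f x ^ 2) (q : ℝ) (hq1 : 1 < q) (hq2 : q < 2) (c : ℝ) (hc : 0 < c) (f : X → ℝ) :
    ∑ x, Sop f x ^ q ≤ q * (2 * A * c ^ (1 - q) / (q - 1) + 4 * D * c ^ (2 - q) / (2 - q)) *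
      ∑ x, |f x| ^ q := by
  have hpt : ∀ s, 0 < s → ((Finset.univ.filter fun x => s < Sop f x).card : ℝ) ≤
      ∑ x, ((if s < |f x| / c then 2 * A * |f x| * s⁻¹ else 0) +
        (if |f x| / c ≤ s then 4 * D * f x ^ 2 * (s ^ 2)⁻¹ else 0)) := by
    intro s hs
    set f1 : X → ℝ := fun x => if s < |f x| / c then f x else 0 with hf1
    set f2 : X → ℝ := fun x => if s < |f x| / c then 0 else f x with hf2
    have hf : f = fun x => f1 x + f2 x := by
      funext x; simp only [hf1, hf2]; split_ifs <;> simp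
    have hsub : (Finset.univ.filter fun x => s < Sop f x) ⊆
        (Finset.univ.filter fun x => s / 2 < Sop f1 x) ∪ (Finset.univ.filter fun x => s / 2 < Sop f2 x) := by
      intro x hx
      simp only [Finset.mem_union, Finset.mem_filter, Finset.mem_univ, true_and] at hx ⊢
      by_contra hcon
      push Not at hcon
      have := hSadd f1 f2 x
      rw [← hf] at this
      linarith [hcon.1, hcon.2]
    have e1 := h1 f1 (s / 2) (by linarith)
    have e2 := h2 f2 (s / 2) (by linarith)
    have e3 : ((Finset.univ.filter fun x => s < Sop f x).card : ℝ) ≤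
        ((Finset.univ.filter fun x => s / 2 < Sop f1 x).card : ℝ) +
          ((Finset.univ.filter fun x => s / 2 < Sop f2 x).card : ℝ) := by
      exact_mod_cast (Finset.card_le_card hsub).trans (Finset.card_union_le _ _)
    refine e3.trans ((add_le_add e1 e2).trans (le_of_eq ?_))
    rw [Finset.mul_sum, Finset.mul_sum, ← Finset.sum_add_distrib]
    refine Finset.sum_congr rfl fun x _ => ?_
    simp only [hf1, hf2]
    by_cases h : s < |f x| / c
    · rw [if_pos h, if_pos h, if_pos h, if_neg (not_le.mpr h)]; field_simp; ring
    · rw [if_neg h, if_neg h, if_neg h, if_pos (not_lt.mp h)]; simp; field_simp; ring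
  have hq0 : 0 < q := by linarith
  have hRpos : 0 ≤ q * (2 * A * c ^ (1 - q) / (q - 1) + 4 * D * c ^ (2 - q) / (2 - q)) := by
    have : 0 < q - 1 := by linarith
    have : 0 < 2 - q := by linarith
    positivity
  have hsum0 : 0 ≤ ∑ x, |f x| ^ q := Finset.sum_nonneg fun x _ => Real.rpow_nonneg (abs_nonneg _) _
  refine (ENNReal.ofReal_le_ofReal_iff (mul_nonneg hRpos hsum0)).mp ?_
  rw [ENNReal.ofReal_sum_of_nonneg fun x _ => Real.rpow_nonneg (hS0 f x) _]
  simp_rw [layer hq0 (hS0 f _)]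
  have hmeas1 : ∀ (u p : ℝ), Measurable fun t : ℝ => (if t < u then ENNReal.ofReal (t ^ p) else 0) :=
    fun u p => Measurable.ite measurableSet_Iio (by fun_prop) measurable_const
  have hmeas2 : ∀ (u p : ℝ), Measurable fun t : ℝ => (if u ≤ t then ENNReal.ofReal (t ^ p) else 0) :=
    fun u p => Measurable.ite measurableSet_Ici (by fun_prop) measurable_const
  rw [← Finset.mul_sum, ← lintegral_finsetSum _ fun x _ => hmeas1 _ _]
  have hstep : ∫⁻ t in Ioi (0:ℝ), ∑ x, (if t < Sop f x then ENNReal.ofReal (t ^ (q - 1)) else 0) ≤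
      ∫⁻ t in Ioi (0:ℝ), ∑ x, (ENNReal.ofReal (2 * A * |f x|) *
        (if t < |f x| / c then ENNReal.ofReal (t ^ (q - 2)) else 0) +
        ENNReal.ofReal (4 * D * f x ^ 2) *
        (if |f x| / c ≤ t then ENNReal.ofReal (t ^ (q - 3)) else 0)) := by
    refine setLIntegral_mono' measurableSet_Ioi fun t ht => ?_
    have ht0 : (0:ℝ) < t := ht
    have e1 : ∑ x, (if t < Sop f x then ENNReal.ofReal (t ^ (q - 1)) else 0) =
        ENNReal.ofReal (((Finset.univ.filter fun x => t < Sop f x).card : ℝ) * t ^ (q - 1)) := by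
      rw [← Finset.sum_filter, Finset.sum_const, nsmul_eq_mul, ENNReal.ofReal_mul (by positivity),
        ENNReal.ofReal_natCast]
    rw [e1]
    have e2 := mul_le_mul_of_nonneg_right (hpt t ht0) (Real.rpow_nonneg ht0.le (q - 1))
    refine (ENNReal.ofReal_le_ofReal e2).trans (le_of_eq ?_)
    rw [Finset.sum_mul, ENNReal.ofReal_sum_of_nonneg]
    · refine Finset.sum_congr rfl fun x _ => ?_
      have r1 : t ^ (q - 2) = t⁻¹ * t ^ (q - 1) := by
        rw [← Real.rpow_neg_one, ← Real.rpow_add ht0]; congr 1; ring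
      have r2 : t ^ (q - 3) = (t ^ 2)⁻¹ * t ^ (q - 1) := by
        rw [← Real.rpow_natCast, ← Real.rpow_neg ht0.le, ← Real.rpow_add ht0]; congr 1; push_cast; ring
      by_cases h : t < |f x| / c
      · rw [if_pos h, if_pos h, if_neg (not_le.mpr h), if_neg (not_le.mpr h), add_zero, mul_zero,
          add_zero, ← ENNReal.ofReal_mul (by positivity), r1]
        congr 1; ring
      · rw [if_neg h, if_neg h, if_pos (not_lt.mp h), if_pos (not_lt.mp h), zero_add, mul_zero,
          zero_add, ← ENNReal.ofReal_mul (by positivity), r2]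
        congr 1; ring
    · intro x _
      refine mul_nonneg (add_nonneg ?_ ?_) (by positivity) <;> split_ifs <;> positivity
  refine (mul_le_mul_right hstep _).trans ?_
  have hmm : ∀ x ∈ (Finset.univ : Finset X), Measurable fun t : ℝ => (ENNReal.ofReal (2 * A * |f x|) *
        (if t < |f x| / c then ENNReal.ofReal (t ^ (q - 2)) else 0) +
        ENNReal.ofReal (4 * D * f x ^ 2) *
        (if |f x| / c ≤ t then ENNReal.ofReal (t ^ (q - 3)) else 0)) :=
    fun x _ => (((hmeas1 _ _).const_mul _).add ((hmeas2 _ _).const_mul _))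
  rw [lintegral_finsetSum _ hmm,
    Finset.mul_sum, Finset.mul_sum, ENNReal.ofReal_sum_of_nonneg fun x _ =>
      mul_nonneg hRpos (Real.rpow_nonneg (abs_nonneg _) _)]
  refine Finset.sum_le_sum fun x _ => le_of_eq ?_
  rw [lintegral_add_left ((hmeas1 _ _).const_mul _), lintegral_const_mul _ (hmeas1 _ _),
    lintegral_const_mul _ (hmeas2 _ _)]
  by_cases hfx : f x = 0
  · rw [hfx]; simp [Real.zero_rpow hq0.ne']
  · have hv : 0 < |f x| := abs_pos.mpr hfx
    have hq1' : 0 < q - 1 := by linarith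
    have hq2' : 0 < 2 - q := by linarith
    rw [lint1 (by linarith) (by positivity), lint2 (by linarith) (by positivity),
      ← ENNReal.ofReal_mul (by positivity), ← ENNReal.ofReal_mul (by positivity),
      ← ENNReal.ofReal_add, ← ENNReal.ofReal_mul (by positivity)]
    · congr 1
      rw [show q - 2 + 1 = q - 1 by ring, show q - 3 + 1 = q - 2 by ring, Real.div_rpow hv.le hc.le,
        Real.div_rpow hv.le hc.le]
      have s1 : |f x| ^ q = |f x| * |f x| ^ (q - 1) := by
        nth_rw 2 [← Real.rpow_one |f x|]; rw [← Real.rpow_add hv]; congr 1; ring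
      have s2 : |f x| ^ q = f x ^ 2 * |f x| ^ (q - 2) := by
        rw [← sq_abs, ← Real.rpow_natCast, ← Real.rpow_add hv]; congr 1; push_cast; ring
      have s3 : c ^ (1 - q) = (c ^ (q - 1))⁻¹ := by rw [← Real.rpow_neg hc.le]; congr 1; ring
      have s4 : c ^ (2 - q) = (c ^ (q - 2))⁻¹ := by rw [← Real.rpow_neg hc.le]; congr 1; ring
      rw [mul_assoc q, add_mul, s3, s4]
      congr 1
      rw [show -(q - 2) = 2 - q by ring]
      congr 1
      · rw [s1]; field_simp
      · rw [s2]; field_simp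
    · have : 0 < q - 2 + 1 := by linarith
      positivity
    · have : 0 < -(q - 3 + 1) := by linarith
      positivity

end HE

namespace HE

variable {n : ℕ}

def Cq (q : ℝ) : ℝ := if q = 2 then 1 else q * (6 / (q - 1) + 4 / (2 - q))

lemma Cq_pos {q : ℝ} (hq1 : 1 < q) (hq2 : q ≤ 2) : 0 < Cq q := by
  unfold Cq
  split_ifs with h
  · norm_num
  · have : q < 2 := lt_of_le_of_ne hq2 h
    have h1 : 0 < q - 1 := by linarith
    have h2 : 0 < 2 - q := by linarith
    positivity

theorem level {q : ℝ} (hq1 : 1 < q) (hq2 : q ≤ 2) (m : ℕ → (Fin n → Bool) → ℝ)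
    (Ξ : Finset (Fin n → Bool)) (N : ℕ) (hN1 : 1 ≤ N) (hN : Ξ.card ≤ N)
    (hm : ∀ k ≤ n, ∀ κ ≤ n, ∀ ξ η, agF κ ξ η → m k ξ * (1 - chi Ξ κ ξ) = m k η * (1 - chi Ξ κ η))
    (B : ℝ) (hB0 : 0 < B) (hB : ∀ f, ∑ x, S m f x ^ 2 ≤ B ^ 2 * ∑ x, f x ^ 2)
    (f : (Fin n → Bool) → ℝ) :
    ∑ x, S m f x ^ q ≤ Cq q * B ^ q * (N : ℝ) ^ (1 - q / 2) * ∑ x, |f x| ^ q := by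
  unfold Cq
  split_ifs with h
  · subst h
    have := hB f
    simp only [Real.rpow_two, sq_abs]
    norm_num
    exact this
  · have hq2' : q < 2 := lt_of_le_of_ne hq2 h
    have hNr : (1 : ℝ) ≤ N := by exact_mod_cast hN1
    set σ : ℝ := Real.sqrt N with hσ
    have hσ0 : 0 < σ := Real.sqrt_pos.mpr (by linarith)
    have hσ2 : σ ^ 2 = N := Real.sq_sqrt (by linarith)
    have key := marc (S m) (S_nonneg m) (S_add_le m) (3 * B * σ) (B ^ 2) (by positivity) (by positivity)
      (fun f s hs => by
        have := weak m Ξ N hN1 hN hm B hB f (s / (B * σ)) s (by positivity) hs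
        refine this.trans (le_of_eq ?_)
        rw [← hσ2]; field_simp; ring)
      (fun f s hs => by
        have h1 : s ^ 2 * ((Finset.univ.filter fun x => s < S m f x).card : ℝ) ≤ ∑ x, S m f x ^ 2 := by
          rw [Finset.card_filter]; push_cast; rw [Finset.mul_sum]
          refine Finset.sum_le_sum fun x _ => ?_
          split_ifs with hx
          · rw [mul_one]; exact pow_le_pow_left₀ hs.le hx.le 2
          · simp; positivity
        rw [div_mul_eq_mul_div, le_div_iff₀ (by positivity)]
        have := hB f
        linarith) q hq1 hq2' (σ / B) (by positivity) f
    refine key.trans (le_of_eq ?_)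
    congr 1
    have hBq : B ^ q = B * B ^ (q - 1) := by
      nth_rw 2 [← Real.rpow_one B]; rw [← Real.rpow_add hB0]; congr 1; ring
    have hBq2 : B ^ q = B ^ 2 * B ^ (q - 2) := by
      rw [← Real.rpow_natCast, ← Real.rpow_add hB0]; congr 1; push_cast; ring
    have hNσ : (N : ℝ) ^ (1 - q / 2) = σ ^ (2 - q) := by
      rw [← hσ2, ← Real.rpow_natCast, ← Real.rpow_mul hσ0.le]; congr 1; push_cast; ring
    have hσq : σ ^ (2 - q) = σ * σ ^ (1 - q) := by
      nth_rw 2 [← Real.rpow_one σ]; rw [← Real.rpow_add hσ0]; congr 1; ring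
    have s1 : 2 * (3 * B * σ) * (σ / B) ^ (1 - q) = 6 * (B ^ q * σ ^ (2 - q)) := by
      rw [Real.div_rpow hσ0.le hB0.le, hBq, hσq, show (1 - q) = -(q - 1) by ring,
        Real.rpow_neg hB0.le]
      field_simp; ring
    have s2 : 4 * B ^ 2 * (σ / B) ^ (2 - q) = 4 * (B ^ q * σ ^ (2 - q)) := by
      rw [Real.div_rpow hσ0.le hB0.le, hBq2]
      have : B ^ (2 - q) = (B ^ (q - 2))⁻¹ := by rw [← Real.rpow_neg hB0.le]; congr 1; ring
      rw [this]; field_simp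
    rw [s1, s2, hNσ]; ring

lemma lp_sum_le {X : Type*} [Fintype X] {q : ℝ} (hq : 1 ≤ q) (g : ℕ → X → ℝ) (hg : ∀ j x, 0 ≤ g j x)
    (c : ℕ → ℝ) (hc : ∀ j, (∑ x, g j x ^ q) ^ (1 / q) ≤ c j) (J : ℕ) :
    (∑ x, (∑ j ∈ Finset.range J, g j x) ^ q) ^ (1 / q) ≤ ∑ j ∈ Finset.range J, c j := by
  have hq0 : 0 < q := by linarith
  induction J with
  | zero => simp [Real.zero_rpow hq0.ne', Real.zero_rpow (inv_ne_zero hq0.ne')]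
  | succ J ih =>
    simp_rw [Finset.sum_range_succ]
    have := Real.Lp_add_le Finset.univ (fun x => ∑ j ∈ Finset.range J, g j x) (g J) hq
    have e1 : ∀ x, |∑ j ∈ Finset.range J, g j x| = ∑ j ∈ Finset.range J, g j x := fun x =>
      abs_of_nonneg (Finset.sum_nonneg fun j _ => hg j x)
    have e2 : ∀ x, |∑ j ∈ Finset.range J, g j x + g J x| = ∑ j ∈ Finset.range J, g j x + g J x :=
      fun x => abs_of_nonneg (add_nonneg (Finset.sum_nonneg fun j _ => hg j x) (hg J x))
    have e3 : ∀ x, |g J x| = g J x := fun x => abs_of_nonneg (hg J x)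
    simp_rw [e1, e2, e3] at this
    exact this.trans (add_le_add ih (hc J))

lemma log_bound {ε : ℝ} (hε : 0 < ε) {N : ℕ} (hN : 1 ≤ N) :
    ((Nat.log 2 N + 1 : ℕ) : ℝ) ≤ (1 / (ε * Real.log 2) + 1) * (N : ℝ) ^ ε := by
  have hNr : (1 : ℝ) ≤ N := by exact_mod_cast hN
  have h1 : ((Nat.log 2 N : ℕ) : ℝ) ≤ Real.logb 2 N := by
    have := Real.natLog_le_logb N 2
    exact_mod_cast this
  have h2 := Real.log_le_rpow_div (x := (N:ℝ)) (by linarith) hε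
  have hl2 : 0 < Real.log 2 := Real.log_pos (by norm_num)
  have h3 : Real.logb 2 N ≤ (1 / (ε * Real.log 2)) * (N : ℝ) ^ ε := by
    unfold Real.logb
    rw [div_le_iff₀ hl2]
    refine h2.trans (le_of_eq ?_)
    field_simp
  have h4 : 1 ≤ (N : ℝ) ^ ε := Real.one_le_rpow hNr hε.le
  push_cast
  linarith

end HE

namespace HE

theorem finite_est (q r ε C0 : ℝ) (hq1 : 1 < q) (hq2 : q ≤ 2) (hr1 : 2 < r) (hr2 : r < 2 * q)
    (hε : 0 < ε) (hC0 : 0 ≤ C0) : ∃ C : ℝ, 0 < C ∧ ∀ (n : ℕ) (Ξ : Finset (Fin n → Bool)) (N : ℕ),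
    1 ≤ N → Ξ.card ≤ N → ∀ (a φ : ℕ → (Fin n → Bool) → ℝ),
    (∀ k, ∀ ξ η, agF k ξ η → a k ξ = a k η) →
    (∀ k, ∀ ξ η, agF k ξ η → φ k ξ = φ k η) →
    (∀ k ≤ n, ∀ ξ ∈ Ξ, |a k ξ| ≤ 1) →
    (∀ k ≤ n, ∀ ξ ∈ Ξ, 0 ≤ φ k ξ) → (∀ k ≤ n, ∀ ξ ∈ Ξ, φ k ξ ≤ 1) →
    (∀ k l, k ≤ l → l ≤ n → ∀ ξ ∈ Ξ, |a k ξ - a l ξ| ^ r ≤ φ k ξ - φ l ξ) →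
    ∀ (M : (Fin n → Bool) → ℝ) (Mj : ℕ → (Fin n → Bool) → ℝ) (Br : ℕ → Finset (Fin n → Bool)),
    (∀ ξ, Mj 0 ξ = 0) → (∃ J, Mj J = M) → (∀ j ξ, |M ξ - Mj j ξ| ≤ (1 / 2) ^ j) →
    (∀ j, ((Br j).card : ℝ) ≤ C0 * N * 2 ^ (r * j)) →
    (∀ j, ∀ κ ≤ n, ∀ ξ η, agF κ ξ η → chi (Br j) κ ξ = 0 → Mj j ξ = Mj j η) →
    ∀ f : (Fin n → Bool) → ℝ,
    (∑ x, S (fun k η => a k η * chi Ξ k η * M η) f x ^ q) ^ (1 / q) ≤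
      C * (N : ℝ) ^ (1 / q - 1 / r + ε) * (∑ x, |f x| ^ q) ^ (1 / q) := by
  have hq0 : 0 < q := by linarith
  have hr0 : 0 < r := by linarith
  set C1 : ℝ := 1 + 2 * C0 * 2 ^ r with hC1
  have hC1p : 0 < C1 := by positivity
  set ρ : ℝ := 2 ^ (-1 + r * (1 / q - 1 / 2)) with hρ
  have hρ0 : 0 < ρ := by positivity
  have hρ1 : ρ < 1 := by
    refine Real.rpow_lt_one_of_one_lt_of_neg (by norm_num) ?_
    have : r * (1 / q - 1 / 2) < 1 := by
      rw [div_sub_div _ _ hq0.ne' (by norm_num), mul_div_assoc', div_lt_one (by positivity)]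
      nlinarith
    linarith
  have hθ : 0 ≤ 1 / q - 1 / 2 := by
    rw [sub_nonneg]; exact one_div_le_one_div_of_le hq0 hq2
  set C2 : ℝ := (Cq q) ^ (1 / q) * 100 * C1 ^ (1 / q - 1 / 2) with hC2
  have hCqp := Cq_pos hq1 hq2
  have hC2p : 0 < C2 := by positivity
  have hl2 : 0 < Real.log 2 := Real.log_pos (by norm_num)
  set C3 : ℝ := 1 / (ε * Real.log 2) + 1 with hC3
  have hC3p : 0 < C3 := by positivity
  refine ⟨C2 * C3 * (1 - ρ)⁻¹, by have : 0 < 1 - ρ := by linarith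
                                  positivity, ?_⟩
  intro n Ξ N hN1 hN a φ hai hφi ha1 hφ0 hφ1 haφ M Mj Br hM0 hMJ hMapp hBr hconst f
  obtain ⟨J, hJ⟩ := hMJ
  have hNr : (1 : ℝ) ≤ N := by exact_mod_cast hN1
  set ℓ : ℕ := Nat.log 2 N + 1 with hℓ
  have hℓ1 : (1 : ℝ) ≤ ℓ := by rw [hℓ]; push_cast; linarith [Nat.cast_nonneg (α := ℝ) (Nat.log 2 N)]
  set mm : ℕ → ℕ → (Fin n → Bool) → ℝ := fun j k η =>
    a k η * chi Ξ k η * (Mj (j + 1) η - Mj j η) with hmm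
  set L : ℝ := (∑ x, |f x| ^ q) ^ (1 / q) with hL
  have hL0 : 0 ≤ L := by positivity
  have hlev : ∀ j, (∑ x, S (mm j) f x ^ q) ^ (1 / q) ≤
      C2 * ℓ * (N : ℝ) ^ (1 / q - 1 / r) * L * ρ ^ j := by
    intro j
    set N' : ℕ := N + (Br j).card + (Br (j + 1)).card with hN'
    have hN'1 : 1 ≤ N' := by omega
    have hN'c : (Ξ ∪ Br j ∪ Br (j + 1)).card ≤ N' := by
      have h1 := Finset.card_union_le (Ξ ∪ Br j) (Br (j + 1))
      have h2 := Finset.card_union_le Ξ (Br j)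
      omega
    have hN'r : (N' : ℝ) ≤ C1 * N * 2 ^ (r * j) := by
      have h1 := hBr j
      have h2 := hBr (j + 1)
      have h3 : (2:ℝ) ^ (r * ((j + 1 : ℕ) : ℝ)) = 2 ^ r * 2 ^ (r * j) := by
        rw [← Real.rpow_add (by norm_num)]; congr 1; push_cast; ring
      rw [h3] at h2
      have h4 : (1:ℝ) ≤ 2 ^ (r * j) := Real.one_le_rpow (by norm_num) (by positivity)
      have h5 : (1:ℝ) ≤ 2 ^ r := Real.one_le_rpow (by norm_num) (by positivity)
      have h6 : C0 * N * 2 ^ (r * j) ≤ C0 * N * (2 ^ r * 2 ^ (r * j)) :=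
        mul_le_mul_of_nonneg_left (le_mul_of_one_le_left (by positivity) h5) (by positivity)
      have h7 : (N:ℝ) ≤ N * 2 ^ (r * j) := le_mul_of_one_le_right (by linarith) h4
      rw [hN']; push_cast
      rw [hC1]
      calc (N : ℝ) + (Br j).card + (Br (j + 1)).card
          ≤ N * 2 ^ (r * j) + C0 * N * (2 ^ r * 2 ^ (r * j)) + C0 * N * (2 ^ r * 2 ^ (r * j)) := by
            linarith
        _ = _ := by ring
    set B : ℝ := 100 * ℓ * (N : ℝ) ^ (1 / 2 - 1 / r) * (1 / 2) ^ j with hB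
    have hB0 : 0 < B := by positivity
    have hinv : ∀ k ≤ n, ∀ κ ≤ n, ∀ ξ η, agF κ ξ η →
        mm j k ξ * (1 - chi (Ξ ∪ Br j ∪ Br (j + 1)) κ ξ) =
        mm j k η * (1 - chi (Ξ ∪ Br j ∪ Br (j + 1)) κ η) := by
      intro k hk κ hκ ξ η h
      rw [← chi_inv (Ξ ∪ Br j ∪ Br (j + 1)) h]
      rcases chi_cases (Ξ ∪ Br j ∪ Br (j + 1)) κ ξ with ⟨h1, -⟩ | h1
      · rw [h1]; ring
      · have hsub : ∀ Z ⊆ Ξ ∪ Br j ∪ Br (j + 1), chi Z κ ξ = 0 := by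
          intro Z hZ
          unfold chi at h1 ⊢
          rw [if_neg]
          rintro ⟨ζ, hζ, hζ2⟩
          rw [if_pos ⟨ζ, hZ hζ, hζ2⟩] at h1
          norm_num at h1
        have e1 := hconst j κ hκ ξ η h (hsub _ (by intro z hz; simp [hz]))
        have e2 := hconst (j + 1) κ hκ ξ η h (hsub _ (by intro z hz; simp [hz]))
        have e3 : a k ξ * chi Ξ k ξ = a k η * chi Ξ k η := by
          rcases le_total κ k with hκk | hκk
          · rw [hai k ξ η (h.mono hκk), chi_inv Ξ (h.mono hκk)]
          · have e4 : chi Ξ κ ξ = 0 := hsub _ (by intro z hz; simp [hz])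
            have e5 : chi Ξ k ξ = 0 :=
              le_antisymm (e4 ▸ chi_mono Ξ hκk ξ) (chi_nonneg _ _ _)
            have e6 : chi Ξ k η = 0 :=
              le_antisymm ((chi_inv Ξ h ▸ e4) ▸ chi_mono Ξ hκk η) (chi_nonneg _ _ _)
            rw [e5, e6]; ring
        simp only [hmm]
        rw [e3, e1, e2]
    have hL2 : ∀ f, ∑ x, S (mm j) f x ^ 2 ≤ B ^ 2 * ∑ x, f x ^ 2 := by
      intro f
      obtain ⟨Mx, hMx, hMxs⟩ := L2max r hr1 Ξ N hN1 hN a φ hai hφi ha1 hφ0 hφ1 haφ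
        (T (fun η => Mj (j + 1) η - Mj j η) f)
      have e1 : ∀ x, S (mm j) f x ^ 2 ≤ Mx x := by
        intro x
        have hMx0 : 0 ≤ Mx x := (sq_nonneg _).trans (hMx x 0 (Nat.zero_le _))
        have : S (mm j) f x ≤ Real.sqrt (Mx x) := by
          refine S_le _ _ _ fun k hk => Real.abs_le_sqrt ?_
          have := hMx x k hk
          rw [T_comp] at this
          exact this
        calc S (mm j) f x ^ 2 ≤ Real.sqrt (Mx x) ^ 2 := pow_le_pow_left₀ (S_nonneg _ _ _) this 2
          _ = Mx x := Real.sq_sqrt hMx0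
      have e2 := plancherel_le (fun η => Mj (j + 1) η - Mj j η) ((2 * (1 / 2) ^ j) ^ 2) (fun ξ => by
        rw [← sq_abs]
        refine pow_le_pow_left₀ (abs_nonneg _) ?_ 2
        have h1 := hMapp j ξ
        have h2 := hMapp (j + 1) ξ
        have h3 : ((1:ℝ) / 2) ^ (j + 1) ≤ (1 / 2) ^ j := pow_le_pow_of_le_one (by norm_num) (by norm_num) (Nat.le_succ j)
        rw [abs_le] at h1 h2 ⊢
        constructor <;> linarith [h1.1, h1.2, h2.1, h2.2]) f
      have hP0 : 0 ≤ (N : ℝ) ^ (1 - 2 / r) := by positivity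
      have hPsq : (N : ℝ) ^ (1 - 2 / r) = ((N : ℝ) ^ (1 / 2 - 1 / r)) ^ 2 := by
        rw [← Real.rpow_natCast, ← Real.rpow_mul (by linarith)]; congr 1; push_cast; ring
      calc ∑ x, S (mm j) f x ^ 2 ≤ ∑ x, Mx x := Finset.sum_le_sum fun x _ => e1 x
        _ ≤ 2400 * (ℓ : ℝ) ^ 2 * (N : ℝ) ^ (1 - 2 / r) * ∑ x, T (fun η => Mj (j + 1) η - Mj j η) f x ^ 2 := hMxs
        _ ≤ 2400 * (ℓ : ℝ) ^ 2 * (N : ℝ) ^ (1 - 2 / r) * ((2 * (1 / 2) ^ j) ^ 2 * ∑ x, f x ^ 2) :=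
          mul_le_mul_of_nonneg_left e2 (by positivity)
        _ ≤ B ^ 2 * ∑ x, f x ^ 2 := by
          rw [← mul_assoc]
          refine mul_le_mul_of_nonneg_right ?_ (Finset.sum_nonneg fun _ _ => sq_nonneg _)
          rw [hB, hPsq]
          have : 0 ≤ (ℓ : ℝ) ^ 2 * ((N : ℝ) ^ (1 / 2 - 1 / r)) ^ 2 * ((1 / 2) ^ j) ^ 2 := by positivity
          nlinarith
    have key := level hq1 hq2 (mm j) (Ξ ∪ Br j ∪ Br (j + 1)) N' hN'1 hN'c hinv B hB0 hL2 f
    have hS0 : 0 ≤ ∑ x, S (mm j) f x ^ q := Finset.sum_nonneg fun x _ => Real.rpow_nonneg (S_nonneg _ _ _) _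
    have hf0 : 0 ≤ ∑ x, |f x| ^ q := by positivity
    have k2 := Real.rpow_le_rpow hS0 key (by positivity : 0 ≤ 1 / q)
    refine k2.trans ?_
    rw [Real.mul_rpow (by positivity) hf0, Real.mul_rpow (by positivity) (by positivity),
      Real.mul_rpow hCqp.le (by positivity), ← Real.rpow_mul hB0.le, mul_one_div_cancel hq0.ne',
      Real.rpow_one, ← Real.rpow_mul (by positivity)]
    have k3 : (1 - q / 2) * (1 / q) = 1 / q - 1 / 2 := by field_simp
    rw [k3]
    have k4 : (N' : ℝ) ^ (1 / q - 1 / 2) ≤ C1 ^ (1 / q - 1 / 2) * (N : ℝ) ^ (1 / q - 1 / 2) *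
        ((2:ℝ) ^ (r * (1 / q - 1 / 2))) ^ j := by
      refine (Real.rpow_le_rpow (by positivity) hN'r hθ).trans (le_of_eq ?_)
      rw [Real.mul_rpow (by positivity) (by positivity), Real.mul_rpow hC1p.le (by positivity)]
      congr 1
      rw [← Real.rpow_natCast, ← Real.rpow_mul (by norm_num), ← Real.rpow_mul (by norm_num)]
      congr 1; ring
    have k5 : (N : ℝ) ^ (1 / q - 1 / r) = (N : ℝ) ^ (1 / 2 - 1 / r) * (N : ℝ) ^ (1 / q - 1 / 2) := by
      rw [← Real.rpow_add (by linarith)]; congr 1; ring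
    have k6 : ρ ^ j = (1 / 2) ^ j * ((2:ℝ) ^ (r * (1 / q - 1 / 2))) ^ j := by
      rw [← mul_pow, hρ, Real.rpow_add (by norm_num), Real.rpow_neg_one]; norm_num
    calc (Cq q) ^ (1 / q) * B * (N' : ℝ) ^ (1 / q - 1 / 2) * L
        ≤ (Cq q) ^ (1 / q) * B * (C1 ^ (1 / q - 1 / 2) * (N : ℝ) ^ (1 / q - 1 / 2) *
        ((2:ℝ) ^ (r * (1 / q - 1 / 2))) ^ j) * L :=
          mul_le_mul_of_nonneg_right (mul_le_mul_of_nonneg_left k4 (by positivity)) hL0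
      _ = _ := by rw [k5, k6, hC2, hB]; ring
  have hmink := lp_sum_le hq1.le (fun j x => S (mm j) f x) (fun j x => S_nonneg _ _ _) _ hlev J
  have hSle : ∀ x, S (fun k η => a k η * chi Ξ k η * M η) f x ≤ ∑ j ∈ Finset.range J, S (mm j) f x := by
    intro x
    refine S_le _ _ _ fun k hk => ?_
    have : (fun η => a k η * chi Ξ k η * M η) = fun η => ∑ j ∈ Finset.range J, mm j k η := by
      funext η
      simp only [hmm]
      rw [← Finset.mul_sum, Finset.sum_range_sub (fun j => Mj j η), hM0, hJ, sub_zero]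
    rw [this, T_msum]
    exact (Finset.abs_sum_le_sum_abs _ _).trans (Finset.sum_le_sum fun j _ => le_S (mm j) f x hk)
  have h1 : (∑ x, S (fun k η => a k η * chi Ξ k η * M η) f x ^ q) ^ (1 / q) ≤
      (∑ x, (∑ j ∈ Finset.range J, S (mm j) f x) ^ q) ^ (1 / q) := by
    refine Real.rpow_le_rpow (Finset.sum_nonneg fun x _ => Real.rpow_nonneg (S_nonneg _ _ _) _)
      (Finset.sum_le_sum fun x _ => Real.rpow_le_rpow (S_nonneg _ _ _) (hSle x) hq0.le) (by positivity)
  refine h1.trans (hmink.trans ?_)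
  rw [← Finset.mul_sum]
  have h2 : ∑ j ∈ Finset.range J, ρ ^ j ≤ (1 - ρ)⁻¹ := by
    rw [← tsum_geometric_of_lt_one hρ0.le hρ1]
    exact (summable_geometric_of_lt_one hρ0.le hρ1).sum_le_tsum _ (fun _ _ => by positivity)
  have h3 := log_bound hε hN1
  have h4 : (N : ℝ) ^ (1 / q - 1 / r + ε) = (N : ℝ) ^ (1 / q - 1 / r) * (N : ℝ) ^ ε :=
    Real.rpow_add (by linarith) _ _
  have h5 : 0 < 1 - ρ := by linarith
  calc C2 * ℓ * (N : ℝ) ^ (1 / q - 1 / r) * L * ∑ j ∈ Finset.range J, ρ ^ j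
      ≤ C2 * (C3 * (N : ℝ) ^ ε) * (N : ℝ) ^ (1 / q - 1 / r) * L * (1 - ρ)⁻¹ := by
        refine mul_le_mul ?_ h2 (Finset.sum_nonneg fun _ _ => by positivity) (by positivity)
        refine mul_le_mul_of_nonneg_right ?_ hL0
        refine mul_le_mul_of_nonneg_right ?_ (by positivity)
        exact mul_le_mul_of_nonneg_left h3 hC2p.le
    _ = _ := by rw [h4]; ring

end HE

namespace HE
variable {n : ℕ}

/-- position of a bit vector in the natural order -/
def idx (v : Fin n → Bool) : ℕ := Nat.ofBits v

lemma idx_lt (v : Fin n → Bool) : idx v < 2 ^ n := Nat.ofBits_lt_two_pow v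

lemma idx_bit (v : Fin n → Bool) (i : Fin n) : (idx v).testBit i = v i := by
  unfold idx; rw [Nat.testBit_ofBits_lt _ _ i.2]

lemma idx_inj {v w : Fin n → Bool} (h : idx v = idx w) : v = w := by
  funext i; rw [← idx_bit v i, h, idx_bit]

lemma agF_iff (κ : ℕ) (v w : Fin n → Bool) : agF κ v w ↔ idx v / 2 ^ κ = idx w / 2 ^ κ := by
  constructor
  · intro h
    apply Nat.eq_of_testBit_eq
    intro i
    rw [Nat.testBit_div_two_pow, Nat.testBit_div_two_pow]
    by_cases hi : i + κ < n
    · have := h ⟨i + κ, hi⟩ (by simp)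
      rw [← idx_bit v, ← idx_bit w] at this
      simpa using this
    · unfold idx
      rw [Nat.testBit_ofBits_ge _ _ (by omega), Nat.testBit_ofBits_ge _ _ (by omega)]
  · intro h i hi
    have := congrArg (fun z => z.testBit (i - κ)) h
    simp only [Nat.testBit_div_two_pow] at this
    rw [Nat.sub_add_cancel hi] at this
    rwa [idx_bit, idx_bit] at this

theorem finite_est2 (q r ε K : ℝ) (hq1 : 1 < q) (hq2 : q ≤ 2) (hr1 : 2 < r) (hr2 : r < 2 * q)
    (hε : 0 < ε) (hK : 0 ≤ K) : ∃ C : ℝ, 0 < C ∧ ∀ (n : ℕ) (Ξ : Finset (Fin n → Bool)) (N : ℕ),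
    1 ≤ N → Ξ.card ≤ N → ∀ (a φ : ℕ → (Fin n → Bool) → ℝ),
    (∀ k, ∀ ξ η, agF k ξ η → a k ξ = a k η) →
    (∀ k, ∀ ξ η, agF k ξ η → φ k ξ = φ k η) →
    (∀ k ≤ n, ∀ ξ ∈ Ξ, |a k ξ| ≤ 1) →
    (∀ k ≤ n, ∀ ξ ∈ Ξ, 0 ≤ φ k ξ) → (∀ k ≤ n, ∀ ξ ∈ Ξ, φ k ξ ≤ 1) →
    (∀ k l, k ≤ l → l ≤ n → ∀ ξ ∈ Ξ, |a k ξ - a l ξ| ^ r ≤ φ k ξ - φ l ξ) →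
    ∀ (M Φ : (Fin n → Bool) → ℝ), (∀ v, |M v| ≤ 1) → (∀ v, 0 ≤ Φ v) → (∀ v, Φ v ≤ K * N) →
    (∀ v w, idx v ≤ idx w → |M v - M w| ^ r ≤ Φ v - Φ w) →
    ∀ f : (Fin n → Bool) → ℝ,
    (∑ x, S (fun k η => a k η * chi Ξ k η * M η) f x ^ q) ^ (1 / q) ≤
      C * (N : ℝ) ^ (1 / q - 1 / r + ε) * (∑ x, |f x| ^ q) ^ (1 / q) := by
  obtain ⟨C, hC, H⟩ := finite_est q r ε (K + 1) hq1 hq2 hr1 hr2 hε (by linarith)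
  refine ⟨C, hC, ?_⟩
  intro n Ξ N hN hΞ a φ ha hφ ha1 hφ0 hφ1 haφ M Φ hM hΦ0 hΦK hMΦ f
  have hN' : (1 : ℝ) ≤ N := by exact_mod_cast hN
  let lev : ℕ → (Fin n → Bool) → ℕ := fun j v => ⌊Φ v * 2 ^ (r * j)⌋₊
  have hanti : ∀ v w, idx v ≤ idx w → Φ w ≤ Φ v := fun v w h => by
    have := hMΦ v w h
    have h0 : 0 ≤ |M v - M w| ^ r := by positivity
    linarith
  have hlanti : ∀ j v w, idx v ≤ idx w → lev j w ≤ lev j v := fun j v w h => by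
    apply Nat.floor_le_floor
    exact mul_le_mul_of_nonneg_right (hanti v w h) (by positivity)
  -- first element of a level
  have hex : ∀ j v, ∃ w, lev j w = lev j v ∧ ∀ w', lev j w' = lev j v → idx w ≤ idx w' := by
    intro j v
    obtain ⟨w, hw, hw'⟩ := Finset.exists_min_image (Finset.univ.filter fun w => lev j w = lev j v) idx
      ⟨v, by simp⟩
    refine ⟨w, by simpa using hw, fun w' h => hw' w' (by simpa using h)⟩
  choose rep hrep1 hrep2 using hex
  have hrepc : ∀ j v w, lev j v = lev j w → rep j v = rep j w := by
    intro j v w h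
    apply idx_inj
    apply le_antisymm
    · apply hrep2; rw [hrep1, h]
    · apply hrep2; rw [hrep1, h]
  let big : ℕ → Prop := fun j => (2 ^ n : ℝ) ≤ (K + 1) * N * 2 ^ (r * j)
  let Mj : ℕ → (Fin n → Bool) → ℝ := fun j v =>
    if j = 0 then 0 else if big j then M v else M (rep j v)
  let Br : ℕ → Finset (Fin n → Bool) := fun j =>
    if j = 0 then ∅ else if big j then Finset.univ else Finset.univ.image (rep j)
  refine H n Ξ N hN hΞ a φ ha hφ ha1 hφ0 hφ1 haφ M Mj Br ?_ ?_ ?_ ?_ ?_ f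
  · intro ξ; simp [Mj]
  · refine ⟨n + 1, ?_⟩
    funext v
    have : big (n + 1) := by
      simp only [big]
      have h1 : (2 : ℝ) ^ n ≤ 2 ^ (r * ((n + 1 : ℕ) : ℝ)) := by
        rw [← Real.rpow_natCast]
        apply Real.rpow_le_rpow_of_exponent_le (by norm_num)
        push_cast
        nlinarith [(Nat.cast_nonneg n : (0 : ℝ) ≤ n)]
      have h2 : (1 : ℝ) ≤ (K + 1) * N := by nlinarith
      have h3 : (0 : ℝ) ≤ 2 ^ (r * ((n + 1 : ℕ) : ℝ)) := by positivity
      nlinarith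
    simp [Mj, this]
  · intro j v
    simp only [Mj]
    split_ifs with h1 h2
    · subst h1; simpa using hM v
    · simp
    · have hle : idx (rep j v) ≤ idx v := hrep2 j v v rfl
      have h3 := hMΦ _ _ hle
      have h4 : (Φ (rep j v) - Φ v) * 2 ^ (r * j) ≤ 1 := by
        have e := hrep1 j v
        simp only [lev] at e
        have h5 := Nat.lt_floor_add_one (Φ (rep j v) * 2 ^ (r * (j : ℝ)))
        have h6 := Nat.floor_le (a := Φ v * 2 ^ (r * (j : ℝ))) (mul_nonneg (hΦ0 v) (by positivity))
        rw [e] at h5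
        nlinarith
      have h5 : |M v - M (rep j v)| ^ r ≤ ((1 / 2 : ℝ) ^ j) ^ r := by
        rw [abs_sub_comm]
        refine h3.trans ?_
        have e1 : (((1 / 2 : ℝ) ^ j) ^ r) = (2 ^ (r * (j : ℝ)))⁻¹ := by
          rw [mul_comm, Real.rpow_mul (by norm_num), Real.rpow_natCast, one_div, inv_pow,
            Real.inv_rpow (by positivity)]
        rw [e1, ← one_div, le_div_iff₀ (by positivity)]
        exact h4
      exact (Real.rpow_le_rpow_iff (abs_nonneg _) (by positivity) (by linarith)).1 h5
  · intro j
    simp only [Br]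
    split_ifs with h1 h2
    · simp; positivity
    · simp [big] at h2 ⊢; exact h2
    · have hc : (Finset.univ.image (rep j)).card ≤ ⌊K * N * 2 ^ (r * (j : ℝ))⌋₊ + 1 := by
        rw [← Finset.card_range (⌊K * N * 2 ^ (r * (j : ℝ))⌋₊ + 1)]
        apply Finset.card_le_card_of_injOn (lev j)
        · intro w hw
          simp only [Finset.coe_range, mem_Iio, Nat.lt_succ_iff]
          apply Nat.floor_le_floor
          exact mul_le_mul_of_nonneg_right (hΦK w) (by positivity)
        · intro w hw w' hw' hww
          simp only [Finset.coe_image, Finset.coe_univ, image_univ, mem_range] at hw hw'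
          obtain ⟨v, rfl⟩ := hw
          obtain ⟨v', rfl⟩ := hw'
          rw [hrep1, hrep1] at hww
          exact hrepc _ _ _ hww
      have hc' : ((Finset.univ.image (rep j)).card : ℝ) ≤ K * N * 2 ^ (r * (j : ℝ)) + 1 := by
        have h7 : ((⌊K * N * 2 ^ (r * (j : ℝ))⌋₊ : ℕ) : ℝ) ≤ K * N * 2 ^ (r * (j : ℝ)) :=
          Nat.floor_le (by positivity)
        have h8 : ((Finset.univ.image (rep j)).card : ℝ) ≤
          (⌊K * N * 2 ^ (r * (j : ℝ))⌋₊ : ℝ) + 1 := by exact_mod_cast hc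
        linarith
      have h9 : (1 : ℝ) ≤ 2 ^ (r * (j : ℝ)) := Real.one_le_rpow (by norm_num) (by positivity)
      nlinarith
  · intro j κ hκ
    have key : ∀ ξ η, idx ξ ≤ idx η → agF κ ξ η → chi (Br j) κ ξ = 0 → Mj j ξ = Mj j η := by
      intro ξ η hle hag hchi
      simp only [Mj]
      split_ifs with h1 h2
      · rfl
      · exfalso
        simp only [Br, h1, h2, if_true, if_false, chi] at hchi
        simp only [Finset.mem_univ, true_and, ite_eq_right_iff, one_ne_zero, imp_false] at hchi
        exact hchi ⟨ξ, agF_refl _ _⟩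
      · by_cases hl : lev j ξ = lev j η
        · rw [hrepc _ _ _ hl]
        · exfalso
          simp only [Br, h1, h2, if_false, chi] at hchi
          simp only [ite_eq_right_iff, one_ne_zero, imp_false] at hchi
          apply hchi
          refine ⟨rep j η, by simp, ?_⟩
          have h4 : idx (rep j η) ≤ idx η := hrep2 j η η rfl
          have h5 : idx ξ ≤ idx (rep j η) := by
            by_contra hcon
            have h6 := hlanti j _ _ (le_of_not_ge hcon)
            rw [hrep1] at h6
            exact hl (le_antisymm h6 (hlanti j _ _ hle))
          rw [agF_iff] at hag ⊢
          apply le_antisymm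
          · rw [hag]; exact Nat.div_le_div_right h4
          · exact Nat.div_le_div_right h5
    intro ξ η hag hchi
    rcases le_total (idx ξ) (idx η) with h | h
    · exact key ξ η h hag hchi
    · exact (key η ξ h hag.symm (by rw [← chi_inv _ hag]; exact hchi)).symm
end HE

namespace HE
section
variable {ι : Type*} [LinearOrder ι]

/-- variation to the right of a point -/
def Vc (r : ℝ) (D : Set ι) (m : ι → ℝ) (x : ι) : ℝ≥0∞ :=
  ⨆ (N : ℕ) (u : Fin (N + 1) → ι) (_ : StrictMono u) (_ : ∀ i, u i ∈ D) (_ : x ≤ u 0),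
      (∑ i : Fin N, (‖m (u i.succ) - m (u i.castSucc)‖₊ : ℝ≥0∞) ^ r)

lemma le_Vc (r : ℝ) (D : Set ι) (m : ι → ℝ) (x : ι) {N : ℕ} (u : Fin (N + 1) → ι)
    (h1 : StrictMono u) (h2 : ∀ i, u i ∈ D) (h3 : x ≤ u 0) :
    (∑ i : Fin N, (‖m (u i.succ) - m (u i.castSucc)‖₊ : ℝ≥0∞) ^ r) ≤ Vc r D m x := by
  unfold Vc
  exact le_iSup_of_le N (le_iSup_of_le u (le_iSup_of_le h1 (le_iSup_of_le h2 (le_iSup_of_le h3 le_rfl))))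

lemma Vc_le {r : ℝ} (hr : 0 < r) (D : Set ι) (m : ι → ℝ) (x : ι) :
    Vc r D m x ≤ vnorm r D m ^ r := by
  unfold Vc
  refine iSup_le fun N => iSup_le fun u => iSup_le fun h1 => iSup_le fun h2 => iSup_le fun h3 => ?_
  have h : (∑ i : Fin N, (‖m (u i.succ) - m (u i.castSucc)‖₊ : ℝ≥0∞) ^ r) ^ (1 / r) ≤ vnorm r D m := by
    unfold vnorm
    refine le_add_left ?_
    exact le_iSup_of_le N (le_iSup_of_le u (le_iSup_of_le h1 (le_iSup_of_le h2 le_rfl)))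
  have h' := ENNReal.rpow_le_rpow h hr.le
  rwa [← ENNReal.rpow_mul, one_div, inv_mul_cancel₀ hr.ne', ENNReal.rpow_one] at h'

lemma norm_le_vnorm {r : ℝ} {D : Set ι} (m : ι → ℝ) {x : ι} (hx : x ∈ D) :
    (‖m x‖₊ : ℝ≥0∞) ≤ vnorm r D m := by
  unfold vnorm
  refine le_add_right ?_
  exact le_iSup₂_of_le x hx le_rfl

lemma Vc_congr {r : ℝ} {D : Set ι} {m m' : ι → ℝ} {x : ι} (h : ∀ z, x ≤ z → m z = m' z) :
    Vc r D m x = Vc r D m' x := by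
  unfold Vc
  refine iSup_congr fun N => iSup_congr fun u => iSup_congr fun h1 => iSup_congr fun h2 =>
    iSup_congr fun h3 => ?_
  refine Finset.sum_congr rfl fun i _ => ?_
  have hu : ∀ j, x ≤ u j := fun j => h3.trans (h1.monotone (Fin.zero_le j))
  rw [h _ (hu _), h _ (hu _)]

lemma cons_strict {N : ℕ} {u : Fin (N + 1) → ι} (h1 : StrictMono u) {x : ι} (hx : x < u 0) :
    StrictMono (Fin.cons x u : Fin (N + 1 + 1) → ι) := by
  rw [Fin.strictMono_iff_lt_succ]
  intro i
  refine Fin.cases ?_ (fun j => ?_) i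
  · simpa using hx
  · rw [Fin.castSucc_succ]
    simp only [Fin.cons_succ]
    exact h1 (Fin.castSucc_lt_succ)

lemma cons_sum {N : ℕ} (u : Fin (N + 1) → ι) (x : ι) (m : ι → ℝ) (r : ℝ) :
    (∑ i : Fin (N + 1), (‖m ((Fin.cons x u : Fin (N + 1 + 1) → ι) i.succ) -
      m ((Fin.cons x u : Fin (N + 1 + 1) → ι) i.castSucc)‖₊ : ℝ≥0∞) ^ r) =
    (‖m (u 0) - m x‖₊ : ℝ≥0∞) ^ r +
      ∑ i : Fin N, (‖m (u i.succ) - m (u i.castSucc)‖₊ : ℝ≥0∞) ^ r := by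
  rw [Fin.sum_univ_succ]
  congr 1

lemma Vc_super {r : ℝ} (hr : 0 < r) {D : Set ι} (m : ι → ℝ) {x y : ι} (hx : x ∈ D) (hy : y ∈ D)
    (hxy : x ≤ y) : (‖m y - m x‖₊ : ℝ≥0∞) ^ r + Vc r D m y ≤ Vc r D m x := by
  rcases hxy.eq_or_lt with rfl | hlt
  · simp [hr]
  have key : ∀ (N : ℕ) (u : Fin (N + 1) → ι), StrictMono u → (∀ i, u i ∈ D) → y ≤ u 0 →
      (‖m y - m x‖₊ : ℝ≥0∞) ^ r +
        (∑ i : Fin N, (‖m (u i.succ) - m (u i.castSucc)‖₊ : ℝ≥0∞) ^ r) ≤ Vc r D m x := by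
    intro N u h1 h2 h3
    rcases h3.eq_or_lt with h | h
    · have hc := cons_strict h1 (x := x) (by rwa [← h])
      refine le_trans (le_of_eq ?_) (le_Vc r D m x _ hc ?_ ?_)
      · rw [cons_sum, h]
      · intro i; refine Fin.cases ?_ (fun j => ?_) i
        · simpa using hx
        · simpa using h2 j
      · simp
    · have hc := cons_strict h1 (x := y) h
      have hc' := cons_strict hc (x := x) (by simpa using hlt)
      refine le_trans ?_ (le_Vc r D m x _ hc' ?_ ?_)
      · rw [cons_sum, cons_sum]
        simp only [Fin.cons_zero]
        gcongr
        exact le_add_self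
      · intro i; refine Fin.cases ?_ (fun j => Fin.cases ?_ (fun j => ?_) j) i
        · simpa using hx
        · simpa using hy
        · simpa using h2 j
      · simp
  have hc : (‖m y - m x‖₊ : ℝ≥0∞) ^ r ≤ Vc r D m x := by
    have := key 0 (fun _ => y) (by intro a b h; exact absurd h (by omega)) (fun _ => hy) le_rfl
    simpa using this
  have hV : Vc r D m y ≤ Vc r D m x - (‖m y - m x‖₊ : ℝ≥0∞) ^ r := by
    conv_lhs => unfold Vc
    refine iSup_le fun N => iSup_le fun u => iSup_le fun h1 => iSup_le fun h2 => iSup_le fun h3 => ?_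
    exact ENNReal.le_sub_of_add_le_left (by simp [hr.le]) (key N u h1 h2 h3)
  calc _ ≤ (‖m y - m x‖₊ : ℝ≥0∞) ^ r + (Vc r D m x - (‖m y - m x‖₊ : ℝ≥0∞) ^ r) := by gcongr
    _ = _ := add_tsub_cancel_of_le hc

/-- real valued control function -/
def Vr (r : ℝ) (D : Set ι) (m : ι → ℝ) (x : ι) : ℝ := (Vc r D m x).toReal

lemma Vr_nonneg (r : ℝ) (D : Set ι) (m : ι → ℝ) (x : ι) : 0 ≤ Vr r D m x := ENNReal.toReal_nonneg

lemma Vr_le {r : ℝ} (hr : 0 < r) {D : Set ι} {m : ι → ℝ} {A : ℝ} (hA0 : 0 ≤ A)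
    (hA : vnorm r D m ≤ ENNReal.ofReal A) (x : ι) : Vr r D m x ≤ A ^ r := by
  have h := (Vc_le hr D m x).trans (ENNReal.rpow_le_rpow hA hr.le)
  rw [ENNReal.ofReal_rpow_of_nonneg hA0 hr.le] at h
  exact ENNReal.toReal_le_of_le_ofReal (by positivity) h

lemma Vr_super {r : ℝ} (hr : 0 < r) {D : Set ι} {m : ι → ℝ} (hA : vnorm r D m ≠ ⊤) {x y : ι}
    (hx : x ∈ D) (hy : y ∈ D) (hxy : x ≤ y) : |m x - m y| ^ r ≤ Vr r D m x - Vr r D m y := by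
  have hfin : ∀ z, Vc r D m z ≠ ⊤ := fun z => ne_top_of_le_ne_top
    (ENNReal.rpow_ne_top_of_nonneg hr.le hA) (Vc_le hr D m z)
  have h := Vc_super hr m hx hy hxy
  have h' := ENNReal.toReal_mono (hfin x) h
  rw [ENNReal.toReal_add (by simp [hr.le]) (hfin y), ← ENNReal.toReal_rpow] at h'
  simp only [ENNReal.coe_toReal, coe_nnnorm, Real.norm_eq_abs] at h'
  rw [abs_sub_comm]
  unfold Vr; linarith

lemma abs_le_of_vnorm {r : ℝ} {D : Set ι} {m : ι → ℝ} {A : ℝ} (hA0 : 0 ≤ A)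
    (hA : vnorm r D m ≤ ENNReal.ofReal A) {x : ι} (hx : x ∈ D) : |m x| ≤ A := by
  have h := (norm_le_vnorm (r := r) m hx).trans hA
  rw [← ENNReal.ofReal_coe_nnreal, ENNReal.ofReal_le_ofReal_iff hA0] at h
  simpa using h
end

/-- a sum of functions with disjoint supports -/
lemma sum_control {κ : Type*} (s : Finset κ) (p : κ → ℝ → ℝ) (r : ℝ) (hr : 1 < r) (x y : ℝ)
    (hdis : ∀ z, ∀ i ∈ s, ∀ j ∈ s, p i z ≠ 0 → p j z ≠ 0 → i = j) :
    |∑ i ∈ s, p i x - ∑ i ∈ s, p i y| ^ r ≤ 2 ^ r * ∑ i ∈ s, |p i x - p i y| ^ r := by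
  rw [← Finset.sum_sub_distrib]
  -- at most two indices matter
  have hone : ∀ z, ∃ t ⊆ s, t.card ≤ 1 ∧ ∀ i ∈ s, p i z ≠ 0 → i ∈ t := by
    intro z
    refine ⟨s.filter fun i => p i z ≠ 0, Finset.filter_subset _ _, ?_, ?_⟩
    · rw [Finset.card_le_one]
      intro i hi j hj
      simp only [Finset.mem_filter] at hi hj
      exact hdis z i hi.1 j hj.1 hi.2 hj.2
    · intro i hi h; simp [hi, h]
  obtain ⟨t1, h1s, h1c, h1⟩ := hone x
  obtain ⟨t2, h2s, h2c, h2⟩ := hone y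
  set t := t1 ∪ t2
  have ht : t ⊆ s := Finset.union_subset h1s h2s
  have htc : t.card ≤ 2 := (Finset.card_union_le _ _).trans (by omega)
  have e : ∑ i ∈ s, (p i x - p i y) = ∑ i ∈ t, (p i x - p i y) := by
    symm
    apply Finset.sum_subset ht
    intro i hi hit
    have hx : p i x = 0 := by
      by_contra hc; exact hit (Finset.mem_union_left _ (h1 i hi hc))
    have hy : p i y = 0 := by
      by_contra hc; exact hit (Finset.mem_union_right _ (h2 i hi hc))
    rw [hx, hy, sub_zero]
  rw [e]
  have h3 : |∑ i ∈ t, (p i x - p i y)| ^ r ≤ (∑ i ∈ t, |p i x - p i y|) ^ r :=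
    Real.rpow_le_rpow (abs_nonneg _) (Finset.abs_sum_le_sum_abs _ _) (by linarith)
  have h5 : (∑ i ∈ t, |p i x - p i y|) ^ r ≤ (t.card : ℝ) ^ (r - 1) * ∑ i ∈ t, |p i x - p i y| ^ r := by
    have := Real.rpow_sum_le_const_mul_sum_rpow t (fun i => p i x - p i y) hr.le
    simpa using this
  refine h3.trans (h5.trans ?_)
  apply mul_le_mul
  · have : (t.card : ℝ) ≤ 2 := by exact_mod_cast htc
    calc (t.card : ℝ) ^ (r - 1) ≤ 2 ^ (r - 1) := Real.rpow_le_rpow (by positivity) this (by linarith)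
      _ ≤ 2 ^ r := Real.rpow_le_rpow_of_exponent_le (by norm_num) (by linarith)
  · apply Finset.sum_le_sum_of_subset_of_nonneg ht
    intros; positivity
  · apply Finset.sum_nonneg; intros; positivity
  · positivity

lemma sum_abs_le {κ : Type*} (s : Finset κ) (p : κ → ℝ → ℝ) (B : ℝ) (hB : 0 ≤ B) (z : ℝ)
    (hdis : ∀ i ∈ s, ∀ j ∈ s, p i z ≠ 0 → p j z ≠ 0 → i = j) (h : ∀ i ∈ s, |p i z| ≤ B) :
    |∑ i ∈ s, p i z| ≤ B := by
  by_cases hex : ∃ i ∈ s, p i z ≠ 0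
  · obtain ⟨i, hi, hne⟩ := hex
    rw [Finset.sum_eq_single_of_mem i hi]
    · exact h i hi
    · intro j hj hji
      by_contra hc
      exact hji (hdis j hj i hi hc hne)
  · push Not at hex
    rw [Finset.sum_eq_zero hex]; simpa using hB
end HE

namespace HE

lemma floor_shift (x : ℝ) (k : ℤ) (t : ℕ) : ⌊x / 2 ^ (k + t)⌋ = ⌊x / 2 ^ k⌋ / 2 ^ t := by
  have := Int.floor_div_natCast (x / 2 ^ k) (2 ^ t)
  push_cast at this
  rw [← this, zpow_add₀ (by norm_num), zpow_natCast, div_div]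

lemma digit_zero_or_one (m : ℤ) (x : ℝ) : digit m x = 0 ∨ digit m x = 1 := by
  unfold digit; omega

lemma digit_big {L : ℕ} {x : ℝ} (h0 : 0 ≤ x) (hx : x < 2 ^ L) {m : ℤ} (hm : (L : ℤ) ≤ m) :
    digit m x = 0 := by
  unfold digit
  have h2 : (2 : ℝ) ^ L ≤ 2 ^ m := by
    rw [← zpow_natCast]; exact zpow_le_zpow_right₀ (by norm_num) hm
  have : ⌊x / 2 ^ m⌋ = 0 := by
    rw [Int.floor_eq_zero_iff]
    refine ⟨by positivity, ?_⟩
    rw [div_lt_one (by positivity)]; linarith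
  rw [this]; rfl

/-- frequency bits -/
def vecF (L : ℕ) (x : ℝ) : Fin (2 * L) → Bool := fun i => (⌊x * 2 ^ L⌋₊).testBit i

/-- space bits, in reversed order -/
def vecX (L : ℕ) (x : ℝ) : Fin (2 * L) → Bool := fun i => vecF L x i.rev

lemma digit_vecF {L : ℕ} {x : ℝ} (h0 : 0 ≤ x) (i : Fin (2 * L)) :
    digit ((i : ℤ) - L) x = if vecF L x i = true then 1 else 0 := by
  unfold digit vecF
  have h1 : ⌊x / 2 ^ ((i : ℤ) - L)⌋ = ((⌊x * 2 ^ L⌋₊ / 2 ^ (i : ℕ) : ℕ) : ℤ) := by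
    have := floor_shift x (-(L : ℤ)) i
    rw [neg_add_eq_sub] at this
    rw [this, zpow_neg, zpow_natCast, div_inv_eq_mul, ← Int.natCast_floor_eq_floor (by positivity)]
    push_cast; rfl
  rw [h1, Nat.testBit_eq_decide_div_mod_eq]
  simp only [decide_eq_true_eq]
  split_ifs with h
  · exact_mod_cast h
  · have : ⌊x * 2 ^ L⌋₊ / 2 ^ (i : ℕ) % 2 = 0 := by omega
    exact_mod_cast this

lemma wMulDigit_eq (n : ℤ) (x y : ℝ) (s : Finset ℤ) (hs : ∀ m ∉ s, digit (n - m) x * digit m y = 0) :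
    wMulDigit n x y = (∑ m ∈ s, digit (n - m) x * digit m y) % 2 := by
  unfold wMulDigit
  rw [tsum_eq_sum (s := s) (fun m hm => by rw [hs m hm]; simp), ← Int.cast_sum, Int.floor_intCast]

lemma wMulDigit_cases (n : ℤ) (x y : ℝ) : wMulDigit n x y = 0 ∨ wMulDigit n x y = 1 := by
  unfold wMulDigit; omega

lemma wMulDigit_big {L : ℕ} {x y : ℝ} (hx0 : 0 ≤ x) (hx : x < 2 ^ L) (hy0 : 0 ≤ y) (hy : y < 2 ^ L)
    {n : ℤ} (hn : 2 * (L : ℤ) ≤ n) : wMulDigit n x y = 0 := by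
  rw [wMulDigit_eq n x y ∅]
  · simp
  · intro m _
    by_cases h : (L : ℤ) ≤ m
    · rw [digit_big hy0 hy h, mul_zero]
    · rw [digit_big hx0 hx (by omega), zero_mul]

lemma floor_digits (d : ℤ → ℤ) (hd : ∀ n, d n = 0 ∨ d n = 1) (R : ℕ) (hR : ∀ n : ℤ, R ≤ n → d n = 0)
    (n0 : ℕ) (hn0 : d (-(n0 + 1)) = 0) : ⌊∑' n : ℤ, ((d n : ℤ) : ℝ) * 2 ^ n⌋ % 2 = d 0 := by
  have h1 : HasSum (fun n : ℕ => ((d n : ℤ) : ℝ) * 2 ^ (n : ℤ))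
      (∑ n ∈ Finset.range (R + 1), ((d n : ℤ) : ℝ) * 2 ^ (n : ℤ)) := by
    apply hasSum_sum_of_ne_finset_zero
    intro n hn
    rw [hR n (by simp at hn; omega)]; simp
  have hg : HasSum (fun n : ℕ => (2 : ℝ) ^ (-((n : ℤ) + 1))) 1 := by
    have := hasSum_geometric_two' 1
    convert this using 2 with n
    rw [zpow_neg, zpow_add₀ (by norm_num), zpow_natCast]; simp; ring
  have hle : ∀ n : ℕ, ((d (-(n + 1)) : ℤ) : ℝ) * 2 ^ (-((n : ℤ) + 1)) ≤ (2 : ℝ) ^ (-((n : ℤ) + 1)) := by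
    intro n
    have hp : (0 : ℝ) < 2 ^ (-((n : ℤ) + 1)) := by positivity
    rcases hd (-(n + 1)) with h | h <;> rw [h]
    · rw [Int.cast_zero, zero_mul]; exact hp.le
    · rw [Int.cast_one, one_mul]
  have hnn : ∀ n : ℕ, 0 ≤ ((d (-(n + 1)) : ℤ) : ℝ) * 2 ^ (-((n : ℤ) + 1)) := by
    intro n
    have hp : (0 : ℝ) < 2 ^ (-((n : ℤ) + 1)) := by positivity
    rcases hd (-(n + 1)) with h | h <;> rw [h]
    · rw [Int.cast_zero, zero_mul]
    · rw [Int.cast_one, one_mul]; exact hp.le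
  have hs : Summable fun n : ℕ => ((d (-(n + 1)) : ℤ) : ℝ) * 2 ^ (-((n : ℤ) + 1)) :=
    Summable.of_nonneg_of_le hnn hle hg.summable
  have hlt : ∑' n : ℕ, ((d (-(n + 1)) : ℤ) : ℝ) * 2 ^ (-((n : ℤ) + 1)) < 1 := by
    rw [← hg.tsum_eq]
    refine Summable.tsum_lt_tsum (i := n0) hle ?_ hs hg.summable
    rw [hn0]; simp; positivity
  have hnn' : 0 ≤ ∑' n : ℕ, ((d (-(n + 1)) : ℤ) : ℝ) * 2 ^ (-((n : ℤ) + 1)) := tsum_nonneg hnn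
  have htot := (HasSum.of_nat_of_neg_add_one (f := fun n : ℤ => ((d n : ℤ) : ℝ) * 2 ^ n) h1 hs.hasSum).tsum_eq
  rw [htot]
  have e1 : (∑ n ∈ Finset.range (R + 1), ((d n : ℤ) : ℝ) * 2 ^ (n : ℤ)) =
      ((d 0 + 2 * ∑ n ∈ Finset.range R, d (n + 1) * 2 ^ n : ℤ) : ℝ) := by
    rw [Finset.sum_range_succ']
    push_cast
    rw [Finset.mul_sum, add_comm]
    congr 1
    · simp
    · refine Finset.sum_congr rfl fun n _ => ?_
      rw [zpow_add₀ (by norm_num)]; simp; ring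
  rw [e1, Int.floor_intCast_add, Int.floor_eq_zero_iff.2 ⟨hnn', hlt⟩]
  have := hd 0
  omega

/-- exceptional points -/
def Exc (ξ : ℝ) : Set ℝ := {x | 0 ≤ x ∧ ∀ n < -1, wMulDigit n ξ x = 1}

lemma lt_two_pow_exists (x : ℝ) : ∃ L : ℕ, x < 2 ^ L := pow_unbounded_of_one_lt x (by norm_num)

lemma digit_wMul {ξ x : ℝ} (hξ : 0 ≤ ξ) (hx : 0 ≤ x) (h : x ∉ Exc ξ) :
    digit (-1) (wMul ξ x) = wMulDigit (-1) ξ x := by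
  have h' : ∃ n < -1, wMulDigit n ξ x = 0 := by
    by_contra hc
    push Not at hc
    exact h ⟨hx, fun n hn => (wMulDigit_cases n ξ x).resolve_left (hc n hn)⟩
  obtain ⟨n, hn, hn0⟩ := h'
  obtain ⟨L1, hL1⟩ := lt_two_pow_exists ξ
  obtain ⟨L2, hL2⟩ := lt_two_pow_exists x
  have hL1' : ξ < 2 ^ (max L1 L2) := hL1.trans_le (pow_le_pow_right₀ (by norm_num) (le_max_left _ _))
  have hL2' : x < 2 ^ (max L1 L2) := hL2.trans_le (pow_le_pow_right₀ (by norm_num) (le_max_right _ _))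
  set L := max L1 L2
  have key := floor_digits (fun n => wMulDigit (n - 1) ξ x) (fun n => wMulDigit_cases _ _ _) (2 * L + 1)
    (fun n hn => wMulDigit_big hξ hL1' hx hL2' (by push_cast at hn; omega)) (-n - 2).toNat
    (by
      have : (((-n - 2).toNat : ℕ) : ℤ) = -n - 2 := Int.toNat_of_nonneg (by omega)
      simp only [this]
      rw [← hn0]; congr 1; ring)
  simp only [zero_sub] at key
  rw [← key]
  unfold digit wMul
  congr 2
  rw [← (Equiv.subRight (1 : ℤ)).tsum_eq, ← tsum_div_const]
  refine tsum_congr fun m => ?_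
  simp only [Equiv.subRight_apply]
  rw [zpow_sub₀ (by norm_num), zpow_neg]; field_simp

lemma neg_one_zpow_mod (z : ℤ) : (-1 : ℝ) ^ (z % 2) = (-1) ^ z := by
  conv_rhs => rw [← Int.emod_add_mul_ediv z 2]
  rw [zpow_add₀ (by norm_num), zpow_mul]; simp

lemma zpow_sum {κ : Type*} (s : Finset κ) (f : κ → ℤ) : (-1 : ℝ) ^ (∑ i ∈ s, f i) = ∏ i ∈ s, (-1 : ℝ) ^ f i := by
  induction s using Finset.induction_on with
  | empty => simp
  | insert a s ha ih => rw [Finset.sum_insert ha, Finset.prod_insert ha, zpow_add₀ (by norm_num), ih]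

theorem walshe_eq {L : ℕ} {ξ x : ℝ} (hξ : 0 ≤ ξ) (hx : 0 ≤ x) (hξL : ξ < 2 ^ L) (hxL : x < 2 ^ L)
    (h : x ∉ Exc ξ) : walshe (wMul ξ x) = W (vecF L ξ) (vecX L x) := by
  unfold walshe
  rw [digit_wMul hξ hx h]
  let e : Fin (2 * L) ↪ ℤ := ⟨fun i => (L : ℤ) - 1 - i, fun i j hij => by
    simp only at hij; exact Fin.ext (by omega)⟩
  have he : ∀ i, e i = (L : ℤ) - 1 - i := fun i => rfl
  rw [wMulDigit_eq (-1) ξ x (Finset.univ.map e), neg_one_zpow_mod, Finset.sum_map, zpow_sum]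
  · unfold W
    refine Finset.prod_congr rfl fun i _ => ?_
    have e1 : (-1 : ℤ) - e i = (i : ℤ) - L := by rw [he]; ring
    have e2 : e i = ((i.rev : Fin (2 * L)) : ℤ) - L := by
      have := i.2
      rw [he, Fin.val_rev]; omega
    rw [e1, e2, digit_vecF hξ, digit_vecF hx]
    unfold vecX
    by_cases h1 : vecF L ξ i = true <;> by_cases h2 : vecF L x i.rev = true <;> simp [h1, h2]
  · intro m hm
    by_cases h1 : (L : ℤ) ≤ m
    · rw [digit_big hx hxL h1, mul_zero]
    · by_cases h2 : (L : ℤ) ≤ -1 - m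
      · rw [digit_big hξ hξL h2, zero_mul]
      · exfalso; apply hm
        simp only [Finset.mem_map, Finset.mem_univ, true_and]
        refine ⟨⟨((L : ℤ) - 1 - m).toNat, by omega⟩, ?_⟩
        rw [he]
        simp only
        omega

lemma exc_countable {ξ : ℝ} (hξ : 0 ≤ ξ) : (Exc ξ).Countable := by
  rcases hξ.eq_or_lt with rfl | hpos
  · have : Exc 0 = ∅ := by
      ext x
      simp only [Exc, mem_ofPred_eq, mem_empty_iff_false, iff_false, not_and]
      intro _ h
      have h1 := h (-2) (by norm_num)
      rw [wMulDigit_eq (-2) 0 x ∅ (fun m _ => by simp [digit])] at h1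
      simp at h1
    rw [this]; exact countable_empty
  set p := Int.log 2 ξ with hp
  have hp1 : (2 : ℝ) ^ p ≤ ξ := by exact_mod_cast Int.zpow_log_le_self (b := 2) (by norm_num) hpos
  have hp2 : ξ < (2 : ℝ) ^ (p + 1) := by exact_mod_cast Int.lt_zpow_succ_log_self (b := 2) (by norm_num) ξ
  have hdp : digit p ξ = 1 := by
    unfold digit
    have : ⌊ξ / 2 ^ p⌋ = 1 := by
      rw [Int.floor_eq_iff]
      constructor
      · rw [le_div_iff₀ (by positivity)]; simpa using hp1
      · rw [div_lt_iff₀ (by positivity)]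
        rw [zpow_add₀ (by norm_num)] at hp2; push_cast; linarith
    rw [this]; rfl
  have hdq : ∀ m, p < m → digit m ξ = 0 := by
    intro m hm
    unfold digit
    have : ⌊ξ / 2 ^ m⌋ = 0 := by
      rw [Int.floor_eq_zero_iff]
      refine ⟨by positivity, ?_⟩
      rw [div_lt_one (by positivity)]
      exact hp2.trans_le (zpow_le_zpow_right₀ (by norm_num) (by omega))
    rw [this]; rfl
  have hinj : Set.InjOn (fun x : ℝ => ⌊x / 2 ^ (-1 - p)⌋) (Exc ξ) := by
    intro x hx y hy hxy
    simp only at hxy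
    have hall : ∀ t : ℕ, ⌊x / 2 ^ (-1 - p - t)⌋ = ⌊y / 2 ^ (-1 - p - t)⌋ := by
      intro t
      induction t with
      | zero => simpa using hxy
      | succ t ih =>
        set m : ℤ := -1 - p - (t + 1 : ℕ) with hm
        have hm1 : -1 - p - (t : ℤ) = m + (1 : ℕ) := by rw [hm]; push_cast; ring
        rw [hm1] at ih
        have hdig : ∀ j, m < j → digit j x = digit j y := by
          intro j hj
          unfold digit
          obtain ⟨s, hs⟩ := Int.le.dest (show m + (1 : ℕ) ≤ j by push_cast; omega)
          rw [← hs, floor_shift x (m + (1 : ℕ)), floor_shift y (m + (1 : ℕ)), ih]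
        obtain ⟨L1, hL1⟩ := lt_two_pow_exists x
        obtain ⟨L2, hL2⟩ := lt_two_pow_exists y
        have hexp : ∀ z, 0 ≤ z → z < 2 ^ (max L1 L2) → wMulDigit (p + m) ξ z =
            (digit m z + ∑ j ∈ Finset.Ioc m (max m (max L1 L2 : ℕ)), digit (p + m - j) ξ * digit j z) % 2 := by
          intro z hz hzL
          rw [wMulDigit_eq (p + m) ξ z (insert m (Finset.Ioc m (max m (max L1 L2 : ℕ)))),
            Finset.sum_insert (by simp)]
          · rw [add_sub_cancel_right, hdp, one_mul]
          · intro j hj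
            simp only [Finset.mem_insert, Finset.mem_Ioc, not_or, not_and, not_le] at hj
            by_cases h1 : m < j
            · have := hj.2 h1
              rw [digit_big hz hzL (m := j) (by omega), mul_zero]
            · rw [hdq _ (by omega), zero_mul]
        have hx' := hexp x hx.1 (hL1.trans_le (pow_le_pow_right₀ (by norm_num) (le_max_left _ _)))
        have hy' := hexp y hy.1 (hL2.trans_le (pow_le_pow_right₀ (by norm_num) (le_max_right _ _)))
        rw [hx.2 _ (by rw [hm]; push_cast; omega)] at hx'
        rw [hy.2 _ (by rw [hm]; push_cast; omega)] at hy'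
        have hsum : ∑ j ∈ Finset.Ioc m (max m (max L1 L2 : ℕ)), digit (p + m - j) ξ * digit j x =
            ∑ j ∈ Finset.Ioc m (max m (max L1 L2 : ℕ)), digit (p + m - j) ξ * digit j y := by
          refine Finset.sum_congr rfl fun j hj => ?_
          rw [hdig j (Finset.mem_Ioc.1 hj).1]
        rw [hsum] at hx'
        have hdx := digit_zero_or_one m x
        have hdy := digit_zero_or_one m y
        have hdd : digit m x = digit m y := by omega
        rw [floor_shift, floor_shift] at ih
        unfold digit at hdd
        simp only [pow_one] at ih
        omega
    by_contra hne
    have hpos' : 0 < |x - y| := abs_pos.2 (sub_ne_zero.2 hne)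
    have hb : ∀ t : ℕ, |x - y| * 2 ^ t ≤ 2 ^ (-1 - p) := by
      intro t
      have h1 := Int.abs_sub_lt_one_of_floor_eq_floor (hall t)
      rw [← sub_div, abs_div, abs_of_pos (by positivity : (0 : ℝ) < 2 ^ (-1 - p - (t : ℤ))),
        div_lt_one (by positivity), zpow_sub₀ (by norm_num), zpow_natCast, lt_div_iff₀ (by positivity)] at h1
      exact h1.le
    obtain ⟨t, ht⟩ := pow_unbounded_of_one_lt (2 ^ (-1 - p) / |x - y|) (by norm_num : (1 : ℝ) < 2)
    rw [div_lt_iff₀ hpos'] at ht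
    linarith [hb t, mul_comm |x - y| (2 ^ t)]
  exact Set.MapsTo.countable_of_injOn (Set.mapsTo_univ _ _) hinj (Set.to_countable _)
end HE

namespace HE

lemma floor_lt_pow {L : ℕ} {x : ℝ} (h0 : 0 ≤ x) (hx : x < 2 ^ L) : ⌊x * 2 ^ L⌋₊ < 2 ^ (2 * L) := by
  rw [Nat.floor_lt (by positivity)]
  push_cast
  rw [two_mul, pow_add]
  exact mul_lt_mul_of_pos_right hx (by positivity)

lemma idx_vecF {L : ℕ} {x : ℝ} (h0 : 0 ≤ x) (hx : x < 2 ^ L) : idx (vecF L x) = ⌊x * 2 ^ L⌋₊ := by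
  unfold idx vecF
  rw [Nat.ofBits_testBit, Nat.mod_eq_of_lt (floor_lt_pow h0 hx)]

/-- left end point of a frequency cell -/
def pt (L : ℕ) (v : Fin (2 * L) → Bool) : ℝ := (idx v : ℝ) / 2 ^ L

lemma pt_nonneg (L : ℕ) (v : Fin (2 * L) → Bool) : 0 ≤ pt L v := by unfold pt; positivity

lemma pt_lt (L : ℕ) (v : Fin (2 * L) → Bool) : pt L v < 2 ^ L := by
  unfold pt
  rw [div_lt_iff₀ (by positivity), ← pow_add, ← two_mul]
  exact_mod_cast idx_lt v

lemma vecF_eq_iff {L : ℕ} {x : ℝ} (h0 : 0 ≤ x) (hx : x < 2 ^ L) (v : Fin (2 * L) → Bool) :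
    vecF L x = v ↔ x ∈ Ico (pt L v) (pt L v + (2 ^ L)⁻¹) := by
  have e : vecF L x = v ↔ ⌊x * 2 ^ L⌋₊ = idx v := by
    rw [← idx_vecF h0 hx]
    exact ⟨fun h => by rw [h], idx_inj⟩
  rw [e, Nat.floor_eq_iff (by positivity)]
  unfold pt
  rw [mem_Ico, div_le_iff₀ (by positivity), ← one_div, ← add_div, lt_div_iff₀ (by positivity)]

lemma vecF_pt (L : ℕ) (v : Fin (2 * L) → Bool) : vecF L (pt L v) = v := by
  rw [vecF_eq_iff (pt_nonneg L v) (pt_lt L v)]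
  refine ⟨le_rfl, ?_⟩
  have : (0 : ℝ) < (2 ^ L)⁻¹ := by positivity
  linarith

lemma pt_add_le (L : ℕ) (v : Fin (2 * L) → Bool) : pt L v + (2 ^ L)⁻¹ ≤ 2 ^ L := by
  unfold pt
  rw [← one_div, ← add_div, div_le_iff₀ (by positivity), ← pow_add, ← two_mul]
  exact_mod_cast idx_lt v

lemma measurable_vecF (L : ℕ) : Measurable (vecF L) := by
  rw [measurable_pi_iff]
  intro i
  unfold vecF
  exact (measurable_from_top (f := fun k : ℕ => k.testBit i)).comp
    (Nat.measurable_floor.comp (measurable_id.mul_const _))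

lemma measurable_vecX (L : ℕ) : Measurable (vecX L) := by
  rw [measurable_pi_iff]
  intro i
  exact (measurable_pi_iff.1 (measurable_vecF L)) i.rev

/-- the truncated measure -/
def nu (L : ℕ) : Measure ℝ := volume.restrict (Ico 0 (2 ^ L))

instance (L : ℕ) : IsFiniteMeasure (nu L) := by unfold nu; infer_instance

lemma nu_vecF (L : ℕ) (v : Fin (2 * L) → Bool) : nu L (vecF L ⁻¹' {v}) = ENNReal.ofReal ((2 ^ L)⁻¹) := by
  unfold nu
  rw [Measure.restrict_apply (measurable_vecF L (measurableSet_singleton v))]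
  have : vecF L ⁻¹' {v} ∩ Ico 0 (2 ^ L) = Ico (pt L v) (pt L v + (2 ^ L)⁻¹) := by
    ext x
    constructor
    · rintro ⟨h1, h2, h3⟩
      exact (vecF_eq_iff h2 h3 v).1 h1
    · intro h
      have h2 : 0 ≤ x := (pt_nonneg L v).trans h.1
      have h3 : x < 2 ^ L := h.2.trans_le (pt_add_le L v)
      exact ⟨(vecF_eq_iff h2 h3 v).2 h, h2, h3⟩
  rw [this, Real.volume_Ico]; congr 1; ring

lemma nu_vecX (L : ℕ) (v : Fin (2 * L) → Bool) : nu L (vecX L ⁻¹' {v}) = ENNReal.ofReal ((2 ^ L)⁻¹) := by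
  rw [← nu_vecF L (fun i => v i.rev)]
  congr 1
  ext x
  simp only [mem_preimage, mem_singleton_iff]
  constructor
  · intro h; rw [← h]; funext i; simp [vecX]
  · intro h; funext i; unfold vecX; rw [h]; simp

lemma lintegral_vecX (L : ℕ) (h : (Fin (2 * L) → Bool) → ℝ≥0∞) :
    ∫⁻ x, h (vecX L x) ∂(nu L) = ENNReal.ofReal ((2 ^ L)⁻¹) * ∑ v, h v := by
  rw [← lintegral_map (measurable_of_finite h) (measurable_vecX L), lintegral_fintype, Finset.mul_sum]
  refine Finset.sum_congr rfl fun v _ => ?_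
  rw [Measure.map_apply (measurable_vecX L) (measurableSet_singleton v), nu_vecX, mul_comm]

lemma integral_vecF (L : ℕ) (h : (Fin (2 * L) → Bool) → ℝ) :
    ∫ x, h (vecF L x) ∂(nu L) = (2 ^ L)⁻¹ * ∑ v, h v := by
  have hm : AEStronglyMeasurable h ((nu L).map (vecF L)) := (measurable_of_finite h).aestronglyMeasurable
  rw [← integral_map (measurable_vecF L).aemeasurable hm, integral_fintype, Finset.mul_sum]
  · refine Finset.sum_congr rfl fun v _ => ?_
    rw [measureReal_def, Measure.map_apply (measurable_vecF L) (measurableSet_singleton v), nu_vecF,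
      ENNReal.toReal_ofReal (by positivity), smul_eq_mul]
  · exact Integrable.of_finite

/-- space cells -/
def cellX (L : ℕ) (v : Fin (2 * L) → Bool) : Set ℝ := vecX L ⁻¹' {v}

lemma measurableSet_cellX (L : ℕ) (v : Fin (2 * L) → Bool) : MeasurableSet (cellX L v) :=
  measurable_vecX L (measurableSet_singleton v)

lemma integral_cells (L : ℕ) (h : (Fin (2 * L) → Bool) → ℝ) (g : ℝ → ℝ) (hg : Integrable g (nu L)) :
    ∫ y, h (vecX L y) * g y ∂(nu L) = ∑ v, h v * ∫ y in cellX L v, g y ∂(nu L) := by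
  have e : ∀ y, h (vecX L y) * g y = ∑ v, (cellX L v).indicator (fun y => h v * g y) y := by
    intro y
    rw [Finset.sum_eq_single_of_mem (vecX L y) (Finset.mem_univ _)]
    · rw [indicator_of_mem]; simp [cellX]
    · intro v _ hv
      rw [indicator_of_notMem]
      simp only [cellX, mem_preimage, mem_singleton_iff]
      exact fun hc => hv hc.symm
  simp_rw [e]
  rw [integral_finsetSum]
  · refine Finset.sum_congr rfl fun v _ => ?_
    rw [integral_indicator (measurableSet_cellX L v), integral_const_mul]
  · intro v _
    exact (hg.const_mul (h v)).indicator (measurableSet_cellX L v)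

/-- discretization of a function -/
def fL (L : ℕ) (g : ℝ → ℝ) (v : Fin (2 * L) → Bool) : ℝ := 2 ^ L * ∫ y in cellX L v, g y ∂(nu L)

lemma hat_fL (L : ℕ) (g : ℝ → ℝ) (hg : Integrable g (nu L)) (w : Fin (2 * L) → Bool) :
    hat (fL L g) w = 2 ^ L * ∫ y, W w (vecX L y) * g y ∂(nu L) := by
  rw [integral_cells L (W w) g hg, Finset.mul_sum]
  unfold hat fL
  exact Finset.sum_congr rfl fun v _ => by ring

lemma nu_le (L : ℕ) : nu L ≤ μplus := by
  unfold nu μplus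
  exact Measure.restrict_mono_set _ (fun x hx => hx.1)

lemma nu_mem (L : ℕ) : ∀ᵐ y ∂(nu L), y ∈ Ico (0 : ℝ) (2 ^ L) := ae_restrict_mem measurableSet_Ico

lemma exc_ae {ξ : ℝ} (hξ : 0 ≤ ξ) (μ : Measure ℝ) [NullSingletonClass μ] : ∀ᵐ y ∂μ, y ∉ Exc ξ := by
  have := (exc_countable hξ).measure_zero μ
  exact measure_eq_zero_iff_ae_notMem.1 this

instance (L : ℕ) : NullSingletonClass (nu L) := by unfold nu; infer_instance
instance : NullSingletonClass μplus := by unfold μplus; infer_instance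

lemma walshe_ae {L : ℕ} {ξ : ℝ} (hξ : 0 ≤ ξ) (hξL : ξ < 2 ^ L) :
    ∀ᵐ y ∂(nu L), walshe (wMul ξ y) = W (vecF L ξ) (vecX L y) := by
  filter_upwards [nu_mem L, exc_ae hξ (nu L)] with y h1 h2
  exact walshe_eq hξ h1.1 hξL h1.2 h2

lemma W_swap (L : ℕ) (ξ x : ℝ) : W (vecF L ξ) (vecX L x) = W (vecF L x) (vecX L ξ) := by
  unfold W
  rw [← Equiv.prod_comp (Fin.revPerm)]
  refine Finset.prod_congr rfl fun i _ => ?_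
  simp only [Fin.revPerm_apply, vecX, Fin.rev_rev]
  simp only [and_comm]
  congr

lemma walshe_abs (x : ℝ) : |walshe x| = 1 := by
  unfold walshe
  rcases digit_zero_or_one (-1) x with h | h <;> rw [h] <;> simp

lemma ev_lt (x : ℝ) : ∀ᶠ L : ℕ in atTop, x < 2 ^ L := by
  obtain ⟨L0, h⟩ := lt_two_pow_exists x
  filter_upwards [eventually_ge_atTop L0] with L hL
  exact h.trans_le (pow_le_pow_right₀ (by norm_num) hL)

lemma walshe_meas {ξ : ℝ} (hξ : 0 ≤ ξ) : AEStronglyMeasurable (fun y => walshe (wMul ξ y)) μplus := by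
  refine aestronglyMeasurable_of_tendsto_ae atTop (f := fun (L : ℕ) y => W (vecF L ξ) (vecX L y)) ?_ ?_
  · intro L
    exact ((measurable_of_finite (W (vecF L ξ))).comp (measurable_vecX L)).aestronglyMeasurable
  · have h1 : ∀ᵐ y ∂μplus, y ∈ Ici (0 : ℝ) := ae_restrict_mem measurableSet_Ici
    filter_upwards [h1, exc_ae hξ μplus] with y h1 h2
    apply tendsto_const_nhds.congr'
    filter_upwards [ev_lt ξ, ev_lt y] with L h3 h4
    exact walshe_eq hξ h1 h3 h4 h2

lemma walshe_integrable {ξ : ℝ} (hξ : 0 ≤ ξ) (g : ℝ → ℝ) (hg : Integrable g μplus) :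
    Integrable (fun y => walshe (wMul ξ y) * g y) μplus :=
  hg.bdd_mul (c := 1) (walshe_meas hξ) (Eventually.of_forall fun y => by rw [Real.norm_eq_abs, walshe_abs])

lemma walshFT_nonint {ξ : ℝ} (hξ : 0 ≤ ξ) (g : ℝ → ℝ) (hg : ¬ Integrable g μplus) : walshFT g ξ = 0 := by
  unfold walshFT
  apply integral_undef
  intro h
  apply hg
  have := walshe_integrable hξ _ h
  refine this.congr (Eventually.of_forall fun y => ?_)
  simp only
  rw [← mul_assoc, ← abs_mul_abs_self, walshe_abs]; ring

/-- truncated transform -/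
def gL (L : ℕ) (g : ℝ → ℝ) (ξ : ℝ) : ℝ := (2 ^ L)⁻¹ * hat (fL L g) (vecF L ξ)

lemma gL_eq {L : ℕ} {g : ℝ → ℝ} (hg : Integrable g μplus) {ξ : ℝ} (hξ : 0 ≤ ξ) (hξL : ξ < 2 ^ L) :
    gL L g ξ = ∫ y in Ico 0 (2 ^ L), walshe (wMul ξ y) * g y := by
  unfold gL
  rw [hat_fL L g (hg.mono_measure (nu_le L)), ← mul_assoc, inv_mul_cancel₀ (by positivity), one_mul]
  apply integral_congr_ae
  filter_upwards [walshe_ae hξ hξL] with y hy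
  rw [hy]

lemma gL_abs {L : ℕ} {g : ℝ → ℝ} (hg : Integrable g μplus) {ξ : ℝ} (hξ : 0 ≤ ξ) (hξL : ξ < 2 ^ L) :
    |gL L g ξ| ≤ ∫ y, |g y| ∂μplus := by
  rw [gL_eq hg hξ hξL]
  refine (abs_integral_le_integral_abs).trans ?_
  simp_rw [abs_mul, walshe_abs, one_mul]
  exact integral_mono_measure (nu_le L) (Eventually.of_forall fun y => abs_nonneg _) hg.abs

lemma gL_tendsto {g : ℝ → ℝ} (hg : Integrable g μplus) {ξ : ℝ} (hξ : 0 ≤ ξ) :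
    Tendsto (fun L => gL L g ξ) atTop (nhds (walshFT g ξ)) := by
  have hU : ⋃ L : ℕ, Ico (0 : ℝ) (2 ^ L) = Ici 0 := by
    ext x
    simp only [mem_iUnion, mem_Ico, mem_Ici]
    refine ⟨fun ⟨L, h⟩ => h.1, fun h => ?_⟩
    obtain ⟨L, hL⟩ := lt_two_pow_exists x
    exact ⟨L, h, hL⟩
  have h1 := tendsto_setIntegral_of_monotone (μ := volume) (s := fun L : ℕ => Ico (0 : ℝ) (2 ^ L))
    (f := fun y => walshe (wMul ξ y) * g y) (fun L => measurableSet_Ico)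
    (fun a b hab => Ico_subset_Ico_right (pow_le_pow_right₀ (by norm_num) hab))
    (by rw [hU]; exact walshe_integrable hξ g hg)
  rw [hU] at h1
  refine h1.congr' ?_
  filter_upwards [ev_lt ξ] with L hL
  rw [gL_eq hg hξ hL]

lemma T_eq {L : ℕ} (g : ℝ → ℝ) (m : (Fin (2 * L) → Bool) → ℝ) {x : ℝ} (hx : 0 ≤ x) (hxL : x < 2 ^ L) :
    T m (fL L g) (vecX L x) = ∫ ξ in Ico 0 (2 ^ L), walshe (wMul x ξ) * (m (vecF L ξ) * gL L g ξ) := by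
  have h1 : ∫ ξ in Ico 0 (2 ^ L), walshe (wMul x ξ) * (m (vecF L ξ) * gL L g ξ) =
      ∫ ξ, (fun v => W v (vecX L x) * (m v * ((2 ^ L)⁻¹ * hat (fL L g) v))) (vecF L ξ) ∂(nu L) := by
    apply integral_congr_ae
    filter_upwards [walshe_ae hx hxL] with y hy
    rw [hy, W_swap]; rfl
  rw [h1, integral_vecF L (fun v => W v (vecX L x) * (m v * ((2 ^ L)⁻¹ * hat (fL L g) v)))]
  unfold T
  rw [Finset.mul_sum, Finset.mul_sum]
  refine Finset.sum_congr rfl fun v _ => ?_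
  have e2 : ((2 : ℝ) ^ (2 * L))⁻¹ = (2 ^ L)⁻¹ * (2 ^ L)⁻¹ := by rw [two_mul, pow_add, mul_inv]
  rw [e2]; ring
end HE

namespace HE

/-- dyadic intervals -/
def dint (k j : ℤ) : Set ℝ := Ico ((j : ℝ) * 2 ^ k) (((j : ℝ) + 1) * 2 ^ k)

lemma mem_dint {k j : ℤ} {ξ : ℝ} : ξ ∈ dint k j ↔ ⌊ξ / 2 ^ k⌋ = j := by
  unfold dint
  rw [Int.floor_eq_iff, mem_Ico, le_div_iff₀ (by positivity), div_lt_iff₀ (by positivity)]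

lemma dyadicSum_eq (a : Set ℝ → ℝ) (ξ : ℝ) (k : ℤ) : dyadicSum a ξ k = a (dint k ⌊ξ / 2 ^ k⌋) := by
  unfold dyadicSum
  rw [finsum_eq_single _ (dint k ⌊ξ / 2 ^ k⌋)]
  · rw [finsum_eq_if, if_pos ⟨_, rfl⟩, indicator_of_mem (mem_dint.2 rfl), mul_one]
  · intro ω hω
    rw [finsum_eq_if]
    split_ifs with h
    · obtain ⟨j, rfl⟩ := h
      rw [indicator_of_notMem, mul_zero]
      intro hc
      apply hω
      have : ⌊ξ / 2 ^ k⌋ = j := mem_dint.1 hc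
      rw [this]; rfl
    · rfl

lemma Dk_eq (a : Set ℝ → ℝ) (Ξ : Set ℝ) (ξ : ℝ) (k : ℤ) : Dk a Ξ k ξ =
    if ∃ η ∈ Ξ, ⌊η / 2 ^ k⌋ = ⌊ξ / 2 ^ k⌋ then a (dint k ⌊ξ / 2 ^ k⌋) else 0 := by
  unfold Dk
  rw [finsum_eq_single _ (dint k ⌊ξ / 2 ^ k⌋)]
  · rw [finsum_eq_if, indicator_of_mem (mem_dint.2 rfl), mul_one]
    congr 1
    apply propext
    constructor
    · rintro ⟨_, η, h1, h2⟩
      exact ⟨η, h2, mem_dint.1 h1⟩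
    · rintro ⟨η, h1, h2⟩
      exact ⟨⟨_, rfl⟩, η, mem_dint.2 h2, h1⟩
  · intro ω hω
    rw [finsum_eq_if]
    split_ifs with h
    · obtain ⟨⟨j, rfl⟩, _⟩ := h
      rw [indicator_of_notMem, mul_zero]
      intro hc
      apply hω
      have : ⌊ξ / 2 ^ k⌋ = j := mem_dint.1 hc
      rw [this]; rfl
    · rfl

lemma Dk_integrable (a : Set ℝ → ℝ) {Ξ : Set ℝ} (hΞ : Ξ.Finite) (k : ℤ) : Integrable (Dk a Ξ k) μplus := by
  have e : Dk a Ξ k = fun ξ => ∑ j ∈ (hΞ.toFinset.image fun η => ⌊η / 2 ^ k⌋),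
      (dint k j).indicator (fun _ => a (dint k j)) ξ := by
    funext ξ
    rw [Dk_eq]
    split_ifs with h
    · obtain ⟨η, h1, h2⟩ := h
      rw [Finset.sum_eq_single_of_mem ⌊ξ / 2 ^ k⌋]
      · rw [indicator_of_mem (mem_dint.2 rfl)]
      · rw [← h2]; exact Finset.mem_image_of_mem _ (by simpa using h1)
      · intro j _ hj
        rw [indicator_of_notMem]
        rw [mem_dint]; exact fun hc => hj hc.symm
    · rw [Finset.sum_eq_zero]
      intro j hj
      rw [indicator_of_notMem]
      rw [mem_dint]
      rintro rfl
      simp only [Finset.mem_image, Finite.mem_toFinset] at hj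
      exact h hj
  rw [e]
  apply integrable_finsetSum
  intro j _
  rw [integrable_indicator_iff (by unfold dint; exact measurableSet_Ico)]
  apply integrableOn_const
  · unfold dint μplus
    refine ne_top_of_le_ne_top ?_ (Measure.restrict_apply_le _ _)
    rw [Real.volume_Ico]; exact ENNReal.ofReal_ne_top
  · simp

lemma floor_pt (L κ : ℕ) (v : Fin (2 * L) → Bool) :
    ⌊pt L v / 2 ^ ((κ : ℤ) - L)⌋ = ((idx v / 2 ^ κ : ℕ) : ℤ) := by
  have := floor_shift (pt L v) (-(L : ℤ)) κ
  rw [neg_add_eq_sub] at this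
  rw [this, zpow_neg, zpow_natCast, div_inv_eq_mul]
  unfold pt
  rw [div_mul_cancel₀ _ (by positivity)]
  simp

lemma floor_vecF {L : ℕ} (κ : ℕ) {ξ : ℝ} (h0 : 0 ≤ ξ) (h : ξ < 2 ^ L) :
    ⌊pt L (vecF L ξ) / 2 ^ ((κ : ℤ) - L)⌋ = ⌊ξ / 2 ^ ((κ : ℤ) - L)⌋ := by
  rw [floor_pt, idx_vecF h0 h]
  have := floor_shift ξ (-(L : ℤ)) κ
  rw [neg_add_eq_sub] at this
  rw [this, zpow_neg, zpow_natCast, div_inv_eq_mul, ← Int.natCast_floor_eq_floor (by positivity)]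
  simp

lemma agF_floor {L κ : ℕ} {v w : Fin (2 * L) → Bool} :
    agF κ v w ↔ ⌊pt L v / 2 ^ ((κ : ℤ) - L)⌋ = ⌊pt L w / 2 ^ ((κ : ℤ) - L)⌋ := by
  rw [agF_iff, floor_pt, floor_pt]; exact_mod_cast Iff.rfl

/-- finite version of the coefficients -/
def aL (a : Set ℝ → ℝ) (L : ℕ) (κ : ℕ) (v : Fin (2 * L) → Bool) : ℝ := dyadicSum a (pt L v) ((κ : ℤ) - L)

lemma aL_inv (a : Set ℝ → ℝ) {L κ : ℕ} {v w : Fin (2 * L) → Bool} (h : agF κ v w) :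
    aL a L κ v = aL a L κ w := by
  unfold aL
  rw [dyadicSum_eq, dyadicSum_eq, agF_floor.1 h]

lemma aL_chi (a : Set ℝ → ℝ) (Ξ : Finset ℝ) {L : ℕ} (hΞ0 : ∀ η ∈ Ξ, 0 ≤ η) (hΞ : ∀ η ∈ Ξ, η < 2 ^ L) (κ : ℕ)
    {ξ : ℝ} (h0 : 0 ≤ ξ) (h : ξ < 2 ^ L) :
    aL a L κ (vecF L ξ) * chi (Ξ.image (vecF L)) κ (vecF L ξ) = Dk a Ξ ((κ : ℤ) - L) ξ := by
  unfold aL chi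
  rw [dyadicSum_eq, Dk_eq, floor_vecF κ h0 h, mul_ite, mul_one, mul_zero]
  congr 1
  apply propext
  constructor
  · rintro ⟨w, hw, hag⟩
    obtain ⟨η, hη, rfl⟩ := Finset.mem_image.1 hw
    rw [agF_floor, floor_vecF κ h0 h, floor_vecF κ (hΞ0 η hη) (hΞ η hη)] at hag
    exact ⟨η, hη, hag⟩
  · rintro ⟨η, hη, hag⟩
    refine ⟨vecF L η, Finset.mem_image_of_mem _ hη, ?_⟩
    rw [agF_floor, floor_vecF κ h0 h, floor_vecF κ (hΞ0 η hη) (hΞ η hη)]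
    exact hag

lemma pt_vecF_le {L : ℕ} {ξ : ℝ} (h0 : 0 ≤ ξ) (h : ξ < 2 ^ L) :
    pt L (vecF L ξ) ≤ ξ ∧ ξ < pt L (vecF L ξ) + (2 ^ L)⁻¹ := (vecF_eq_iff h0 h _).1 rfl

lemma pt_tendsto {ξ : ℝ} (h0 : 0 ≤ ξ) : Tendsto (fun L => pt L (vecF L ξ)) atTop (nhds ξ) := by
  have h1 : Tendsto (fun L : ℕ => ξ - (2 ^ L)⁻¹) atTop (nhds ξ) := by
    have : Tendsto (fun L : ℕ => ((2 : ℝ) ^ L)⁻¹) atTop (nhds 0) := by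
      simp_rw [← inv_pow]
      exact tendsto_pow_atTop_nhds_zero_of_lt_one (by norm_num) (by norm_num)
    simpa using tendsto_const_nhds.sub this
  refine tendsto_of_tendsto_of_tendsto_of_le_of_le' h1 tendsto_const_nhds ?_ ?_
  · filter_upwards [ev_lt ξ] with L hL
    linarith [(pt_vecF_le h0 hL).2]
  · filter_upwards [ev_lt ξ] with L hL
    exact (pt_vecF_le h0 hL).1

lemma M_tendsto (M Φ : ℝ → ℝ) {r : ℝ} (hr : 0 < r)
    (hM : ∀ x y, 0 ≤ x → x ≤ y → |M x - M y| ^ r ≤ Φ x - Φ y) :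
    ∀ᵐ ξ ∂μplus, Tendsto (fun L => M (pt L (vecF L ξ))) atTop (nhds (M ξ)) := by
  let Ψ : ℝ → ℝ := fun x => Φ (max x 0)
  have hΨ : Antitone Ψ := by
    intro x y hxy
    have := hM (max x 0) (max y 0) (le_max_right _ _) (max_le_max_right _ hxy)
    have h0 : 0 ≤ |M (max x 0) - M (max y 0)| ^ r := by positivity
    simp only [Ψ]; linarith
  have hae : ∀ᵐ ξ ∂μplus, ξ ∉ {x | ¬ContinuousAt Ψ x} :=
    measure_eq_zero_iff_ae_notMem.1 (hΨ.countable_not_continuousAt.measure_zero μplus)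
  have h1 : ∀ᵐ y ∂μplus, y ∈ Ici (0 : ℝ) := ae_restrict_mem measurableSet_Ici
  filter_upwards [hae, h1] with ξ hc h0
  have hc' : ContinuousAt Ψ ξ := by simpa using hc
  have h0' : 0 ≤ ξ := h0
  have h2 : Tendsto (fun L => Ψ (pt L (vecF L ξ))) atTop (nhds (Ψ ξ)) := hc'.tendsto.comp (pt_tendsto h0')
  have h3 : Tendsto (fun L => (Ψ (pt L (vecF L ξ)) - Ψ ξ) ^ (1 / r)) atTop (nhds 0) := by
    have h4 : Tendsto (fun L => Ψ (pt L (vecF L ξ)) - Ψ ξ) atTop (nhds 0) := by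
      simpa using h2.sub_const (Ψ ξ)
    have h5 := h4.rpow_const (p := 1 / r) (Or.inr (by positivity))
    rwa [Real.zero_rpow (by positivity)] at h5
  rw [tendsto_iff_dist_tendsto_zero]
  refine squeeze_zero' (Eventually.of_forall fun L => dist_nonneg) ?_ h3
  filter_upwards [ev_lt ξ] with L hL
  have h6 := hM _ _ (pt_nonneg L (vecF L ξ)) (pt_vecF_le h0' hL).1
  have e : Ψ (pt L (vecF L ξ)) - Ψ ξ = Φ (pt L (vecF L ξ)) - Φ ξ := by
    simp only [Ψ]; rw [max_eq_left (pt_nonneg _ _), max_eq_left h0']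
  rw [e, Real.dist_eq]
  calc |M (pt L (vecF L ξ)) - M ξ| = (|M (pt L (vecF L ξ)) - M ξ| ^ r) ^ (1 / r) := by
        rw [← Real.rpow_mul (abs_nonneg _), mul_one_div_cancel hr.ne', Real.rpow_one]
    _ ≤ _ := Real.rpow_le_rpow (by positivity) h6 (by positivity)

theorem T_tendsto (a : Set ℝ → ℝ) (Ξ : Finset ℝ) (hΞ0 : ∀ η ∈ Ξ, 0 ≤ η) (M : ℝ → ℝ) (B : ℝ)
    (hB : ∀ x, 0 ≤ x → |M x| ≤ B)
    (hM : ∀ᵐ ξ ∂μplus, Tendsto (fun L => M (pt L (vecF L ξ))) atTop (nhds (M ξ)))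
    (g : ℝ → ℝ) (hg : Integrable g μplus) (k : ℤ) {x : ℝ} (hx : 0 ≤ x) :
    Tendsto (fun L : ℕ => T (fun v => aL a L (k + L).toNat v * chi (Ξ.image (vecF L)) (k + L).toNat v
      * M (pt L v)) (fL L g) (vecX L x)) atTop
      (nhds (walshFT (fun ξ => Dk a Ξ k ξ * M ξ * walshFT g ξ) x)) := by
  have hB0 : 0 ≤ B := (abs_nonneg _).trans (hB 0 le_rfl)
  let F : ℕ → ℝ → ℝ := fun L => (Ico (0 : ℝ) (2 ^ L)).indicator fun ξ =>
    walshe (wMul x ξ) * (Dk a Ξ k ξ * M (pt L (vecF L ξ)) * gL L g ξ)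
  have hD := Dk_integrable a (Ξ := (Ξ : Set ℝ)) Ξ.finite_toSet k
  have hlim : Tendsto (fun L => ∫ ξ, F L ξ ∂μplus) atTop
      (nhds (∫ ξ, walshe (wMul x ξ) * (Dk a Ξ k ξ * M ξ * walshFT g ξ) ∂μplus)) := by
    apply tendsto_integral_of_dominated_convergence
      (fun ξ => |Dk a Ξ k ξ| * B * ∫ y, |g y| ∂μplus)
    · intro L
      refine AEStronglyMeasurable.indicator ?_ measurableSet_Ico
      refine (walshe_meas hx).mul ((hD.aestronglyMeasurable.mul ?_).mul ?_)
      · exact ((measurable_of_finite (fun v => M (pt L v))).comp (measurable_vecF L)).aestronglyMeasurable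
      · exact ((measurable_of_finite (fun v => (2 ^ L)⁻¹ * hat (fL L g) v)).comp
          (measurable_vecF L)).aestronglyMeasurable
    · exact (hD.abs.mul_const B).mul_const _
    · intro L
      refine Eventually.of_forall fun ξ => ?_
      simp only [F]
      by_cases h : ξ ∈ Ico (0 : ℝ) (2 ^ L)
      · rw [indicator_of_mem h, Real.norm_eq_abs, abs_mul, walshe_abs, one_mul, abs_mul, abs_mul]
        have h1 := hB (pt L (vecF L ξ)) (pt_nonneg _ _)
        have h2 := gL_abs hg h.1 h.2
        gcongr
      · rw [indicator_of_notMem h, norm_zero]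
        have : 0 ≤ ∫ y, |g y| ∂μplus := integral_nonneg fun y => abs_nonneg _
        positivity
    · have h1 : ∀ᵐ y ∂μplus, y ∈ Ici (0 : ℝ) := ae_restrict_mem measurableSet_Ici
      filter_upwards [hM, h1] with ξ h2 h3
      have h4 : Tendsto (fun L => walshe (wMul x ξ) * (Dk a Ξ k ξ * M (pt L (vecF L ξ)) * gL L g ξ)) atTop
          (nhds (walshe (wMul x ξ) * (Dk a Ξ k ξ * M ξ * walshFT g ξ))) :=
        ((h2.const_mul _).mul (gL_tendsto hg h3)).const_mul _
      refine h4.congr' ?_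
      filter_upwards [ev_lt ξ] with L hL
      simp only [F]
      rw [indicator_of_mem (show ξ ∈ Ico (0:ℝ) (2 ^ L) from ⟨h3, hL⟩)]
  refine hlim.congr' ?_
  have hΞL : ∀ᶠ L : ℕ in atTop, ∀ η ∈ Ξ, η < 2 ^ L := by
    rw [Filter.eventually_all_finset]
    exact fun η _ => ev_lt η
  filter_upwards [ev_lt x, hΞL, eventually_ge_atTop (-k).toNat] with L hxL hΞL hk
  rw [T_eq g _ hx hxL]
  simp only [F]
  unfold μplus
  rw [integral_indicator measurableSet_Ico, Measure.restrict_restrict measurableSet_Ico]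
  have e : Ico (0 : ℝ) (2 ^ L) ∩ Ici 0 = Ico 0 (2 ^ L) := by
    ext z; simp only [mem_inter_iff, mem_Ico, mem_Ici]; tauto
  rw [e]
  apply setIntegral_congr_fun measurableSet_Ico
  intro ξ hξ
  have hk' : (((k + L).toNat : ℕ) : ℤ) - L = k := by omega
  have := aL_chi a Ξ hΞ0 hΞL (k + L).toNat hξ.1 hξ.2
  rw [hk'] at this
  simp only
  rw [this]

lemma fL_bound (q : ℝ) (hq : 1 < q) (L : ℕ) (g : ℝ → ℝ) (hg : Integrable g μplus) :
    ∑ v, ENNReal.ofReal (|fL L g v| ^ q) ≤ ENNReal.ofReal (2 ^ L) * ∫⁻ y, ‖g y‖ₑ ^ q ∂μplus := by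
  have hq0 : 0 < q := by linarith
  have hcell : ∀ v, ENNReal.ofReal (|fL L g v| ^ q) ≤
      ENNReal.ofReal (2 ^ L) * ∫⁻ y in cellX L v, ‖g y‖ₑ ^ q ∂(nu L) := by
    intro v
    have hgc : AEStronglyMeasurable g ((nu L).restrict (cellX L v)) :=
      (hg.mono_measure (nu_le L)).aestronglyMeasurable.restrict
    have h1 : ‖∫ y in cellX L v, g y ∂(nu L)‖ₑ ≤ ∫⁻ y in cellX L v, ‖g y‖ₑ ∂(nu L) :=
      enorm_integral_le_lintegral_enorm _
    have h2 : ∫⁻ y in cellX L v, ‖g y‖ₑ ∂(nu L) ≤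
        (∫⁻ y in cellX L v, ‖g y‖ₑ ^ q ∂(nu L)) ^ (1 / q) * ENNReal.ofReal ((2 ^ L)⁻¹) ^ (1 - 1 / q) := by
      have hconj : q.HolderConjugate (q / (q - 1)) := Real.HolderConjugate.conjExponent hq
      have := ENNReal.lintegral_mul_le_Lp_mul_Lq ((nu L).restrict (cellX L v)) hconj
        (f := fun y => ‖g y‖ₑ) (g := fun _ => 1) hgc.enorm aemeasurable_const
      simp only [Pi.mul_apply, mul_one, ENNReal.one_rpow, lintegral_const, one_mul,
        Measure.restrict_apply_univ] at this
      unfold cellX at this ⊢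
      rw [nu_vecX] at this
      refine this.trans (le_of_eq ?_)
      congr 2
      have : q - 1 ≠ 0 := by linarith
      field_simp
    have h3 : ENNReal.ofReal (|fL L g v| ^ q) = (ENNReal.ofReal (2 ^ L) * ‖∫ y in cellX L v, g y ∂(nu L)‖ₑ) ^ q := by
      rw [← ENNReal.ofReal_rpow_of_nonneg (abs_nonneg _) hq0.le]
      congr 1
      unfold fL
      rw [abs_mul, abs_of_pos (by positivity), ENNReal.ofReal_mul (by positivity), Real.enorm_eq_ofReal_abs]
    rw [h3]
    calc (ENNReal.ofReal (2 ^ L) * ‖∫ y in cellX L v, g y ∂(nu L)‖ₑ) ^ q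
        ≤ (ENNReal.ofReal (2 ^ L) * ((∫⁻ y in cellX L v, ‖g y‖ₑ ^ q ∂(nu L)) ^ (1 / q) *
          ENNReal.ofReal ((2 ^ L)⁻¹) ^ (1 - 1 / q))) ^ q := by
          apply ENNReal.rpow_le_rpow _ hq0.le
          exact mul_le_mul_right (h1.trans h2) _
      _ = _ := by
          rw [ENNReal.mul_rpow_of_nonneg _ _ hq0.le, ENNReal.mul_rpow_of_nonneg _ _ hq0.le,
            ← ENNReal.rpow_mul, ← ENNReal.rpow_mul, one_div, inv_mul_cancel₀ hq0.ne', ENNReal.rpow_one,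
            sub_mul, inv_mul_cancel₀ hq0.ne', one_mul, mul_left_comm]
          have e : ENNReal.ofReal (2 ^ L) ^ q * ENNReal.ofReal ((2 ^ L)⁻¹) ^ (q - 1) = ENNReal.ofReal (2 ^ L) := by
            have hp : (0:ℝ) < 2 ^ L := by positivity
            rw [ENNReal.ofReal_rpow_of_pos hp, ENNReal.ofReal_rpow_of_pos (inv_pos.mpr hp),
              ← ENNReal.ofReal_mul (by positivity), Real.inv_rpow hp.le, ← Real.rpow_neg hp.le,
              ← Real.rpow_add hp, show q + -(q - 1) = 1 by ring, Real.rpow_one]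
          rw [e, mul_comm]
  calc ∑ v, ENNReal.ofReal (|fL L g v| ^ q)
      ≤ ∑ v, ENNReal.ofReal (2 ^ L) * ∫⁻ y in cellX L v, ‖g y‖ₑ ^ q ∂(nu L) :=
        Finset.sum_le_sum fun v _ => hcell v
    _ = ENNReal.ofReal (2 ^ L) * ∫⁻ y, ‖g y‖ₑ ^ q ∂(nu L) := by
        rw [← Finset.mul_sum]
        congr 1
        have hU : ⋃ v, cellX L v = univ := by
          ext y; simp [cellX]
        rw [← setLIntegral_univ (μ := nu L), ← hU, lintegral_iUnion (measurableSet_cellX L), tsum_fintype]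
        intro v w hvw
        rw [Function.onFun, disjoint_left]
        intro y h1 h2
        exact hvw (by simp only [cellX, mem_preimage, mem_singleton_iff] at h1 h2; rw [← h1, h2])
    _ ≤ _ := mul_le_mul_right (lintegral_mono' (nu_le L) le_rfl) _
end HE

namespace HE

lemma ds_congr (a : Set ℝ → ℝ) {x y : ℝ} {k z : ℤ} (h : ⌊x / 2 ^ k⌋ = ⌊y / 2 ^ k⌋) (hz : k ≤ z) :
    dyadicSum a x z = dyadicSum a y z := by
  obtain ⟨t, rfl⟩ := Int.le.dest hz
  rw [dyadicSum_eq, dyadicSum_eq, floor_shift, floor_shift, h]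

lemma Vr_ds (r : ℝ) (a : Set ℝ → ℝ) {x y : ℝ} {k : ℤ} (h : ⌊x / 2 ^ k⌋ = ⌊y / 2 ^ k⌋) :
    Vr r univ (dyadicSum a x) k = Vr r univ (dyadicSum a y) k := by
  unfold Vr
  rw [Vc_congr fun z hz => ds_congr a h hz]

/-- the conclusion of the finite theorem -/
def FinEst (q r K C e : ℝ) : Prop := ∀ (n : ℕ) (Ξ : Finset (Fin n → Bool)) (N : ℕ),
    1 ≤ N → Ξ.card ≤ N → ∀ (a φ : ℕ → (Fin n → Bool) → ℝ),
    (∀ k, ∀ ξ η, agF k ξ η → a k ξ = a k η) →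
    (∀ k, ∀ ξ η, agF k ξ η → φ k ξ = φ k η) →
    (∀ k ≤ n, ∀ ξ ∈ Ξ, |a k ξ| ≤ 1) →
    (∀ k ≤ n, ∀ ξ ∈ Ξ, 0 ≤ φ k ξ) → (∀ k ≤ n, ∀ ξ ∈ Ξ, φ k ξ ≤ 1) →
    (∀ k l, k ≤ l → l ≤ n → ∀ ξ ∈ Ξ, |a k ξ - a l ξ| ^ r ≤ φ k ξ - φ l ξ) →
    ∀ (M Φ : (Fin n → Bool) → ℝ), (∀ v, |M v| ≤ 1) → (∀ v, 0 ≤ Φ v) → (∀ v, Φ v ≤ K * N) →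
    (∀ v w, idx v ≤ idx w → |M v - M w| ^ r ≤ Φ v - Φ w) →
    ∀ f : (Fin n → Bool) → ℝ,
    (∑ x, S (fun k η => a k η * chi Ξ k η * M η) f x ^ q) ^ (1 / q) ≤
      C * (N : ℝ) ^ e * (∑ x, |f x| ^ q) ^ (1 / q)

lemma fin_step {q r C e : ℝ} (hr : 1 < r) (H : FinEst q r (2 ^ r) C e)
    (Ξ : Finset ℝ) (hΞ0 : ∀ η ∈ Ξ, 0 ≤ η) (a : Set ℝ → ℝ) (N : ℕ) (hN : 1 ≤ N) (hcard : Ξ.card ≤ N)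
    {A B : ℝ} (hA : 0 < A) (hB : 0 < B)
    (hAv : ∀ η ∈ Ξ, vnorm r (univ : Set ℤ) (dyadicSum a η) ≤ ENNReal.ofReal A)
    (M Φ : ℝ → ℝ) (hMB : ∀ x, 0 ≤ x → |M x| ≤ B) (hΦ0 : ∀ x, 0 ≤ Φ x) (hΦ : ∀ x, Φ x ≤ 2 ^ r * N * B ^ r)
    (hMΦ : ∀ x y, 0 ≤ x → x ≤ y → |M x - M y| ^ r ≤ Φ x - Φ y)
    (L : ℕ) (hΞL : ∀ η ∈ Ξ, η < 2 ^ L) (f : (Fin (2 * L) → Bool) → ℝ) :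
    (∑ x, S (fun κ v => (aL a L κ v / A) * chi (Ξ.image (vecF L)) κ v * (M (pt L v) / B)) f x ^ q) ^ (1 / q) ≤
      C * (N : ℝ) ^ e * (∑ x, |f x| ^ q) ^ (1 / q) := by
  have hr0 : 0 < r := by linarith
  have hAr : 0 < A ^ r := Real.rpow_pos_of_pos hA r
  have hBr : 0 < B ^ r := Real.rpow_pos_of_pos hB r
  have hfl : ∀ (κ : ℕ), ∀ η ∈ Ξ, ⌊pt L (vecF L η) / 2 ^ ((κ : ℤ) - L)⌋ = ⌊η / 2 ^ ((κ : ℤ) - L)⌋ :=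
    fun κ η hη => floor_vecF κ (hΞ0 η hη) (hΞL η hη)
  have haη : ∀ (κ : ℕ), ∀ η ∈ Ξ, aL a L κ (vecF L η) = dyadicSum a η ((κ : ℤ) - L) :=
    fun κ η hη => ds_congr a (hfl κ η hη) le_rfl
  have hdiv : ∀ (x y c : ℝ), 0 < c → |x / c - y / c| ^ r = |x - y| ^ r / c ^ r := by
    intro x y c hc
    rw [← sub_div, abs_div, abs_of_pos hc, Real.div_rpow (abs_nonneg _) hc.le]
  refine H (2 * L) (Ξ.image (vecF L)) N hN (Finset.card_image_le.trans hcard)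
    (fun κ v => aL a L κ v / A) (fun κ v => Vr r univ (dyadicSum a (pt L v)) ((κ : ℤ) - L) / A ^ r)
    ?_ ?_ ?_ ?_ ?_ ?_ (fun v => M (pt L v) / B) (fun v => Φ (pt L v) / B ^ r) ?_ ?_ ?_ ?_ f
  · intro k ξ η h
    simp only [aL_inv a h]
  · intro k ξ η h
    simp only [Vr_ds r a (agF_floor.1 h)]
  · intro k _ ξ hξ
    obtain ⟨η, hη, rfl⟩ := Finset.mem_image.1 hξ
    rw [haη k η hη, abs_div, abs_of_pos hA, div_le_one hA]
    exact abs_le_of_vnorm hA.le (hAv η hη) (mem_univ _)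
  · intro k _ ξ _
    exact div_nonneg (Vr_nonneg _ _ _ _) hAr.le
  · intro k _ ξ hξ
    obtain ⟨η, hη, rfl⟩ := Finset.mem_image.1 hξ
    rw [Vr_ds r a (hfl k η hη), div_le_one hAr]
    exact Vr_le hr0 hA.le (hAv η hη) _
  · intro k l hkl _ ξ hξ
    obtain ⟨η, hη, rfl⟩ := Finset.mem_image.1 hξ
    rw [Vr_ds r a (hfl k η hη), Vr_ds r a (hfl l η hη), haη k η hη, haη l η hη, hdiv _ _ _ hA, ← sub_div]
    apply div_le_div_of_nonneg_right _ hAr.le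
    exact Vr_super hr0 (ne_top_of_le_ne_top ENNReal.ofReal_ne_top (hAv η hη)) (mem_univ _) (mem_univ _)
      (by omega)
  · intro v
    rw [abs_div, abs_of_pos hB, div_le_one hB]
    exact hMB _ (pt_nonneg L v)
  · intro v; exact div_nonneg (hΦ0 _) hBr.le
  · intro v
    rw [div_le_iff₀ hBr]; exact hΦ _
  · intro v w hvw
    rw [hdiv _ _ _ hB, ← sub_div]
    apply div_le_div_of_nonneg_right _ hBr.le
    apply hMΦ _ _ (pt_nonneg L v)
    unfold pt
    have : (idx v : ℝ) ≤ idx w := by exact_mod_cast hvw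
    gcongr

lemma T_const {n : ℕ} (c : ℝ) (m f : (Fin n → Bool) → ℝ) (x) : T (fun v => c * m v) f x = c * T m f x := by
  unfold T
  rw [mul_left_comm, Finset.mul_sum (a := c)]
  congr 1
  exact Finset.sum_congr rfl fun v _ => by ring

theorem coreR {q r C e : ℝ} (hq : 1 < q) (hr : 1 < r) (hC : 0 < C) (H : FinEst q r (2 ^ r) C e)
    (Ξ : Finset ℝ) (hΞ0 : ∀ η ∈ Ξ, 0 ≤ η) (a : Set ℝ → ℝ) (N : ℕ) (hN : 1 ≤ N) (hcard : Ξ.card ≤ N)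
    {A B : ℝ} (hA : 0 < A) (hB : 0 < B)
    (hAv : ∀ η ∈ Ξ, vnorm r (univ : Set ℤ) (dyadicSum a η) ≤ ENNReal.ofReal A)
    (M Φ : ℝ → ℝ) (hMB : ∀ x, 0 ≤ x → |M x| ≤ B) (hΦ0 : ∀ x, 0 ≤ Φ x) (hΦ : ∀ x, Φ x ≤ 2 ^ r * N * B ^ r)
    (hMΦ : ∀ x y, 0 ≤ x → x ≤ y → |M x - M y| ^ r ≤ Φ x - Φ y)
    (g : ℝ → ℝ) (hg : Integrable g μplus) :
    ∫⁻ x, (⨆ k : ℤ, (‖walshFT (fun ξ => Dk a Ξ k ξ * M ξ * walshFT g ξ) x‖₊ : ℝ≥0∞)) ^ q ∂μplus ≤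
      ENNReal.ofReal (A * B * (C * (N : ℝ) ^ e)) ^ q * ∫⁻ y, ‖g y‖ₑ ^ q ∂μplus := by
  have hq0 : 0 < q := by linarith
  have hr0 : 0 < r := by linarith
  have hNe : 0 < C * (N : ℝ) ^ e := by
    have : (0:ℝ) < N := by exact_mod_cast hN
    positivity
  let m' : (L : ℕ) → ℕ → (Fin (2 * L) → Bool) → ℝ := fun L κ v =>
    (aL a L κ v / A) * chi (Ξ.image (vecF L)) κ v * (M (pt L v) / B)
  let h : (L : ℕ) → (Fin (2 * L) → Bool) → ℝ≥0∞ := fun L v =>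
    ENNReal.ofReal (A * B * S (m' L) (fL L g) v) ^ q
  let F : ℕ → ℝ → ℝ≥0∞ := fun L => (Ico (0:ℝ) (2 ^ L)).indicator fun x => h L (vecX L x)
  have hFm : ∀ L, Measurable (F L) := fun L =>
    ((measurable_of_finite (h L)).comp (measurable_vecX L)).indicator measurableSet_Ico
  have hMt := M_tendsto M Φ hr0 hMΦ
  have hT := fun (k : ℤ) {x : ℝ} (hx : 0 ≤ x) => T_tendsto a Ξ hΞ0 M B hMB hMt g hg k hx
  have hΞL : ∀ᶠ L : ℕ in atTop, ∀ η ∈ Ξ, η < 2 ^ L := by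
    rw [Filter.eventually_all_finset]
    exact fun η _ => ev_lt η
  -- pointwise
  have hpt : ∀ x, 0 ≤ x →
      (⨆ k : ℤ, (‖walshFT (fun ξ => Dk a Ξ k ξ * M ξ * walshFT g ξ) x‖₊ : ℝ≥0∞)) ^ q ≤
        liminf (fun L => F L x) atTop := by
    intro x hx
    have h1 : ⨆ k : ℤ, (‖walshFT (fun ξ => Dk a Ξ k ξ * M ξ * walshFT g ξ) x‖₊ : ℝ≥0∞) ≤
        (liminf (fun L => F L x) atTop) ^ (1 / q) := by
      refine iSup_le fun k => ?_
      rw [one_div, ENNReal.le_rpow_inv_iff hq0]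
      have h2 : Tendsto (fun L : ℕ => ENNReal.ofReal |T (fun v => aL a L (k + L).toNat v *
          chi (Ξ.image (vecF L)) (k + L).toNat v * M (pt L v)) (fL L g) (vecX L x)| ^ q) atTop
          (nhds ((‖walshFT (fun ξ => Dk a Ξ k ξ * M ξ * walshFT g ξ) x‖₊ : ℝ≥0∞) ^ q)) := by
        have h3 := (ENNReal.continuous_rpow_const (y := q)).continuousAt.tendsto.comp
          (ENNReal.tendsto_ofReal (hT k hx).abs)
        have h4 : (‖walshFT (fun ξ => Dk a Ξ k ξ * M ξ * walshFT g ξ) x‖₊ : ℝ≥0∞) =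
          ENNReal.ofReal |walshFT (fun ξ => Dk a Ξ k ξ * M ξ * walshFT g ξ) x| :=
            Real.enorm_eq_ofReal_abs _
        rw [h4]
        exact h3
      rw [← h2.liminf_eq]
      refine liminf_le_liminf ?_
      filter_upwards [ev_lt x, eventually_ge_atTop k.natAbs] with L hxL hk
      simp only [F]
      rw [indicator_of_mem (show x ∈ Ico (0:ℝ) (2 ^ L) from ⟨hx, hxL⟩)]
      simp only [h]
      apply ENNReal.rpow_le_rpow _ hq0.le
      apply ENNReal.ofReal_le_ofReal
      have h5 : (fun v => aL a L (k + L).toNat v * chi (Ξ.image (vecF L)) (k + L).toNat v * M (pt L v)) =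
          fun v => (A * B) * m' L (k + L).toNat v := by
        funext v
        simp only [m']
        field_simp
      rw [h5, T_const, abs_mul, abs_of_pos (by positivity)]
      exact mul_le_mul_of_nonneg_left (le_S _ _ _ (by omega)) (by positivity)
    calc _ ≤ ((liminf (fun L => F L x) atTop) ^ (1 / q)) ^ q := ENNReal.rpow_le_rpow h1 hq0.le
      _ = _ := by rw [← ENNReal.rpow_mul, one_div, inv_mul_cancel₀ hq0.ne', ENNReal.rpow_one]
  -- integrals
  have hint : ∀ᶠ L : ℕ in atTop, ∫⁻ x, F L x ∂μplus ≤
      ENNReal.ofReal (A * B * (C * (N : ℝ) ^ e)) ^ q * ∫⁻ y, ‖g y‖ₑ ^ q ∂μplus := by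
    filter_upwards [hΞL] with L hL
    have e1 : ∫⁻ x, F L x ∂μplus = ∫⁻ x, h L (vecX L x) ∂(nu L) := by
      simp only [F]
      rw [lintegral_indicator measurableSet_Ico]
      unfold μplus nu
      rw [Measure.restrict_restrict measurableSet_Ico]
      congr 2
      ext z; simp only [mem_inter_iff, mem_Ico, mem_Ici]; tauto
    rw [e1, lintegral_vecX]
    have h6 := fin_step hr H Ξ hΞ0 a N hN hcard hA hB hAv M Φ hMB hΦ0 hΦ hMΦ L hL (fL L g)
    have hS0 : ∀ x, 0 ≤ S (m' L) (fL L g) x := fun x => S_nonneg _ _ _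
    have hs1 : 0 ≤ ∑ x, S (m' L) (fL L g) x ^ q := Finset.sum_nonneg fun x _ => Real.rpow_nonneg (hS0 x) q
    have hs2 : 0 ≤ ∑ x, |fL L g x| ^ q := Finset.sum_nonneg fun x _ => Real.rpow_nonneg (abs_nonneg _) q
    have h7 : ∑ x, S (m' L) (fL L g) x ^ q ≤ (C * (N : ℝ) ^ e) ^ q * ∑ x, |fL L g x| ^ q := by
      have := Real.rpow_le_rpow (Real.rpow_nonneg hs1 _) h6 hq0.le
      rw [Real.mul_rpow hNe.le (Real.rpow_nonneg hs2 _), ← Real.rpow_mul hs1, ← Real.rpow_mul hs2,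
        one_div, inv_mul_cancel₀ hq0.ne', Real.rpow_one, Real.rpow_one] at this
      exact this
    have h8 : ∑ v, h L v = ENNReal.ofReal ((A * B) ^ q * ∑ x, S (m' L) (fL L g) x ^ q) := by
      rw [Finset.mul_sum, ENNReal.ofReal_sum_of_nonneg]
      · refine Finset.sum_congr rfl fun v _ => ?_
        simp only [h]
        rw [ENNReal.ofReal_rpow_of_nonneg (mul_nonneg (by positivity) (hS0 v)) hq0.le,
          Real.mul_rpow (by positivity) (hS0 v)]
      · intro v _
        exact mul_nonneg (by positivity) (Real.rpow_nonneg (hS0 v) q)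
    have h9 : ENNReal.ofReal (∑ x, |fL L g x| ^ q) ≤ ENNReal.ofReal (2 ^ L) * ∫⁻ y, ‖g y‖ₑ ^ q ∂μplus := by
      rw [ENNReal.ofReal_sum_of_nonneg fun x _ => Real.rpow_nonneg (abs_nonneg _) q]
      exact fL_bound q hq L g hg
    calc ENNReal.ofReal ((2 ^ L)⁻¹) * ∑ v, h L v
        ≤ ENNReal.ofReal ((2 ^ L)⁻¹) * (ENNReal.ofReal (A * B * (C * (N : ℝ) ^ e)) ^ q *
            ENNReal.ofReal (∑ x, |fL L g x| ^ q)) := by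
          apply mul_le_mul_right
          rw [h8, ENNReal.ofReal_rpow_of_pos (by positivity), ← ENNReal.ofReal_mul (by positivity)]
          apply ENNReal.ofReal_le_ofReal
          rw [Real.mul_rpow (by positivity) hNe.le, mul_assoc]
          exact mul_le_mul_of_nonneg_left h7 (by positivity)
      _ ≤ ENNReal.ofReal ((2 ^ L)⁻¹) * (ENNReal.ofReal (A * B * (C * (N : ℝ) ^ e)) ^ q *
            (ENNReal.ofReal (2 ^ L) * ∫⁻ y, ‖g y‖ₑ ^ q ∂μplus)) :=
          mul_le_mul_right (mul_le_mul_right h9 _) _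
      _ = _ := by
          rw [mul_left_comm, ← mul_assoc (ENNReal.ofReal ((2 ^ L)⁻¹)), ← ENNReal.ofReal_mul (by positivity),
            inv_mul_cancel₀ (by positivity), ENNReal.ofReal_one, one_mul]
  calc ∫⁻ x, (⨆ k : ℤ, (‖walshFT (fun ξ => Dk a Ξ k ξ * M ξ * walshFT g ξ) x‖₊ : ℝ≥0∞)) ^ q ∂μplus
      ≤ ∫⁻ x, liminf (fun L => F L x) atTop ∂μplus := by
        apply lintegral_mono_ae
        have h1 : ∀ᵐ y ∂μplus, y ∈ Ici (0 : ℝ) := ae_restrict_mem measurableSet_Ici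
        filter_upwards [h1] with x hx
        exact hpt x hx
    _ ≤ liminf (fun L => ∫⁻ x, F L x ∂μplus) atTop := lintegral_liminf_le hFm
    _ ≤ _ := by
        refine (liminf_le_liminf hint).trans (le_of_eq ?_)
        exact tendsto_const_nhds.liminf_eq

lemma walshFT_zero {f : ℝ → ℝ} (h : ∀ x, 0 ≤ x → f x = 0) (ξ : ℝ) : walshFT f ξ = 0 := by
  unfold walshFT
  rw [setIntegral_congr_fun (g := fun _ => (0:ℝ)) measurableSet_Ici fun x hx => by simp [h x hx]]
  simp

lemma Mqstar_zero {q : ℝ} (hq : 0 < q) (m : ℤ → ℝ → ℝ) (h : ∀ k x, 0 ≤ x → m k x = 0) : Mqstar q m = 0 := by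
  unfold Mqstar lpNormE
  simp only [ENNReal.iSup_eq_zero]
  intro g _
  have : ∀ x k, walshFT (fun ξ => m k ξ * walshFT g ξ) x = 0 := fun x k =>
    walshFT_zero (fun y hy => by rw [h k y hy, zero_mul]) x
  simp [this, hq]

theorem main (q r eps : ℝ) (hq1 : 1 < q) (hq2 : q ≤ 2) (hr1 : 2 < r)
    (hr2 : r < 2 * q) (heps : 0 < eps) :
    ∃ C : ℝ, 0 < C ∧ ∀ Ξ : Set ℝ, Ξ.Finite → Ξ ⊆ Set.Ici 0 → ∀ a : Set ℝ → ℝ,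
      ∀ Y : Set (Set ℝ), Y.Finite → Y.PairwiseDisjoint id →
      (∀ v ∈ Y, v ⊆ Set.Ici 0 ∧ v.OrdConnected) → ∀ m : Set ℝ → ℝ → ℝ,
        (∀ v ∈ Y, (∀ x, m v x ≠ 0 → x ∈ v) ∧ vnorm r (Set.Ici 0) (m v) ≠ ⊤) →
        Mqstar q (fun k ξ => Dk a Ξ k ξ * ∑ᶠ v ∈ Y, m v ξ) ≤
          ENNReal.ofReal C * ((Ξ.ncard + Y.ncard : ℕ) : ℝ≥0∞) ^ (1 / q - 1 / r + eps) *
            (⨆ ξ ∈ Ξ, vnorm r (Set.univ : Set ℤ) (dyadicSum a ξ)) *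
            ⨆ v ∈ Y, vnorm r (Set.Ici 0) (m v) := by
  have hq0 : 0 < q := by linarith
  have hr0 : 0 < r := by linarith
  obtain ⟨C, hC, H⟩ := finite_est2 q r eps (2 ^ r) hq1 hq2 hr1 hr2 heps (by positivity)
  have H' : FinEst q r (2 ^ r) C (1 / q - 1 / r + eps) := H
  refine ⟨C, hC, ?_⟩
  intro Ξ hΞ hΞ0 a Y hY hdis hYi m hm
  set A := ⨆ ξ ∈ Ξ, vnorm r (Set.univ : Set ℤ) (dyadicSum a ξ) with hAdef
  set B := ⨆ v ∈ Y, vnorm r (Set.Ici 0) (m v) with hBdef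
  have hAle : ∀ ξ ∈ Ξ, vnorm r (Set.univ : Set ℤ) (dyadicSum a ξ) ≤ A := fun ξ hξ =>
    le_iSup₂ (f := fun ξ (_ : ξ ∈ Ξ) => vnorm r (Set.univ : Set ℤ) (dyadicSum a ξ)) ξ hξ
  have hBle : ∀ v ∈ Y, vnorm r (Set.Ici 0) (m v) ≤ B := fun v hv =>
    le_iSup₂ (f := fun v (_ : v ∈ Y) => vnorm r (Set.Ici 0) (m v)) v hv
  have hsum : ∀ ξ, ∑ᶠ v ∈ Y, m v ξ = ∑ v ∈ hY.toFinset, m v ξ := fun ξ =>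
    finsum_mem_eq_finite_toFinset_sum _ hY
  by_cases hA0 : A = 0
  · rw [Mqstar_zero hq0]
    · exact zero_le
    intro k x hx
    have : Dk a Ξ k x = 0 := by
      rw [Dk_eq]
      split_ifs with h
      · obtain ⟨η, h1, h2⟩ := h
        have h3 := hAle η h1
        rw [hA0, ← ENNReal.ofReal_zero] at h3
        have h4 := abs_nonpos_iff.1 (abs_le_of_vnorm le_rfl h3 (mem_univ k))
        rwa [dyadicSum_eq, h2] at h4
      · rfl
    rw [this, zero_mul]
  by_cases hB0 : B = 0
  · rw [Mqstar_zero hq0]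
    · exact zero_le
    intro k x hx
    rw [hsum, Finset.sum_eq_zero, mul_zero]
    intro v hv
    have h1 := hBle v (hY.mem_toFinset.1 hv)
    rw [hB0, ← ENNReal.ofReal_zero] at h1
    have := abs_le_of_vnorm le_rfl h1 (show x ∈ Ici (0:ℝ) from hx)
    exact abs_nonpos_iff.1 this
  have hΞne : Ξ.Nonempty := by
    by_contra h
    rw [not_nonempty_iff_eq_empty] at h
    apply hA0
    rw [hAdef, h]; simp
  have hΞc : 1 ≤ Ξ.ncard := (Set.ncard_pos hΞ).2 hΞne
  set N := Ξ.ncard + Y.ncard with hN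
  have hNr : (0:ℝ) < N := by exact_mod_cast (by omega : 0 < N)
  have hNe : ((N : ℕ) : ℝ≥0∞) ^ (1 / q - 1 / r + eps) = ENNReal.ofReal ((N:ℝ) ^ (1 / q - 1 / r + eps)) := by
    rw [← ENNReal.ofReal_rpow_of_pos hNr, ENNReal.ofReal_natCast]
  rw [hNe]
  have hBt : B ≠ ⊤ := by
    have h1 : B ≤ ∑ v ∈ hY.toFinset, vnorm r (Set.Ici 0) (m v) := by
      refine iSup₂_le fun v hv => ?_
      exact Finset.single_le_sum (f := fun v => vnorm r (Set.Ici 0) (m v)) (fun _ _ => zero_le)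
        (hY.mem_toFinset.2 hv)
    refine ne_top_of_le_ne_top ?_ h1
    exact ENNReal.sum_ne_top.2 fun v hv => (hm v (hY.mem_toFinset.1 hv)).2
  by_cases hAt : A = ⊤
  · rw [hAt, ENNReal.mul_top, ENNReal.top_mul hB0]
    · exact le_top
    · apply mul_ne_zero
      · simpa using hC
      · simp only [ne_eq, ENNReal.ofReal_eq_zero, not_le]; positivity
  have hAp : 0 < A.toReal := ENNReal.toReal_pos hA0 hAt
  have hBp : 0 < B.toReal := ENNReal.toReal_pos hB0 hBt
  have hAr : ENNReal.ofReal A.toReal = A := ENNReal.ofReal_toReal hAt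
  have hBr : ENNReal.ofReal B.toReal = B := ENNReal.ofReal_toReal hBt
  let M : ℝ → ℝ := fun ξ => ∑ v ∈ hY.toFinset, m v ξ
  let Φ : ℝ → ℝ := fun ξ => 2 ^ r * ∑ v ∈ hY.toFinset, Vr r (Ici 0) (m v) ξ
  have hdis' : ∀ z, ∀ i ∈ hY.toFinset, ∀ j ∈ hY.toFinset, m i z ≠ 0 → m j z ≠ 0 → i = j := by
    intro z i hi j hj h1 h2
    rw [hY.mem_toFinset] at hi hj
    by_contra hij
    exact disjoint_left.1 (hdis hi hj hij) ((hm i hi).1 z h1) ((hm j hj).1 z h2)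
  have hMB : ∀ x, 0 ≤ x → |M x| ≤ B.toReal := by
    intro x hx
    refine sum_abs_le _ _ _ hBp.le x (hdis' x) fun i hi => ?_
    refine abs_le_of_vnorm (r := r) hBp.le ?_ (show x ∈ Ici (0:ℝ) from hx)
    rw [hBr]; exact hBle i (hY.mem_toFinset.1 hi)
  have hΦ0 : ∀ x, 0 ≤ Φ x := fun x => mul_nonneg (by positivity)
    (Finset.sum_nonneg fun v _ => Vr_nonneg _ _ _ _)
  have hΦ : ∀ x, Φ x ≤ 2 ^ r * N * B.toReal ^ r := by
    intro x
    have h1 : ∑ v ∈ hY.toFinset, Vr r (Ici 0) (m v) x ≤ hY.toFinset.card • B.toReal ^ r := by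
      apply Finset.sum_le_card_nsmul
      intro v hv
      refine Vr_le hr0 hBp.le ?_ x
      rw [hBr]; exact hBle v (hY.mem_toFinset.1 hv)
    rw [nsmul_eq_mul, ← Set.ncard_eq_toFinset_card Y hY] at h1
    have h2 : (Y.ncard : ℝ) ≤ N := by exact_mod_cast (by omega : Y.ncard ≤ N)
    simp only [Φ]
    rw [mul_assoc]
    apply mul_le_mul_of_nonneg_left _ (by positivity)
    exact h1.trans (mul_le_mul_of_nonneg_right h2 (by positivity))
  have hMΦ : ∀ x y, 0 ≤ x → x ≤ y → |M x - M y| ^ r ≤ Φ x - Φ y := by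
    intro x y hx hxy
    refine (sum_control hY.toFinset m r (by linarith) x y hdis').trans ?_
    simp only [Φ]
    rw [← mul_sub, ← Finset.sum_sub_distrib]
    apply mul_le_mul_of_nonneg_left _ (by positivity)
    refine Finset.sum_le_sum fun v hv => ?_
    exact Vr_super hr0 (hm v (hY.mem_toFinset.1 hv)).2 hx (hx.trans hxy) hxy
  simp only [hsum]
  unfold Mqstar
  refine iSup₂_le fun g hg1 => ?_
  by_cases hg : Integrable g μplus
  swap
  · have : ∀ x k, walshFT (fun ξ => (Dk a Ξ k ξ * ∑ v ∈ hY.toFinset, m v ξ) * walshFT g ξ) x = 0 := fun x k =>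
      walshFT_zero (fun y hy => by rw [walshFT_nonint hy g hg, mul_zero]) x
    unfold lpNormE
    simp [this, hq0]
  have hg2 : ∫⁻ y, ‖g y‖ₑ ^ q ∂μplus = 1 := by
    rw [eLpNorm_eq_lintegral_rpow_enorm_toReal (by simpa using hq0) ENNReal.ofReal_ne_top,
      ENNReal.toReal_ofReal hq0.le] at hg1
    have := congrArg (· ^ q) hg1
    simp only [ENNReal.one_rpow] at this
    rwa [← ENNReal.rpow_mul, one_div, inv_mul_cancel₀ hq0.ne', ENNReal.rpow_one] at this
  have hcore := coreR hq1 (by linarith : 1 < r) hC H' hΞ.toFinset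
    (fun η hη => hΞ0 (hΞ.mem_toFinset.1 hη)) a N (by omega)
    (by rw [← Set.ncard_eq_toFinset_card Ξ hΞ]; omega) hAp hBp
    (fun η hη => by rw [hAr]; exact hAle η (hΞ.mem_toFinset.1 hη)) M Φ hMB hΦ0 hΦ hMΦ g hg
  rw [hg2, mul_one, hΞ.coe_toFinset] at hcore
  unfold lpNormE
  have h3 := ENNReal.rpow_le_rpow hcore (by positivity : 0 ≤ 1 / q)
  refine h3.trans (le_of_eq ?_)
  rw [← ENNReal.rpow_mul, mul_one_div_cancel hq0.ne', ENNReal.rpow_one, ENNReal.ofReal_mul (by positivity),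
    ENNReal.ofReal_mul hAp.le, ENNReal.ofReal_mul hC.le, hAr, hBr]
  ring

end HE

/-- Lemma 3.6 (hybrid estimate): for `1 < q ≤ 2`, `2 < r < 2q`,
`‖𝒟_k Σ_υ m_υ‖_{M^{q,*}} ≤ C_{q,r,ε} (|Ξ| + |Υ|)^{1/q - 1/r + ε}
  sup_{ξ ∈ Ξ} ‖Σ_{|ω| = 2^k} a_ω 1_ω(ξ)‖_{V^r_k} sup_υ ‖m_υ‖_{V^r}`. -/
theorem hybrid_estimate (q r eps : ℝ) (hq1 : 1 < q) (hq2 : q ≤ 2) (hr1 : 2 < r)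
    (hr2 : r < 2 * q) (heps : 0 < eps) :
    ∃ C : ℝ, 0 < C ∧ ∀ Ξ : Set ℝ, Ξ.Finite → Ξ ⊆ Set.Ici 0 → ∀ a : Set ℝ → ℝ,
      ∀ Y : Set (Set ℝ), Y.Finite → Y.PairwiseDisjoint id →
      (∀ v ∈ Y, v ⊆ Set.Ici 0 ∧ v.OrdConnected) → ∀ m : Set ℝ → ℝ → ℝ,
        (∀ v ∈ Y, (∀ x, m v x ≠ 0 → x ∈ v) ∧ vnorm r (Set.Ici 0) (m v) ≠ ⊤) →
        Mqstar q (fun k ξ => Dk a Ξ k ξ * ∑ᶠ v ∈ Y, m v ξ) ≤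
          ENNReal.ofReal C * ((Ξ.ncard + Y.ncard : ℕ) : ℝ≥0∞) ^ (1 / q - 1 / r + eps) *
            (⨆ ξ ∈ Ξ, vnorm r (Set.univ : Set ℤ) (dyadicSum a ξ)) *
            ⨆ v ∈ Y, vnorm r (Set.Ici 0) (m v) :=
  HE.main q r eps hq1 hq2 hr1 hr2 heps

end
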